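/- arXiv:1204.3963 — 2 statements merged into one kernel-verified Lean document; each statement's English description precedes it below -/
import Mathlib

section
/- (Rubio de Francia sharp extrapolation) Let T be an operator mapping measurable functions on ℝⁿ to measurable functions. Suppose that for some 1 < p₀ < ∞ there exist constants c > 0 and α > 0 such that for every weight w ∈ A_{p₀} and every f ∈ L^{p₀}(w) one has ‖Tf‖_{L^{p₀}(w)} ≤ c·[w]_{A_{p₀}}^α ‖f‖_{L^{p₀}(w)}. Then for every 1 < p < ∞ there exists a constant c_p > 0 (independent of the weight) such that for every weight w ∈ A_p and every f ∈ L^p(w), ‖Tf‖_{L^p(w)} ≤ c_p·[w]_{A_p}^{α·max(1,(p₀−1)/(p−1))} ‖f‖_{L^p(w)}. -/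
open MeasureTheory Set Filter ENNReal

noncomputable section

/-- An axis-parallel cube in `ℝⁿ` with positive side length. -/
def IsCube {n : ℕ} (Q : Set (Fin n → ℝ)) : Prop :=
  ∃ (a : Fin n → ℝ) (r : ℝ), 0 < r ∧ Q = Set.Icc a (fun i => a i + r)

/-- The average `|Q|⁻¹ ∫_Q f dx` (of the nonnegative part of `f`), as a value in `ℝ≥0∞`. -/
def avg {n : ℕ} (Q : Set (Fin n → ℝ)) (f : (Fin n → ℝ) → ℝ) : ℝ≥0∞ :=
  (∫⁻ x in Q, ENNReal.ofReal (f x)) / volume Q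

/-- A weight on `ℝⁿ`: a positive (almost everywhere) locally integrable function. -/
def IsWeight {n : ℕ} (w : (Fin n → ℝ) → ℝ) : Prop :=
  (∀ᵐ x ∂(volume : Measure (Fin n → ℝ)), 0 < w x) ∧ LocallyIntegrable w volume

/-- The `A_p` characteristic `sup_Q (|Q|⁻¹∫_Q w)(|Q|⁻¹∫_Q w^{-1/(p-1)})^{p-1}`,
as a value in `ℝ≥0∞`. -/
def apCharE {n : ℕ} (p : ℝ) (w : (Fin n → ℝ) → ℝ) : ℝ≥0∞ :=
  ⨆ (Q : Set (Fin n → ℝ)) (_ : IsCube Q),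
    avg Q w * (avg Q (fun x => w x ^ (-(1 / (p - 1))))) ^ (p - 1)

/-- The `A_p` characteristic of `w`, as a real number. -/
def apChar {n : ℕ} (p : ℝ) (w : (Fin n → ℝ) → ℝ) : ℝ :=
  (apCharE p w).toReal

/-- Membership in the Muckenhoupt class `A_p`: `w` is a weight with finite `A_p`
characteristic. -/
def MemAp {n : ℕ} (p : ℝ) (w : (Fin n → ℝ) → ℝ) : Prop :=
  IsWeight w ∧ apCharE p w ≠ ⊤

/-- The non-centered Hardy–Littlewood maximal function (`ℝ≥0∞`-valued):
`Mf(x) = sup_{Q ∋ x} |Q|⁻¹ ∫_Q |f|`. -/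
def maximalE {n : ℕ} (f : (Fin n → ℝ) → ℝ) (x : Fin n → ℝ) : ℝ≥0∞ :=
  ⨆ (Q : Set (Fin n → ℝ)) (_ : IsCube Q) (_ : x ∈ Q), avg Q (fun y => |f y|)

/-- The non-centered Hardy–Littlewood maximal function, real-valued. -/
def maximal {n : ℕ} (f : (Fin n → ℝ) → ℝ) (x : Fin n → ℝ) : ℝ :=
  (maximalE f x).toReal

/-- The norm `(∫ |f|^p w dx)^{1/p}` of `f` in `L^p(w)`, as a value in `ℝ≥0∞`. -/
def eLpNormW {n : ℕ} (p : ℝ) (w f : (Fin n → ℝ) → ℝ) : ℝ≥0∞ :=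
  (∫⁻ x, ENNReal.ofReal (|f x| ^ p) * ENNReal.ofReal (w x)) ^ (1 / p)

/-- Membership in `L^p(w)`: `f` is measurable with finite `L^p(w)` norm. -/
def MemLpW {n : ℕ} (p : ℝ) (w f : (Fin n → ℝ) → ℝ) : Prop :=
  Measurable f ∧ eLpNormW p w f ≠ ⊤

/-- `T` is (strongly) bounded on `L^p(w)` with constant `c`:
`‖Tf‖_{L^p(w)} ≤ c ‖f‖_{L^p(w)}` for all `f ∈ L^p(w)`. -/
def StrongBound {n : ℕ} (p : ℝ) (w : (Fin n → ℝ) → ℝ)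
    (T : ((Fin n → ℝ) → ℝ) → (Fin n → ℝ) → ℝ) (c : ℝ) : Prop :=
  ∀ f, MemLpW p w f → eLpNormW p w (T f) ≤ ENNReal.ofReal c * eLpNormW p w f

/-- The operator norm of `T` on `L^p(w)`: the least constant in a strong bound. -/
def opNorm {n : ℕ} (p : ℝ) (w : (Fin n → ℝ) → ℝ)
    (T : ((Fin n → ℝ) → ℝ) → (Fin n → ℝ) → ℝ) : ℝ :=
  sInf { c : ℝ | 0 ≤ c ∧ StrongBound p w T c }

/-- The `w`-measure `w(E) = ∫_E w dx` of a set `E`. -/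
def wMeasure {n : ℕ} (w : (Fin n → ℝ) → ℝ) (E : Set (Fin n → ℝ)) : ℝ≥0∞ :=
  ∫⁻ x in E, ENNReal.ofReal (w x)

/-- `T` is of weak type `(p,p)` with respect to `w`, with constant `c`:
`λ · w({|Tf| > λ})^{1/p} ≤ c ‖f‖_{L^p(w)}` for all `λ > 0` and `f ∈ L^p(w)`. -/
def WeakBound {n : ℕ} (p : ℝ) (w : (Fin n → ℝ) → ℝ)
    (T : ((Fin n → ℝ) → ℝ) → (Fin n → ℝ) → ℝ) (c : ℝ) : Prop :=
  ∀ f, MemLpW p w f → ∀ lam : ℝ, 0 < lam →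
    ENNReal.ofReal lam * wMeasure w {x | lam < |T f x|} ^ (1 / p)
      ≤ ENNReal.ofReal c * eLpNormW p w f

/-- The weak-type `(p,p)` norm `‖T‖_{L^p(w) → L^{p,∞}(w)}`: the least constant in a
weak bound. -/
def weakNorm {n : ℕ} (p : ℝ) (w : (Fin n → ℝ) → ℝ)
    (T : ((Fin n → ℝ) → ℝ) → (Fin n → ℝ) → ℝ) : ℝ :=
  sInf { c : ℝ | 0 ≤ c ∧ WeakBound p w T c }

/-- Membership in `A₁`: `u` is a weight with `Mu ≤ c·u` a.e. for some `c`. -/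
def MemA1 {n : ℕ} (u : (Fin n → ℝ) → ℝ) : Prop :=
  IsWeight u ∧ ∃ c : ℝ, ∀ᵐ x ∂(volume : Measure (Fin n → ℝ)),
    maximalE u x ≤ ENNReal.ofReal (c * u x)

/-- The `A₁` characteristic of `u`: the least `c` with `Mu ≤ c·u` a.e. -/
def a1Char {n : ℕ} (u : (Fin n → ℝ) → ℝ) : ℝ :=
  sInf { c : ℝ | ∀ᵐ x ∂(volume : Measure (Fin n → ℝ)),
    maximalE u x ≤ ENNReal.ofReal (c * u x) }

/-- The dual maximal operator `M'f = M(fw)/w`. -/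
def dualMax {n : ℕ} (w : (Fin n → ℝ) → ℝ) (f : (Fin n → ℝ) → ℝ)
    (x : Fin n → ℝ) : ℝ :=
  maximal (fun y => f y * w y) x / w x

namespace RdF

/-- Centered maximal operator over closed sup-norm balls of rational radius. -/
def Mc {n : ℕ} (μ : Measure (Fin n → ℝ)) (f : (Fin n → ℝ) → ℝ≥0∞) (x : Fin n → ℝ) : ℝ≥0∞ :=
  ⨆ (q : ℚ) (_ : 0 < q), (∫⁻ y in Metric.closedBall x (q : ℝ), f y ∂μ) /
    μ (Metric.closedBall x (q : ℝ))

lemma measurable_ballint {n : ℕ} (μ : Measure (Fin n → ℝ)) [SFinite μ]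
    {f : (Fin n → ℝ) → ℝ≥0∞} (hf : Measurable f) (r : ℝ) :
    Measurable (fun x => ∫⁻ y in Metric.closedBall x r, f y ∂μ) := by
  have h1 : MeasurableSet {z : (Fin n → ℝ) × (Fin n → ℝ) | dist z.2 z.1 ≤ r} :=
    (isClosed_le (by fun_prop) (by fun_prop)).measurableSet
  have h2 : Measurable (fun z : (Fin n → ℝ) × (Fin n → ℝ) =>
      {z : (Fin n → ℝ) × (Fin n → ℝ) | dist z.2 z.1 ≤ r}.indicator (fun z => f z.2) z) :=
    (hf.comp measurable_snd).indicator h1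
  have h3 := h2.lintegral_prod_right' (ν := μ)
  convert h3 using 2 with x
  rw [← lintegral_indicator Metric.isClosed_closedBall.measurableSet]
  rfl

lemma measurable_ballmeas {n : ℕ} (μ : Measure (Fin n → ℝ)) [SFinite μ] (r : ℝ) :
    Measurable (fun x => μ (Metric.closedBall x r)) := by
  simpa using measurable_ballint μ (f := fun _ => 1) measurable_const r

lemma measurable_Mc {n : ℕ} (μ : Measure (Fin n → ℝ)) [SFinite μ]
    {f : (Fin n → ℝ) → ℝ≥0∞} (hf : Measurable f) : Measurable (Mc μ f) := by
  refine Measurable.iSup fun q => Measurable.iSup fun _ => ?_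
  exact (measurable_ballint μ hf _).div (measurable_ballmeas μ _)

/-- Besicovitch multiplicity constant. -/
lemma exists_besi (n : ℕ) : ∃ N : ℕ, ∀ (μ : Measure (Fin n → ℝ)) [SFinite μ]
    (f : (Fin n → ℝ) → ℝ≥0∞), Measurable f → ∀ lam : ℝ≥0∞,
    lam * μ {x | lam < Mc μ f x} ≤ N * ∫⁻ y, f y ∂μ := by
  obtain ⟨N, τ, hτ, hN⟩ := HasBesicovitchCovering.no_satelliteConfig (α := Fin n → ℝ)
  refine ⟨N, fun μ _ f hf lam => ?_⟩
  let E : ℕ → Set (Fin n → ℝ) := fun R => {x | ∃ q : ℚ, 0 < q ∧ (q : ℝ) ≤ R ∧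
    lam < (∫⁻ y in Metric.closedBall x (q : ℝ), f y ∂μ) / μ (Metric.closedBall x (q : ℝ))}
  have hE : {x | lam < Mc μ f x} = ⋃ R, E R := by
    ext x
    simp only [Mc, mem_ofPred_eq, lt_iSup_iff, mem_iUnion, E]
    constructor
    · rintro ⟨q, hq, h⟩
      obtain ⟨R, hR⟩ := exists_nat_ge (q : ℝ)
      exact ⟨R, q, hq, hR, h⟩
    · rintro ⟨R, q, hq, -, h⟩
      exact ⟨q, hq, h⟩
  have hmono : Monotone E := by
    intro a b hab x
    rintro ⟨q, hq, h1, h2⟩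
    exact ⟨q, hq, h1.trans (by exact_mod_cast hab), h2⟩
  rw [hE, hmono.measure_iUnion, ENNReal.mul_iSup]
  refine iSup_le fun R => ?_
  have hsel : ∀ x : E R, ∃ q : ℚ, 0 < q ∧ (q : ℝ) ≤ R ∧
    lam < (∫⁻ y in Metric.closedBall x.1 (q : ℝ), f y ∂μ) / μ (Metric.closedBall x.1 (q : ℝ)) :=
    fun x => x.2
  choose r hr0 hrR hr using hsel
  let Q : Besicovitch.BallPackage (E R) (Fin n → ℝ) :=
    { c := fun x => x.1
      r := fun x => (r x : ℝ)
      rpos := fun x => by exact_mod_cast hr0 x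
      r_bound := R
      r_le := hrR }
  obtain ⟨s, hs1, hs2⟩ := Besicovitch.exist_disjoint_covering_families hτ hN Q
  have hcount : ∀ i, (s i).Countable := by
    intro i
    refine (hs1 i).countable_of_nonempty_interior fun j _ => ?_
    refine ⟨Q.c j, Metric.ball_subset_interior_closedBall (Metric.mem_ball_self (Q.rpos j))⟩
  have hsub : E R ⊆ ⋃ i : Fin N, ⋃ j ∈ s i, Metric.closedBall (Q.c j) (Q.r j) := by
    intro x hx
    have : x ∈ range Q.c := ⟨⟨x, hx⟩, rfl⟩
    have h := hs2 this
    simp only [mem_iUnion] at h ⊢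
    obtain ⟨i, j, hj, h⟩ := h
    exact ⟨i, j, hj, Metric.ball_subset_closedBall h⟩
  calc lam * μ (E R) ≤ lam * ∑ i : Fin N, ∑' j : s i, μ (Metric.closedBall (Q.c j) (Q.r j)) := by
        gcongr
        refine (measure_mono hsub).trans ((measure_iUnion_fintype_le _ _).trans ?_)
        refine Finset.sum_le_sum fun i _ => ?_
        exact measure_biUnion_le μ (hcount i) _
    _ = ∑ i : Fin N, ∑' j : s i, lam * μ (Metric.closedBall (Q.c j) (Q.r j)) := by
        rw [Finset.mul_sum]
        simp_rw [ENNReal.tsum_mul_left]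
    _ ≤ ∑ i : Fin N, ∑' j : s i, ∫⁻ y in Metric.closedBall (Q.c j) (Q.r j), f y ∂μ := by
        gcongr with i _ j
        exact (ENNReal.mul_lt_of_lt_div (hr j)).le
    _ ≤ ∑ i : Fin N, ∫⁻ y, f y ∂μ := by
        gcongr with i _
        have := (hcount i).to_subtype
        rw [← lintegral_iUnion (fun j => Metric.isClosed_closedBall.measurableSet)]
        · exact setLIntegral_le_lintegral _ _
        · intro a b hab
          exact hs1 i a.2 b.2 (fun h => hab (Subtype.ext h))
    _ = N * ∫⁻ y, f y ∂μ := by simp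

lemma Mc_mono {n : ℕ} (μ : Measure (Fin n → ℝ)) {f g : (Fin n → ℝ) → ℝ≥0∞} (h : ∀ x, f x ≤ g x)
    (x : Fin n → ℝ) : Mc μ f x ≤ Mc μ g x := by
  unfold Mc
  gcongr with q hq y
  exact h y

lemma Mc_add_const {n : ℕ} (μ : Measure (Fin n → ℝ)) {f : (Fin n → ℝ) → ℝ≥0∞} (c : ℝ≥0∞)
    (x : Fin n → ℝ) : Mc μ (fun y => f y + c) x ≤ Mc μ f x + c := by
  refine iSup₂_le fun q hq => ?_
  rw [lintegral_add_right _ measurable_const, ENNReal.add_div]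
  gcongr
  · exact le_iSup₂ (f := fun (q : ℚ) (_ : 0 < q) =>
      (∫⁻ y in Metric.closedBall x (q : ℝ), f y ∂μ) / μ (Metric.closedBall x (q : ℝ))) q hq
  · rw [setLIntegral_const]
    exact ENNReal.div_le_of_le_mul le_rfl

/-- Layer-cake identity for one number. -/
lemma layer (s : ℝ) (hs : 0 < s) (a : ℝ≥0∞) :
    ∫⁻ t in Ioi (0 : ℝ), ENNReal.ofReal (t ^ (s - 1)) * (if ENNReal.ofReal t < a then 1 else 0)
      = a ^ s / ENNReal.ofReal s := by
  have fin : ∀ b : ℝ, 0 ≤ b → ∫⁻ t in Ioi (0 : ℝ), ENNReal.ofReal (t ^ (s - 1)) *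
      (if ENNReal.ofReal t < ENNReal.ofReal b then 1 else 0)
      = ENNReal.ofReal b ^ s / ENNReal.ofReal s := by
    intro b hb
    have h1 : ∀ t : ℝ, ENNReal.ofReal (t ^ (s - 1)) *
      (if ENNReal.ofReal t < ENNReal.ofReal b then 1 else 0) =
        (Iio b).indicator (fun t => ENNReal.ofReal (t ^ (s - 1))) t * (if 0 < b then 1 else 0) := by
      intro t
      simp only [indicator, mem_Iio]
      rcases hb.eq_or_lt with rfl | hb
      · simp
      · simp only [ENNReal.ofReal_lt_ofReal_iff hb]
        simp [hb]
    simp_rw [h1]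
    rcases hb.eq_or_lt with rfl | hb
    · simp [hs]
    simp only [hb, if_true, mul_one]
    rw [lintegral_indicator measurableSet_Iio, Measure.restrict_restrict measurableSet_Iio,
      show Iio b ∩ Ioi 0 = Ioo 0 b by ext; simp [and_comm]]
    rw [← ofReal_integral_eq_lintegral_ofReal]
    · rw [← integral_Ioc_eq_integral_Ioo, ← intervalIntegral.integral_of_le hb.le,
        integral_rpow (Or.inl (by linarith)), ENNReal.ofReal_rpow_of_pos hb,
        ← ENNReal.ofReal_div_of_pos hs]
      simp [hs.ne']
    · have := (intervalIntegral.intervalIntegrable_rpow' (a := 0) (b := b) (r := s - 1)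
        (by linarith))
      rw [intervalIntegrable_iff_integrableOn_Ioo_of_le hb.le] at this
      exact this
    · filter_upwards [ae_restrict_mem measurableSet_Ioo] with t ht
      exact Real.rpow_nonneg ht.1.le _
  by_cases ha : a = ⊤
  · subst ha
    rw [ENNReal.top_rpow_of_pos hs, ENNReal.top_div_of_ne_top ENNReal.ofReal_ne_top]
    have h2 : ∀ k : ℕ, ENNReal.ofReal k ^ s / ENNReal.ofReal s ≤
      ∫⁻ t in Ioi (0 : ℝ), ENNReal.ofReal (t ^ (s - 1)) *
        (if ENNReal.ofReal t < ⊤ then 1 else 0) := by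
      intro k
      rw [← fin k (by positivity)]
      gcongr with t
      split_ifs with h3 h4
      · exact le_rfl
      · exact absurd ENNReal.ofReal_lt_top h4
      · simp
      · simp
    have h3 : Tendsto (fun k : ℕ => ENNReal.ofReal ((k : ℝ) ^ s / s)) atTop (nhds ⊤) := by
      refine ENNReal.tendsto_ofReal_atTop.comp ?_
      exact ((tendsto_rpow_atTop hs).comp tendsto_natCast_atTop_atTop).atTop_div_const hs
    refine top_unique (le_of_tendsto' (h3.congr fun k => ?_) h2)
    rw [ENNReal.ofReal_div_of_pos hs, ENNReal.ofReal_rpow_of_nonneg (by positivity) hs.le]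
  · have := fin a.toReal ENNReal.toReal_nonneg
    rwa [ENNReal.ofReal_toReal ha] at this

lemma strong (n : ℕ) (q : ℝ) (hq : 1 < q) : ∃ C : ℝ≥0∞, C ≠ ⊤ ∧ C ≠ 0 ∧
    ∀ (μ : Measure (Fin n → ℝ)) [SFinite μ]
    (f : (Fin n → ℝ) → ℝ≥0∞), Measurable f →
    ∫⁻ x, Mc μ f x ^ q ∂μ ≤ C * ∫⁻ x, f x ^ q ∂μ := by
  obtain ⟨N, hN⟩ := exists_besi n
  have hq0 : 0 < q := by linarith
  have hq1 : 0 < q - 1 := by linarith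
  refine ⟨ENNReal.ofReal q * (2 * N * (2 ^ (q - 1) / ENNReal.ofReal (q - 1))) + 1, ?_, by simp,
    fun μ _ f hf => ?_⟩
  · have : ENNReal.ofReal (q - 1) ≠ 0 := by simpa using hq1
    finiteness
  have hM := measurable_Mc μ hf
  have hq' : ENNReal.ofReal q ≠ 0 := by simpa using hq0
  have key : ∀ t : ℝ, 0 < t → μ {x | ENNReal.ofReal t < Mc μ f x} ≤
      2 * N * (ENNReal.ofReal (t⁻¹) * ∫⁻ x, f x * (if ENNReal.ofReal t < 2 * f x then 1 else 0) ∂μ) := by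
    intro t ht
    set F : (Fin n → ℝ) → ℝ≥0∞ := fun x => f x * (if ENNReal.ofReal t < 2 * f x then 1 else 0)
    have hF : Measurable F := by
      refine hf.mul (Measurable.ite ?_ measurable_const measurable_const)
      exact measurableSet_lt measurable_const (hf.const_mul _)
    have h1 : ∀ x, f x ≤ F x + ENNReal.ofReal (t / 2) := by
      intro x
      simp only [F]
      split_ifs with h
      · simp
      · simp only [mul_zero, zero_add]
        rw [ENNReal.ofReal_div_of_pos two_pos, ENNReal.le_div_iff_mul_le (by simp) (by simp)]
        push Not at h
        simpa [mul_comm] using h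
    have h2 : {x | ENNReal.ofReal t < Mc μ f x} ⊆ {x | ENNReal.ofReal (t / 2) < Mc μ F x} := by
      intro x hx
      simp only [mem_ofPred_eq] at hx ⊢
      have h3 := hx.trans_le ((Mc_mono μ h1 x).trans (Mc_add_const μ _ x))
      have h7 : ENNReal.ofReal t = ENNReal.ofReal (t / 2) + ENNReal.ofReal (t / 2) := by
        rw [← ENNReal.ofReal_add (by positivity) (by positivity), add_halves]
      rw [h7] at h3
      exact (ENNReal.add_lt_add_iff_right ENNReal.ofReal_ne_top).1 h3
    have h4 := hN μ F hF (ENNReal.ofReal (t / 2))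
    have h5 : ENNReal.ofReal (t / 2) ≠ 0 := by simpa using ht
    calc _ ≤ μ {x | ENNReal.ofReal (t / 2) < Mc μ F x} := measure_mono h2
      _ ≤ (N * ∫⁻ y, F y ∂μ) / ENNReal.ofReal (t / 2) := by
        rw [ENNReal.le_div_iff_mul_le (Or.inl h5) (Or.inl ENNReal.ofReal_ne_top), mul_comm]
        exact h4
      _ = _ := by
        rw [div_eq_mul_inv, ← ENNReal.ofReal_inv_of_pos (by positivity), inv_div,
          show 2 / t = 2 * t⁻¹ by ring, ENNReal.ofReal_mul two_pos.le]
        simp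
        ring
  have hmeas1 : Measurable (fun z : (Fin n → ℝ) × ℝ => ENNReal.ofReal (z.2 ^ (q - 1)) *
      (if ENNReal.ofReal z.2 < Mc μ f z.1 then (1 : ℝ≥0∞) else 0)) := by
    refine Measurable.mul (by fun_prop) (Measurable.ite ?_ measurable_const measurable_const)
    exact measurableSet_lt (by fun_prop) (hM.comp measurable_fst)
  have hmeas2 : Measurable (fun z : ℝ × (Fin n → ℝ) => ENNReal.ofReal (z.1 ^ (q - 1 - 1)) *
      (f z.2 * (if ENNReal.ofReal z.1 < 2 * f z.2 then (1 : ℝ≥0∞) else 0))) := by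
    refine Measurable.mul (by fun_prop) (Measurable.mul (by fun_prop)
      (Measurable.ite ?_ measurable_const measurable_const))
    exact measurableSet_lt (by fun_prop) ((hf.comp measurable_snd).const_mul _)
  have e1 : ∫⁻ x, Mc μ f x ^ q ∂μ = ENNReal.ofReal q * ∫⁻ x, (∫⁻ t in Ioi (0 : ℝ),
      ENNReal.ofReal (t ^ (q - 1)) * (if ENNReal.ofReal t < Mc μ f x then 1 else 0)) ∂μ := by
    simp_rw [layer q hq0]
    rw [← lintegral_const_mul' _ _ ENNReal.ofReal_ne_top]
    congr with x
    rw [ENNReal.mul_div_cancel hq' ENNReal.ofReal_ne_top]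
  rw [e1, lintegral_lintegral_swap hmeas1.aemeasurable]
  calc _ ≤ ENNReal.ofReal q * ∫⁻ t in Ioi (0 : ℝ), (2 * N) * ∫⁻ x, ENNReal.ofReal (t ^ (q - 1 - 1)) *
      (f x * (if ENNReal.ofReal t < 2 * f x then 1 else 0)) ∂μ := by
        gcongr 1
        refine setLIntegral_mono' measurableSet_Ioi fun t ht => ?_
        rw [mem_Ioi] at ht
        rw [lintegral_const_mul' _ _ ENNReal.ofReal_ne_top,
          lintegral_const_mul' _ _ ENNReal.ofReal_ne_top]
        have e2 : ∫⁻ x, (if ENNReal.ofReal t < Mc μ f x then (1 : ℝ≥0∞) else 0) ∂μ =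
          μ {x | ENNReal.ofReal t < Mc μ f x} := by
          rw [← lintegral_indicator_one (measurableSet_lt measurable_const hM)]
          simp [indicator]
        rw [e2]
        calc _ ≤ ENNReal.ofReal (t ^ (q - 1)) * _ := mul_le_mul_right (key t ht) _
          _ = _ := by
            rw [show t ^ (q - 1 - 1) = t ^ (q - 1) * t⁻¹ by
              rw [Real.rpow_sub ht (q - 1) 1, Real.rpow_one, div_eq_mul_inv],
              ENNReal.ofReal_mul (by positivity)]
            ring
    _ = ENNReal.ofReal q * ((2 * N) * ∫⁻ x, (∫⁻ t in Ioi (0 : ℝ), ENNReal.ofReal (t ^ (q - 1 - 1)) *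
      (f x * (if ENNReal.ofReal t < 2 * f x then 1 else 0))) ∂μ) := by
        rw [lintegral_const_mul' _ _ (by finiteness), lintegral_lintegral_swap hmeas2.aemeasurable]
    _ = ENNReal.ofReal q * ((2 * N) * ∫⁻ x, (2 ^ (q - 1) / ENNReal.ofReal (q - 1)) * f x ^ q ∂μ) := by
        congr 3 with x
        have : ∀ t : ℝ, ENNReal.ofReal (t ^ (q - 1 - 1)) *
          (f x * (if ENNReal.ofReal t < 2 * f x then 1 else 0)) = f x * (ENNReal.ofReal (t ^ (q - 1 - 1)) *
          ((if ENNReal.ofReal t < 2 * f x then 1 else 0))) := fun t => by ring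
        simp_rw [this]
        rw [lintegral_const_mul'' _ (by
          refine Measurable.aemeasurable (Measurable.mul (by fun_prop)
            (Measurable.ite ?_ measurable_const measurable_const))
          exact measurableSet_lt (by fun_prop) measurable_const), layer _ hq1,
          ENNReal.mul_rpow_of_nonneg _ _ hq1.le]
        have h6 : f x ^ q = f x * f x ^ (q - 1) := by
          conv_rhs => rw [← ENNReal.rpow_one (f x), ← ENNReal.rpow_mul, one_mul,
            ← ENNReal.rpow_add_of_nonneg _ _ zero_le_one hq1.le]
          congr 1; ring
        rw [h6, div_eq_mul_inv, div_eq_mul_inv]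
        ring
    _ ≤ _ := by
        rw [lintegral_const_mul _ (by fun_prop)]
        rw [add_mul]
        refine le_trans (le_of_eq ?_) le_self_add
        ring

end RdF

namespace RdF

open Metric

def LocFin {n : ℕ} (W : (Fin n → ℝ) → ℝ≥0∞) : Prop :=
  ∀ (x : Fin n → ℝ) (r : ℝ), ∫⁻ y in closedBall x r, W y ≠ ⊤

/-- Ball version of the Muckenhoupt condition. -/
def ApB {n : ℕ} (p : ℝ) (W : (Fin n → ℝ) → ℝ≥0∞) (K : ℝ≥0∞) : Prop :=
  ∀ (x : Fin n → ℝ) (r : ℝ), 0 < r →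
    (∫⁻ y in closedBall x r, W y) * (∫⁻ y in closedBall x r, W y ^ (-(1 / (p - 1)))) ^ (p - 1)
      ≤ K * volume (closedBall x r) ^ p

lemma vol_pos {n : ℕ} (x : Fin n → ℝ) {r : ℝ} (hr : 0 < r) : volume (closedBall x r) ≠ 0 :=
  (measure_closedBall_pos volume x hr).ne'

lemma vol_fin {n : ℕ} (x : Fin n → ℝ) (r : ℝ) : volume (closedBall x r) ≠ ⊤ :=
  measure_closedBall_lt_top.ne

lemma vol_scale {n : ℕ} (x y : Fin n → ℝ) {r : ℝ} (hr : 0 < r) :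
    volume (closedBall x (3 * r)) = 3 ^ n * volume (closedBall y r) := by
  rw [Real.volume_pi_closedBall _ (by positivity), Real.volume_pi_closedBall _ (by positivity)]
  rw [show (2 * (3 * r)) = 3 * (2 * r) by ring, mul_pow, ENNReal.ofReal_mul (by positivity),
    ENNReal.ofReal_pow (by positivity)]
  simp

lemma int_pos {n : ℕ} {W : (Fin n → ℝ) → ℝ≥0∞} (hW : Measurable W) (h0 : ∀ᵐ x, W x ≠ 0)
    (x : Fin n → ℝ) {r : ℝ} (hr : 0 < r) : ∫⁻ y in closedBall x r, W y ≠ 0 := by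
  intro h
  rw [lintegral_eq_zero_iff hW] at h
  have h2 : ∀ᵐ y ∂(volume.restrict (closedBall x r)), False := by
    filter_upwards [h, ae_restrict_of_ae h0] with y h1 h2
    exact h2 h1
  have h3 : volume.restrict (closedBall x r) = 0 := by simpa using h2
  rw [Measure.restrict_eq_zero] at h3
  exact vol_pos x hr h3

lemma sigma_fin {n : ℕ} {p : ℝ} (hp : 1 < p) {W : (Fin n → ℝ) → ℝ≥0∞} {K : ℝ≥0∞}
    (hW : Measurable W) (h0 : ∀ᵐ x, W x ≠ 0) (hA : ApB p W K) (hK : K ≠ ⊤)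
    (x : Fin n → ℝ) {r : ℝ} (hr : 0 < r) :
    ∫⁻ y in closedBall x r, W y ^ (-(1 / (p - 1))) ≠ ⊤ := by
  intro h
  have h1 := hA x r hr
  rw [h, ENNReal.top_rpow_of_pos (by linarith), ENNReal.mul_top (int_pos hW h0 x hr)] at h1
  have h2 : K * volume (closedBall x r) ^ p ≠ ⊤ :=
    ENNReal.mul_ne_top hK (ENNReal.rpow_ne_top_of_nonneg (by linarith) (vol_fin x r))
  exact h2 (top_unique h1)

lemma le_Mc {n : ℕ} (μ : Measure (Fin n → ℝ)) (f : (Fin n → ℝ) → ℝ≥0∞) (x : Fin n → ℝ) (q : ℚ)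
    (hq : 0 < q) :
    (∫⁻ y in closedBall x (q : ℝ), f y ∂μ) / μ (closedBall x (q : ℝ)) ≤ Mc μ f x :=
  le_iSup₂ (f := fun (q : ℚ) (_ : 0 < q) =>
      (∫⁻ y in closedBall x (q : ℝ), f y ∂μ) / μ (closedBall x (q : ℝ))) q hq

lemma wd_int {n : ℕ} {W f : (Fin n → ℝ) → ℝ≥0∞} (hW : Measurable W) (hf : Measurable f)
    {s : Set (Fin n → ℝ)} (hs : MeasurableSet s) :
    ∫⁻ y in s, f y ∂(volume.withDensity W) = ∫⁻ y in s, W y * f y := by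
  rw [restrict_withDensity hs, lintegral_withDensity_eq_lintegral_mul _ hW hf]
  rfl

lemma alg1 {p : ℝ} (hp : 1 < p) {a m : ℝ≥0∞} (h0 : a ≠ 0) (ht : a ≠ ⊤) :
    a * (m ^ (p - 1) * a⁻¹) ^ (p / (p - 1)) = a ^ (-(1 / (p - 1))) * m ^ p := by
  have hp1 : 0 < p - 1 := by linarith
  rw [ENNReal.mul_rpow_of_nonneg _ _ (by positivity), ← ENNReal.rpow_mul, ← ENNReal.rpow_neg_one a,
    ← ENNReal.rpow_mul]
  conv_lhs => rw [← ENNReal.rpow_one a, ← ENNReal.rpow_mul, mul_left_comm,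
    ← ENNReal.rpow_add _ _ h0 ht, mul_comm]
  congr 2
  · field_simp; ring
  · field_simp

lemma alg2 {p : ℝ} (hp : 1 < p) {a f : ℝ≥0∞} (h0 : a ≠ 0) (ht : a ≠ ⊤) :
    a ^ (-(1 / (p - 1))) * (f / a ^ (-(1 / (p - 1)))) ^ p = f ^ p * a := by
  have hp1 : 0 < p - 1 := by linarith
  rw [div_eq_mul_inv f, ← ENNReal.rpow_neg, ENNReal.mul_rpow_of_nonneg _ _ (by positivity),
    ← ENNReal.rpow_mul, mul_left_comm, ← ENNReal.rpow_add _ _ h0 ht]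
  conv_rhs => rw [← ENNReal.rpow_one a]
  congr 2
  field_simp; ring

lemma buckley_ptwise {n : ℕ} {p : ℝ} (hp : 1 < p) {W : (Fin n → ℝ) → ℝ≥0∞} {K : ℝ≥0∞}
    (hW : Measurable W) (h0 : ∀ x, W x ≠ 0) (ht : ∀ x, W x ≠ ⊤) (hL : LocFin W)
    (hA : ApB p W K) (hK : K ≠ ⊤) {f : (Fin n → ℝ) → ℝ≥0∞} (hf : Measurable f)
    (x : Fin n → ℝ) :
    Mc volume f x ^ p ≤ ((3 ^ n) ^ p * K) ^ (p / (p - 1)) *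
      Mc (volume.withDensity W) (fun y => Mc (volume.withDensity fun z => W z ^ (-(1 / (p - 1))))
        (fun z => f z / W z ^ (-(1 / (p - 1)))) y ^ (p - 1) * (W y)⁻¹) x ^ (p / (p - 1)) := by
  have hp1 : 0 < p - 1 := by linarith
  have hp0 : 0 < p := by linarith
  set σ : (Fin n → ℝ) → ℝ≥0∞ := fun z => W z ^ (-(1 / (p - 1))) with hσdef
  have hσ : Measurable σ := hW.pow_const _
  have hσ0 : ∀ x, σ x ≠ 0 := fun x => (ENNReal.rpow_pos (pos_iff_ne_zero.2 (h0 x)) (ht x)).ne'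
  have hσt : ∀ x, σ x ≠ ⊤ := fun x => by
    simp only [hσdef]
    rw [ENNReal.rpow_neg, Ne, ENNReal.inv_eq_top]
    exact (ENNReal.rpow_pos (pos_iff_ne_zero.2 (h0 x)) (ht x)).ne'
  set F : (Fin n → ℝ) → ℝ≥0∞ := fun z => f z / σ z with hF
  have hFm : Measurable F := hf.div hσ
  set m := Mc (volume.withDensity σ) F with hm
  have hmm : Measurable m := measurable_Mc _ hFm
  set G : (Fin n → ℝ) → ℝ≥0∞ := fun y => m y ^ (p - 1) * (W y)⁻¹ with hG
  have hGm : Measurable G := (hmm.pow_const _).mul hW.inv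
  suffices h : Mc volume f x ≤ ((3 ^ n) ^ p * K * Mc (volume.withDensity W) G x) ^ (p - 1)⁻¹ by
    rw [← ENNReal.mul_rpow_of_nonneg _ _ (by positivity)]
    calc _ ≤ _ := ENNReal.rpow_le_rpow h hp0.le
      _ = _ := by
        rw [← ENNReal.rpow_mul]
        congr 1
        field_simp
  refine iSup₂_le fun q hq => ?_
  have hq' : (0 : ℝ) < q := by exact_mod_cast hq
  rw [ENNReal.le_rpow_inv_iff hp1]
  set B := closedBall x (q : ℝ) with hB
  set B3 := closedBall x (3 * (q : ℝ)) with hB3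
  have hBm : MeasurableSet B := isClosed_closedBall.measurableSet
  set S3 := ∫⁻ y in B3, σ y with hS3
  have hS30 : S3 ≠ 0 := int_pos hσ (Eventually.of_forall hσ0) x (by positivity)
  have hS3t : S3 ≠ ⊤ := sigma_fin hp hW (Eventually.of_forall h0) hA hK x (by positivity)
  set I := ∫⁻ y in B, f y with hI
  have hb : ∀ y ∈ B, I / S3 ≤ m y := by
    intro y hy
    rw [hB, mem_closedBall] at hy
    refine le_trans ?_ (le_Mc _ F y (2 * q) (by positivity))
    push_cast
    rw [withDensity_apply _ isClosed_closedBall.measurableSet,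
      wd_int hσ hFm isClosed_closedBall.measurableSet]
    have : ∀ y, σ y * F y = f y := fun y => ENNReal.mul_div_cancel (hσ0 y) (hσt y)
    simp_rw [this]
    refine ENNReal.div_le_div ?_ ?_
    · refine lintegral_mono_set ?_
      exact closedBall_subset_closedBall' (by rw [dist_comm]; linarith)
    · refine lintegral_mono_set ?_
      exact closedBall_subset_closedBall' (by linarith)
  set M := Mc (volume.withDensity W) G x with hM
  have hV0 : volume B ≠ 0 := vol_pos x hq'
  have hVt : volume B ≠ ⊤ := vol_fin x _
  have hw0 : ∫⁻ y in B, W y ≠ 0 := int_pos hW (Eventually.of_forall h0) x hq'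
  have hwt : ∫⁻ y in B, W y ≠ ⊤ := hL x _
  have h1 : (I / S3) ^ (p - 1) * volume B ≤ (∫⁻ y in B, W y) * M := by
    have h2 := le_Mc (volume.withDensity W) G x q hq
    rw [withDensity_apply _ hBm, wd_int hW hGm hBm, ENNReal.div_le_iff hw0 hwt] at h2
    rw [mul_comm (∫⁻ y in B, W y)]
    refine le_trans ?_ h2
    rw [← setLIntegral_const]
    refine setLIntegral_mono' hBm fun y hy => ?_
    have : W y * G y = m y ^ (p - 1) := by
      simp only [hG]
      rw [mul_left_comm, ENNReal.mul_inv_cancel (h0 y) (ht y), mul_one]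
    rw [this]
    exact ENNReal.rpow_le_rpow (hb y hy) hp1.le
  have h3 : (∫⁻ y in B, W y) * S3 ^ (p - 1) ≤ K * ((3 ^ n) ^ p * volume B ^ p) := by
    have h4 := hA x (3 * q) (by positivity)
    rw [vol_scale x x hq', ENNReal.mul_rpow_of_nonneg _ _ hp0.le] at h4
    refine le_trans ?_ h4
    gcongr
    rw [hB]
    exact closedBall_subset_closedBall (by linarith)
  have hVp0 : volume B ^ p ≠ 0 := (ENNReal.rpow_pos (pos_iff_ne_zero.2 hV0) hVt).ne'
  have hVpt : volume B ^ p ≠ ⊤ := ENNReal.rpow_ne_top_of_nonneg hp0.le hVt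
  have h5 : (I / volume B) ^ (p - 1) * volume B ^ p ≤ ((3 ^ n) ^ p * K * M) * volume B ^ p := by
    calc (I / volume B) ^ (p - 1) * volume B ^ p
        = I ^ (p - 1) * volume B := by
          rw [ENNReal.div_rpow_of_nonneg _ _ hp1.le, div_eq_mul_inv, ← ENNReal.rpow_neg, mul_assoc,
            ← ENNReal.rpow_add _ _ hV0 hVt]
          ring_nf
          rw [ENNReal.rpow_one]
      _ = ((I / S3) ^ (p - 1) * volume B) * S3 ^ (p - 1) := by
          rw [mul_right_comm, ← ENNReal.mul_rpow_of_nonneg _ _ hp1.le,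
            ENNReal.div_mul_cancel hS30 hS3t]
      _ ≤ ((∫⁻ y in B, W y) * M) * S3 ^ (p - 1) := by gcongr
      _ = ((∫⁻ y in B, W y) * S3 ^ (p - 1)) * M := by ring
      _ ≤ (K * ((3 ^ n) ^ p * volume B ^ p)) * M := by gcongr
      _ = _ := by ring
  exact (ENNReal.mul_le_mul_iff_left hVp0 hVpt).1 h5

lemma buckley (n : ℕ) (p : ℝ) (hp : 1 < p) : ∃ C : ℝ≥0∞, C ≠ 0 ∧ C ≠ ⊤ ∧
    ∀ (W : (Fin n → ℝ) → ℝ≥0∞) (K : ℝ≥0∞),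
    Measurable W → (∀ x, W x ≠ 0) → (∀ x, W x ≠ ⊤) → LocFin W → ApB p W K → K ≠ ⊤ →
    ∀ f : (Fin n → ℝ) → ℝ≥0∞, Measurable f →
    ∫⁻ x, Mc volume f x ^ p * W x ≤ (C * K ^ (1 / (p - 1))) ^ p * ∫⁻ x, f x ^ p * W x := by
  have hp1 : 0 < p - 1 := by linarith
  have hp0 : 0 < p := by linarith
  obtain ⟨C1, hC1t, hC10, hC1⟩ := strong n (p / (p - 1)) (by rw [lt_div_iff₀ hp1]; linarith)
  obtain ⟨C2, hC2t, hC20, hC2⟩ := strong n p hp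
  have h3 : ((3 : ℝ≥0∞) ^ n) ^ p ≠ 0 := by
    refine (ENNReal.rpow_pos (pos_iff_ne_zero.2 (by simp)) (by finiteness)).ne'
  have h3t : ((3 : ℝ≥0∞) ^ n) ^ p ≠ ⊤ := ENNReal.rpow_ne_top_of_nonneg hp0.le (by finiteness)
  refine ⟨(((3 ^ n) ^ p) ^ (p / (p - 1)) * (C1 * C2)) ^ p⁻¹, ?_, ?_, ?_⟩
  · refine (ENNReal.rpow_pos (pos_iff_ne_zero.2 ?_) ?_).ne'
    · exact mul_ne_zero (ENNReal.rpow_pos (pos_iff_ne_zero.2 h3) h3t).ne' (mul_ne_zero hC10 hC20)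
    · exact ENNReal.mul_ne_top (ENNReal.rpow_ne_top_of_nonneg (by positivity) h3t)
        (ENNReal.mul_ne_top hC1t hC2t)
  · refine ENNReal.rpow_ne_top_of_nonneg (by positivity) ?_
    exact ENNReal.mul_ne_top (ENNReal.rpow_ne_top_of_nonneg (by positivity) h3t)
        (ENNReal.mul_ne_top hC1t hC2t)
  intro W K hW h0 ht hL hA hK f hf
  set σ : (Fin n → ℝ) → ℝ≥0∞ := fun z => W z ^ (-(1 / (p - 1))) with hσdef
  have hσ : Measurable σ := hW.pow_const _
  set F : (Fin n → ℝ) → ℝ≥0∞ := fun z => f z / σ z with hF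
  have hFm : Measurable F := hf.div hσ
  set m := Mc (volume.withDensity σ) F with hm
  have hmm : Measurable m := measurable_Mc _ hFm
  set G : (Fin n → ℝ) → ℝ≥0∞ := fun y => m y ^ (p - 1) * (W y)⁻¹ with hG
  have hGm : Measurable G := (hmm.pow_const _).mul hW.inv
  have hMG := measurable_Mc (volume.withDensity W) hGm
  have e1 := hC1 (volume.withDensity W) G hGm
  have e2 := hC2 (volume.withDensity σ) F hFm
  rw [lintegral_withDensity_eq_lintegral_mul _ hW (hMG.pow_const _),
    lintegral_withDensity_eq_lintegral_mul _ hW (hGm.pow_const _)] at e1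
  rw [lintegral_withDensity_eq_lintegral_mul _ hσ (hmm.pow_const _),
    lintegral_withDensity_eq_lintegral_mul _ hσ (hFm.pow_const _)] at e2
  simp only [Pi.mul_apply] at e1 e2
  have a1 : ∀ x, W x * G x ^ (p / (p - 1)) = σ x * m x ^ p := fun x => alg1 hp (h0 x) (ht x)
  have a2 : ∀ x, σ x * F x ^ p = f x ^ p * W x := fun x => alg2 hp (h0 x) (ht x)
  simp_rw [a1] at e1
  simp_rw [a2] at e2
  have hcK : ((3 ^ n) ^ p * K) ^ (p / (p - 1)) ≠ ⊤ :=
    ENNReal.rpow_ne_top_of_nonneg (by positivity) (ENNReal.mul_ne_top h3t hK)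
  calc ∫⁻ x, Mc volume f x ^ p * W x
      ≤ ∫⁻ x, ((3 ^ n) ^ p * K) ^ (p / (p - 1)) *
        (W x * Mc (volume.withDensity W) G x ^ (p / (p - 1))) := by
        refine lintegral_mono fun x => ?_
        refine (mul_le_mul_left (buckley_ptwise hp hW h0 ht hL hA hK hf x) _).trans (le_of_eq ?_)
        ring
    _ = ((3 ^ n) ^ p * K) ^ (p / (p - 1)) *
        ∫⁻ x, (W x * Mc (volume.withDensity W) G x ^ (p / (p - 1))) := lintegral_const_mul' _ _ hcK
    _ ≤ ((3 ^ n) ^ p * K) ^ (p / (p - 1)) * (C1 * (C2 * ∫⁻ x, f x ^ p * W x)) := by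
        gcongr
        refine e1.trans ?_
        gcongr
    _ = _ := by
        rw [ENNReal.mul_rpow_of_nonneg _ (K ^ _) hp0.le, ← ENNReal.rpow_mul, inv_mul_cancel₀ hp0.ne',
          ENNReal.rpow_one, ENNReal.mul_rpow_of_nonneg _ K (by positivity), ← ENNReal.rpow_mul K,
          show 1 / (p - 1) * p = p / (p - 1) by ring]
        ring

/-- If `M u ≤ D u`, ball averages are controlled pointwise. -/
lemma a1_of_Mc {n : ℕ} {u : (Fin n → ℝ) → ℝ≥0∞} {D : ℝ≥0∞}
    (h : ∀ x, Mc volume u x ≤ D * u x) (x : Fin n → ℝ) {r : ℝ} (hr : 0 < r) (y : Fin n → ℝ)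
    (hy : y ∈ closedBall x r) :
    ∫⁻ z in closedBall x r, u z ≤ (3 ^ n * D) * volume (closedBall x r) * u y := by
  obtain ⟨q, hq1, hq2⟩ := exists_rat_btwn (show 2 * r < 3 * r by linarith)
  have hq : (0 : ℝ) < q := by linarith
  have h1 := (le_Mc volume u y q (by exact_mod_cast hq)).trans (h y)
  rw [ENNReal.div_le_iff (vol_pos y hq) (vol_fin y _)] at h1
  rw [mem_closedBall] at hy
  calc _ ≤ ∫⁻ z in closedBall y q, u z := lintegral_mono_set
          (closedBall_subset_closedBall' (by rw [dist_comm]; linarith))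
    _ ≤ _ := h1
    _ ≤ D * u y * volume (closedBall y (3 * r)) := by
        gcongr
    _ = _ := by rw [vol_scale y x hr]; ring

lemma jensen_tsum {p : ℝ} (hp : 1 < p) (a : ℕ → ℝ≥0∞) :
    (∑' k, (1 / 2 : ℝ≥0∞) ^ k * a k) ^ p ≤ 2 ^ p * ∑' k, (1 / 2 : ℝ≥0∞) ^ (k + 1) * a k ^ p := by
  have hp0 : 0 < p := by linarith
  set ν : Measure ℕ := Measure.count.withDensity (fun k => (1 / 2 : ℝ≥0∞) ^ (k + 1)) with hν
  have hint : ∀ f : ℕ → ℝ≥0∞, ∫⁻ k, f k ∂ν = ∑' k, (1 / 2 : ℝ≥0∞) ^ (k + 1) * f k := by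
    intro f
    rw [hν, lintegral_withDensity_eq_lintegral_mul _ (measurable_of_countable _)
      (measurable_of_countable _), lintegral_count]
    rfl
  have h1 : ∑' k, (1 / 2 : ℝ≥0∞) ^ (k + 1) = 1 := by
    rw [ENNReal.tsum_geometric_add_one]
    simp
    exact ENNReal.inv_mul_cancel (by simp) (by simp)
  have h := ENNReal.lintegral_mul_norm_pow_le (μ := ν) (f := fun k => a k ^ p) (g := fun _ => 1)
    (measurable_of_countable _).aemeasurable (measurable_of_countable _).aemeasurable
    (p := 1 / p) (q := 1 - 1 / p) (by positivity)
    (by rw [sub_nonneg, div_le_one hp0]; exact hp.le) (by ring)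
  simp only [hint, ENNReal.one_rpow, mul_one, h1, ← ENNReal.rpow_mul, mul_one_div_cancel hp0.ne',
    ENNReal.rpow_one] at h
  have h2 : ∑' k, (1 / 2 : ℝ≥0∞) ^ k * a k = 2 * ∑' k, (1 / 2 : ℝ≥0∞) ^ (k + 1) * a k := by
    rw [← ENNReal.tsum_mul_left]
    congr with k
    rw [pow_succ, one_div, ← mul_assoc, mul_comm 2, mul_assoc _ _ 2, ENNReal.inv_mul_cancel (by simp) (by simp), mul_one]
  rw [h2, ENNReal.mul_rpow_of_nonneg _ _ hp0.le]
  gcongr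
  calc _ ≤ _ := ENNReal.rpow_le_rpow h hp0.le
    _ = _ := by rw [← ENNReal.rpow_mul, one_div_mul_cancel hp0.ne', ENNReal.rpow_one]

lemma rubio {n : ℕ} {p : ℝ} (hp : 1 < p) {W : (Fin n → ℝ) → ℝ≥0∞} {A : ℝ≥0∞} (hA0 : A ≠ 0)
    (hAt : A ≠ ⊤) (hW : Measurable W)
    (hM : ∀ f : (Fin n → ℝ) → ℝ≥0∞, Measurable f →
      ∫⁻ x, Mc volume f x ^ p * W x ≤ A ^ p * ∫⁻ x, f x ^ p * W x)
    (g : (Fin n → ℝ) → ℝ≥0∞) (hg : Measurable g) (hg0 : ¬ g =ᵐ[volume] 0) :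
    ∃ u : (Fin n → ℝ) → ℝ≥0∞, Measurable u ∧ (∀ x, g x ≤ u x) ∧ (∀ x, u x ≠ 0) ∧
      (∀ x, Mc volume u x ≤ (2 * A) * u x) ∧
      ∫⁻ x, u x ^ p * W x ≤ 2 ^ p * ∫⁻ x, g x ^ p * W x := by
  have hp0 : 0 < p := by linarith
  let a : ℕ → (Fin n → ℝ) → ℝ≥0∞ := fun k => Nat.rec g (fun _ b x => A⁻¹ * Mc volume b x) k
  have a0 : a 0 = g := rfl
  have aS : ∀ k x, a (k + 1) x = A⁻¹ * Mc volume (a k) x := fun k x => rfl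
  have am : ∀ k, Measurable (a k) := by
    intro k
    induction k with
    | zero => exact hg
    | succ k ih => exact (measurable_Mc volume ih).const_mul _
  have aM : ∀ k x, Mc volume (a k) x = A * a (k + 1) x := by
    intro k x
    rw [aS, ← mul_assoc, ENNReal.mul_inv_cancel hA0 hAt, one_mul]
  have aI : ∀ k, ∫⁻ x, a k x ^ p * W x ≤ ∫⁻ x, g x ^ p * W x := by
    intro k
    induction k with
    | zero => exact le_rfl
    | succ k ih =>
      refine le_trans ?_ ih
      have hAp : A ^ p ≠ 0 := (ENNReal.rpow_pos (pos_iff_ne_zero.2 hA0) hAt).ne'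
      have hApt : A ^ p ≠ ⊤ := ENNReal.rpow_ne_top_of_nonneg hp0.le hAt
      have h1 := hM (a k) (am k)
      simp_rw [aM, ENNReal.mul_rpow_of_nonneg _ _ hp0.le, mul_assoc] at h1
      rw [lintegral_const_mul' _ _ hApt] at h1
      exact (ENNReal.mul_le_mul_iff_right hAp hApt).1 h1
  let u : (Fin n → ℝ) → ℝ≥0∞ := fun x => ∑' k, (1 / 2 : ℝ≥0∞) ^ k * a k x
  have hle : ∀ k x, (1 / 2 : ℝ≥0∞) ^ k * a k x ≤ u x := fun k x =>
    ENNReal.le_tsum (f := fun k => (1 / 2 : ℝ≥0∞) ^ k * a k x) k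
  have hum : Measurable u := Measurable.tsum fun k => (am k).const_mul _
  refine ⟨u, hum, ?_, ?_, ?_, ?_⟩
  · intro x
    simpa [a0] using hle 0 x
  · intro x hx
    have h1 := hle (0 + 1) x
    rw [hx, nonpos_iff_eq_zero, aS 0, a0] at h1
    have h2 : Mc volume g x = 0 := by simpa [hAt] using h1
    apply hg0
    have h3 : ∀ k : ℕ, ∀ᵐ y ∂(volume.restrict (closedBall x ((k : ℝ) + 1))), g y = 0 := by
      intro k
      have h4 := le_Mc volume g x (k + 1) (by positivity)
      rw [h2, nonpos_iff_eq_zero, ENNReal.div_eq_zero_iff] at h4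
      push_cast at h4
      rcases h4 with h4 | h4
      · rw [lintegral_eq_zero_iff hg] at h4
        exact h4
      · exact absurd h4 (vol_fin _ _)
    have h5 := (ae_restrict_iUnion_iff (fun k : ℕ => closedBall x ((k : ℝ) + 1)) (fun y => g y = 0)).2 h3
    have h6 : ⋃ k : ℕ, closedBall x ((k : ℝ) + 1) = univ := by
      refine eq_univ_of_forall fun y => ?_
      obtain ⟨k, hk⟩ := exists_nat_ge (dist y x)
      exact mem_iUnion.2 ⟨k, by rw [mem_closedBall]; linarith⟩
    rw [h6, Measure.restrict_univ] at h5
    exact h5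
  · intro x
    refine iSup₂_le fun q hq => ?_
    rw [lintegral_tsum (fun k => ((am k).const_mul _).aemeasurable)]
    have h1 : ∀ k, ∫⁻ y in closedBall x (q : ℝ), (1 / 2 : ℝ≥0∞) ^ k * a k y =
      (1 / 2 : ℝ≥0∞) ^ k * ∫⁻ y in closedBall x (q : ℝ), a k y := fun k =>
        lintegral_const_mul _ (am k)
    simp_rw [h1]
    rw [div_eq_mul_inv, ← ENNReal.tsum_mul_right]
    calc _ ≤ ∑' k, (2 * A) * ((1 / 2 : ℝ≥0∞) ^ (k + 1) * a (k + 1) x) := by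
          refine ENNReal.tsum_le_tsum fun k => ?_
          have h2 := le_Mc volume (a k) x q hq
          rw [aM, div_eq_mul_inv] at h2
          rw [mul_assoc]
          refine (mul_le_mul_right h2 _).trans (le_of_eq ?_)
          have : (1 / 2 : ℝ≥0∞) ^ k = 2 * (1 / 2 : ℝ≥0∞) ^ (k + 1) := by
            rw [pow_succ, one_div, mul_comm 2, mul_assoc, ENNReal.inv_mul_cancel (by simp) (by simp), mul_one]
          rw [this]
          ring
      _ = (2 * A) * ∑' k, ((1 / 2 : ℝ≥0∞) ^ (k + 1) * a (k + 1) x) := ENNReal.tsum_mul_left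
      _ ≤ (2 * A) * u x := by
          gcongr
          exact ENNReal.tsum_comp_le_tsum_of_injective (add_left_injective 1)
            (fun k => (1 / 2 : ℝ≥0∞) ^ k * a k x)
  · calc ∫⁻ x, u x ^ p * W x ≤ ∫⁻ x, 2 ^ p * ∑' k, (1 / 2 : ℝ≥0∞) ^ (k + 1) * (a k x ^ p * W x) := by
          refine lintegral_mono fun x => ?_
          refine (mul_le_mul_left (jensen_tsum hp (fun k => a k x)) _).trans (le_of_eq ?_)
          rw [mul_assoc, ← ENNReal.tsum_mul_right]
          simp_rw [mul_assoc]
      _ = 2 ^ p * ∑' k, (1 / 2 : ℝ≥0∞) ^ (k + 1) * ∫⁻ x, (a k x ^ p * W x) := by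
          have hm : ∀ k, Measurable fun x => a k x ^ p * W x := fun k => ((am k).pow_const _).mul hW
          rw [lintegral_const_mul _ (Measurable.tsum fun k => (hm k).const_mul _),
            lintegral_tsum (fun k => ((hm k).const_mul _).aemeasurable)]
          congr with k
          rw [lintegral_const_mul _ (hm k)]
      _ ≤ 2 ^ p * ∑' k, (1 / 2 : ℝ≥0∞) ^ (k + 1) * ∫⁻ x, (g x ^ p * W x) := by
          gcongr 2 ^ p * ∑' k, (1 / 2 : ℝ≥0∞) ^ (k + 1) * ?_ with k
          exact aI k
      _ = _ := by
          rw [ENNReal.tsum_mul_right]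
          have h1 : ∑' k, (1 / 2 : ℝ≥0∞) ^ (k + 1) = 1 := by
            rw [ENNReal.tsum_geometric_add_one]
            simp
            exact ENNReal.inv_mul_cancel (by simp) (by simp)
          rw [h1, one_mul]

end RdF

namespace RdF

open Metric

lemma rpow_ne_zero' {a : ℝ≥0∞} (h0 : a ≠ 0) (ht : a ≠ ⊤) (s : ℝ) : a ^ s ≠ 0 :=
  (ENNReal.rpow_pos (pos_iff_ne_zero.2 h0) ht).ne'

lemma rpow_ne_top' {a : ℝ≥0∞} (h0 : a ≠ 0) (ht : a ≠ ⊤) (s : ℝ) : a ^ s ≠ ⊤ := by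
  rw [← neg_neg s, ENNReal.rpow_neg, Ne, ENNReal.inv_eq_top]
  exact rpow_ne_zero' h0 ht _

lemma rpow_neg_anti {a b : ℝ≥0∞} (h : a ≤ b) {s : ℝ} (hs : 0 ≤ s) : b ^ (-s) ≤ a ^ (-s) := by
  rw [ENNReal.rpow_neg, ENNReal.rpow_neg]
  exact ENNReal.inv_le_inv.2 (ENNReal.rpow_le_rpow h hs)

/-- Positive finite numbers are exponentials of reals. -/
lemma mul_rpow' {a b : ℝ≥0∞} (ha : a ≠ 0) (ha' : a ≠ ⊤) (hb : b ≠ 0) (s : ℝ) :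
    (a * b) ^ s = a ^ s * b ^ s := by
  by_cases hb' : b = ⊤
  · subst hb'
    rw [ENNReal.mul_top ha]
    rcases lt_trichotomy s 0 with h | h | h
    · rw [ENNReal.top_rpow_of_neg h, mul_zero]
    · subst h; simp
    · rw [ENNReal.top_rpow_of_pos h, ENNReal.mul_top (rpow_ne_zero' ha ha' s)]
  · exact ENNReal.mul_rpow_of_ne_top ha' hb' s |>.trans rfl

lemma K_ne_zero {n : ℕ} {p : ℝ} {W : (Fin n → ℝ) → ℝ≥0∞} {K : ℝ≥0∞} (hp : 1 < p)
    (hW : Measurable W) (h0 : ∀ x, W x ≠ 0) (ht : ∀ x, W x ≠ ⊤) (hA : ApB p W K) (hK : K ≠ ⊤) :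
    K ≠ 0 := by
  rintro rfl
  have h1 := hA 0 1 one_pos
  rw [zero_mul, nonpos_iff_eq_zero, mul_eq_zero] at h1
  rcases h1 with h1 | h1
  · exact int_pos hW (Eventually.of_forall h0) 0 one_pos h1
  · refine rpow_ne_zero' (int_pos (hW.pow_const _) (Eventually.of_forall fun x => ?_) 0 one_pos) ?_ _ h1
    · exact rpow_ne_zero' (h0 x) (ht x) _
    · exact sigma_fin hp hW (Eventually.of_forall h0) hA hK 0 one_pos

/-- Local `A₁`-type condition. -/
def A1B {n : ℕ} (u : (Fin n → ℝ) → ℝ≥0∞) (D : ℝ≥0∞) : Prop :=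
  ∀ (x : Fin n → ℝ) (r : ℝ), 0 < r → ∀ y ∈ closedBall x r,
    ∫⁻ z in closedBall x r, u z ≤ D * volume (closedBall x r) * u y

lemma A1B.fin {n : ℕ} {u : (Fin n → ℝ) → ℝ≥0∞} {D : ℝ≥0∞} (h : A1B u D) (hD : D ≠ ⊤)
    (hut : ∀ᵐ x, u x ≠ ⊤) (x : Fin n → ℝ) {r : ℝ} (hr : 0 < r) :
    ∫⁻ z in closedBall x r, u z ≠ ⊤ := by
  have h1 : ∃ y ∈ closedBall x r, u y ≠ ⊤ := by
    by_contra! hcon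
    have h2 : closedBall x r ⊆ {y | ¬ u y ≠ ⊤} := fun y hy => by simpa using hcon y hy
    exact vol_pos x hr (measure_mono_null h2 hut)
  obtain ⟨y, hy, hyt⟩ := h1
  exact ne_top_of_le_ne_top (ENNReal.mul_ne_top (ENNReal.mul_ne_top hD (vol_fin _ _)) hyt)
    (h x r hr y hy)

lemma A1B.lower {n : ℕ} {u : (Fin n → ℝ) → ℝ≥0∞} {D : ℝ≥0∞} (h : A1B u D) (hD0 : D ≠ 0) (hD : D ≠ ⊤)
    (x : Fin n → ℝ) {r : ℝ} (hr : 0 < r) (y : Fin n → ℝ) (hy : y ∈ closedBall x r) :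
    (∫⁻ z in closedBall x r, u z) / (D * volume (closedBall x r)) ≤ u y := by
  rw [ENNReal.div_le_iff (mul_ne_zero hD0 (vol_pos x hr)) (ENNReal.mul_ne_top hD (vol_fin _ _)),
    mul_comm]
  exact h x r hr y hy

lemma alg4 {a b : ℝ≥0∞} (ha : a ≠ 0) (ha' : a ≠ ⊤) (hb : b ≠ 0) (hb' : b ≠ ⊤) (t : ℝ) :
    a ^ t * (a / b) ^ (-t) = b ^ t := by
  rw [div_eq_mul_inv, mul_rpow' ha ha' (ENNReal.inv_ne_zero.2 hb'), ← mul_assoc,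
    ← ENNReal.rpow_add _ _ ha ha', add_neg_cancel, ENNReal.rpow_zero, one_mul,
    ENNReal.inv_rpow, ENNReal.rpow_neg, inv_inv]

lemma weight_lt {n : ℕ} {p p₀ : ℝ} (hp : 1 < p) (hpp : p < p₀) {W u : (Fin n → ℝ) → ℝ≥0∞}
    {K D : ℝ≥0∞}
    (hW : Measurable W) (h0 : ∀ x, W x ≠ 0) (ht : ∀ x, W x ≠ ⊤) (hL : LocFin W)
    (hA : ApB p W K) (hu : Measurable u) (hu0 : ∀ x, u x ≠ 0)
    (hut : ∀ᵐ x, u x ≠ ⊤) (hD0 : D ≠ 0) (hD : D ≠ ⊤) (hA1 : A1B u D) :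
    LocFin (fun x => W x * u x ^ (-(p₀ - p))) ∧
      ApB p₀ (fun x => W x * u x ^ (-(p₀ - p))) (K * D ^ (p₀ - p)) := by
  have hd : 0 < p₀ - p := by linarith
  have hp1 : 0 < p - 1 := by linarith
  have hp01 : 0 < p₀ - 1 := by linarith
  have key : ∀ (x : Fin n → ℝ) (r : ℝ), 0 < r → ∫⁻ y in closedBall x r, W y * u y ^ (-(p₀ - p)) ≤
      (∫⁻ y in closedBall x r, W y) * ((∫⁻ y in closedBall x r, u y) /
        (D * volume (closedBall x r))) ^ (-(p₀ - p)) := by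
    intro x r hr
    rw [← lintegral_mul_const _ hW]
    refine setLIntegral_mono' isClosed_closedBall.measurableSet fun y hy => ?_
    exact mul_le_mul' le_rfl (rpow_neg_anti (hA1.lower hD0 hD x hr y hy) hd.le)
  have hI0 : ∀ (x : Fin n → ℝ) (r : ℝ), 0 < r → ∫⁻ y in closedBall x r, u y ≠ 0 := fun x r hr =>
    int_pos hu (Eventually.of_forall hu0) x hr
  have hIt : ∀ (x : Fin n → ℝ) (r : ℝ), 0 < r → ∫⁻ y in closedBall x r, u y ≠ ⊤ := fun x r hr =>
    hA1.fin hD hut x hr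
  have hB0 : ∀ (x : Fin n → ℝ) (r : ℝ), 0 < r → D * volume (closedBall x r) ≠ 0 := fun x r hr =>
    mul_ne_zero hD0 (vol_pos x hr)
  have hBt : ∀ (x : Fin n → ℝ) (r : ℝ), 0 < r → D * volume (closedBall x r) ≠ ⊤ := fun x r hr =>
    ENNReal.mul_ne_top hD (vol_fin x r)
  constructor
  · intro x r
    have h1 : closedBall x r ⊆ closedBall x (max r 1) := closedBall_subset_closedBall (le_max_left _ _)
    have hr : 0 < max r 1 := by positivity
    refine ne_top_of_le_ne_top ?_ ((lintegral_mono_set h1).trans (key x _ hr))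
    refine ENNReal.mul_ne_top (hL x _) (rpow_ne_top' ?_ ?_ _)
    · exact (ENNReal.div_pos (hI0 x _ hr) (hBt x _ hr)).ne'
    · exact ENNReal.div_ne_top (hIt x _ hr) (hB0 x _ hr)
  · intro x r hr
    set B := closedBall x r with hB
    have hold : ∫⁻ y in B, (W y * u y ^ (-(p₀ - p))) ^ (-(1 / (p₀ - 1))) ≤
        (∫⁻ y in B, W y ^ (-(1 / (p - 1)))) ^ ((p - 1) / (p₀ - 1)) *
        (∫⁻ y in B, u y) ^ ((p₀ - p) / (p₀ - 1)) := by
      refine le_trans (le_of_eq ?_) (ENNReal.lintegral_mul_norm_pow_le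
        (hW.pow_const _).aemeasurable hu.aemeasurable (by positivity) (by positivity)
        (by field_simp; ring))
      refine lintegral_congr_ae ?_
      filter_upwards [ae_restrict_of_ae hut] with y hy
      rw [mul_rpow' (h0 y) (ht y) (rpow_ne_zero' (hu0 y) hy _), ← ENNReal.rpow_mul,
        ← ENNReal.rpow_mul]
      congr 2
      · field_simp
      · ring
    have hB1 := hA x r hr
    calc _ ≤ ((∫⁻ y in B, W y) * ((∫⁻ y in B, u y) / (D * volume B)) ^ (-(p₀ - p))) *
          ((∫⁻ y in B, W y ^ (-(1 / (p - 1)))) ^ ((p - 1) / (p₀ - 1)) *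
          (∫⁻ y in B, u y) ^ ((p₀ - p) / (p₀ - 1))) ^ (p₀ - 1) :=
          mul_le_mul' (key x r hr) (ENNReal.rpow_le_rpow hold hp01.le)
      _ = ((∫⁻ y in B, W y) * (∫⁻ y in B, W y ^ (-(1 / (p - 1)))) ^ (p - 1)) *
          ((∫⁻ y in B, u y) ^ (p₀ - p) * ((∫⁻ y in B, u y) / (D * volume B)) ^ (-(p₀ - p))) := by
          rw [ENNReal.mul_rpow_of_nonneg _ _ hp01.le, ← ENNReal.rpow_mul, ← ENNReal.rpow_mul,
            div_mul_cancel₀ _ hp01.ne', div_mul_cancel₀ _ hp01.ne']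
          ring
      _ ≤ (K * volume B ^ p) * (D * volume B) ^ (p₀ - p) := by
          rw [alg4 (hI0 x r hr) (hIt x r hr) (hB0 x r hr) (hBt x r hr)]
          gcongr
      _ = _ := by
          rw [ENNReal.mul_rpow_of_nonneg _ _ hd.le]
          have : volume B ^ p₀ = volume B ^ p * volume B ^ (p₀ - p) := by
            rw [← ENNReal.rpow_add _ _ (vol_pos x hr) (vol_fin x r)]
            congr 1; ring
          rw [this]
          ring

lemma weight_gt {n : ℕ} {p p₀ : ℝ} (hp₀ : 1 < p₀) (hpp : p₀ < p) {W v : (Fin n → ℝ) → ℝ≥0∞}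
    {K D : ℝ≥0∞}
    (hW : Measurable W) (h0 : ∀ x, W x ≠ 0) (ht : ∀ x, W x ≠ ⊤) (hL : LocFin W)
    (hA : ApB p W K) (hu : Measurable v) (hu0 : ∀ x, v x ≠ 0)
    (hut : ∀ᵐ x, v x ≠ ⊤) (hD0 : D ≠ 0) (hD : D ≠ ⊤) (hA1 : A1B v D) :
    LocFin (fun x => v x ^ ((p - p₀) / (p - 1)) * W x ^ ((p₀ - 1) / (p - 1))) ∧
      ApB p₀ (fun x => v x ^ ((p - p₀) / (p - 1)) * W x ^ ((p₀ - 1) / (p - 1)))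
        (D ^ ((p - p₀) / (p - 1)) * K ^ ((p₀ - 1) / (p - 1))) := by
  have hp1 : 0 < p - 1 := by linarith
  have hd : 0 < p - p₀ := by linarith
  have hp01 : 0 < p₀ - 1 := by linarith
  set t := (p - p₀) / (p - 1) with htdef
  have ht0 : 0 < t := by positivity
  set s := (p₀ - 1) / (p - 1) with hsdef
  have hs0 : 0 < s := by positivity
  have hts : t + s = 1 := by rw [htdef, hsdef]; field_simp; ring
  have key : ∀ (x : Fin n → ℝ) (r : ℝ), ∫⁻ y in closedBall x r, v y ^ t * W y ^ s ≤
      (∫⁻ y in closedBall x r, v y) ^ t * (∫⁻ y in closedBall x r, W y) ^ s := by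
    intro x r
    exact ENNReal.lintegral_mul_norm_pow_le hu.aemeasurable hW.aemeasurable ht0.le hs0.le hts
  have hI0 : ∀ (x : Fin n → ℝ) (r : ℝ), 0 < r → ∫⁻ y in closedBall x r, v y ≠ 0 := fun x r hr =>
    int_pos hu (Eventually.of_forall hu0) x hr
  have hIt : ∀ (x : Fin n → ℝ) (r : ℝ), 0 < r → ∫⁻ y in closedBall x r, v y ≠ ⊤ := fun x r hr =>
    hA1.fin hD hut x hr
  have hB0 : ∀ (x : Fin n → ℝ) (r : ℝ), 0 < r → D * volume (closedBall x r) ≠ 0 := fun x r hr =>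
    mul_ne_zero hD0 (vol_pos x hr)
  have hBt : ∀ (x : Fin n → ℝ) (r : ℝ), 0 < r → D * volume (closedBall x r) ≠ ⊤ := fun x r hr =>
    ENNReal.mul_ne_top hD (vol_fin x r)
  constructor
  · intro x r
    have h1 : closedBall x r ⊆ closedBall x (max r 1) := closedBall_subset_closedBall (le_max_left _ _)
    have hr : 0 < max r 1 := by positivity
    refine ne_top_of_le_ne_top ?_ ((lintegral_mono_set h1).trans (key x _))
    exact ENNReal.mul_ne_top (ENNReal.rpow_ne_top_of_nonneg ht0.le (hIt x _ hr))
      (ENNReal.rpow_ne_top_of_nonneg hs0.le (hL x _))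
  · intro x r hr
    set B := closedBall x r with hB
    have h2 : ∫⁻ y in B, (v y ^ t * W y ^ s) ^ (-(1 / (p₀ - 1))) ≤
        ((∫⁻ y in B, v y) / (D * volume B)) ^ (-(t / (p₀ - 1))) *
          ∫⁻ y in B, W y ^ (-(1 / (p - 1))) := by
      rw [← lintegral_const_mul _ (hW.pow_const _)]
      refine lintegral_mono_ae ?_
      filter_upwards [ae_restrict_of_ae hut, ae_restrict_mem isClosed_closedBall.measurableSet]
        with y hy hyB
      rw [mul_rpow' (rpow_ne_zero' (hu0 y) hy _) (rpow_ne_top' (hu0 y) hy _)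
        (rpow_ne_zero' (h0 y) (ht y) _), ← ENNReal.rpow_mul, ← ENNReal.rpow_mul,
        show t * -(1 / (p₀ - 1)) = -(t / (p₀ - 1)) by ring,
        show s * -(1 / (p₀ - 1)) = -(1 / (p - 1)) by rw [hsdef]; field_simp]
      exact mul_le_mul' (rpow_neg_anti (hA1.lower hD0 hD x hr y hyB) (by positivity)) le_rfl
    have hB1 := hA x r hr
    calc _ ≤ ((∫⁻ y in B, v y) ^ t * (∫⁻ y in B, W y) ^ s) *
          (((∫⁻ y in B, v y) / (D * volume B)) ^ (-(t / (p₀ - 1))) *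
          ∫⁻ y in B, W y ^ (-(1 / (p - 1)))) ^ (p₀ - 1) :=
          mul_le_mul' (key x r) (ENNReal.rpow_le_rpow h2 hp01.le)
      _ = ((∫⁻ y in B, v y) ^ t * ((∫⁻ y in B, v y) / (D * volume B)) ^ (-t)) *
          ((∫⁻ y in B, W y) * (∫⁻ y in B, W y ^ (-(1 / (p - 1)))) ^ (p - 1)) ^ s := by
          rw [ENNReal.mul_rpow_of_nonneg _ _ hp01.le, ENNReal.mul_rpow_of_nonneg _ _ hs0.le,
            ← ENNReal.rpow_mul, ← ENNReal.rpow_mul,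
            show -(t / (p₀ - 1)) * (p₀ - 1) = -t by field_simp,
            show (p - 1) * s = p₀ - 1 by rw [hsdef]; field_simp]
          ring
      _ ≤ (D * volume B) ^ t * (K * volume B ^ p) ^ s := by
          rw [alg4 (hI0 x r hr) (hIt x r hr) (hB0 x r hr) (hBt x r hr)]
          gcongr
      _ = _ := by
          rw [ENNReal.mul_rpow_of_nonneg _ _ ht0.le, ENNReal.mul_rpow_of_nonneg _ _ hs0.le,
            ← ENNReal.rpow_mul]
          have : volume B ^ p₀ = volume B ^ t * volume B ^ (p * s) := by
            rw [← ENNReal.rpow_add _ _ (vol_pos x hr) (vol_fin x r)]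
            congr 1
            rw [htdef, hsdef]; field_simp; ring
          rw [this]
          ring

/-- The hypothesis at `p₀`, in `ℝ≥0∞` form. -/
def Hyp {n : ℕ} (T : ((Fin n → ℝ) → ℝ) → (Fin n → ℝ) → ℝ) (p₀ α : ℝ) (c : ℝ≥0∞) : Prop :=
  ∀ (V : (Fin n → ℝ) → ℝ≥0∞) (L : ℝ≥0∞), Measurable V → (∀ᵐ x, V x ≠ 0) → (∀ᵐ x, V x ≠ ⊤) →
    LocFin V → ApB p₀ V L → L ≠ ⊤ → ∀ f : (Fin n → ℝ) → ℝ, Measurable f →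
    ∫⁻ x, ‖f x‖ₑ ^ p₀ * V x ≠ ⊤ →
    ∫⁻ x, ‖T f x‖ₑ ^ p₀ * V x ≤ (c * L ^ α) ^ p₀ * ∫⁻ x, ‖f x‖ₑ ^ p₀ * V x

lemma ae_fin_of_int {n : ℕ} {p : ℝ} (hp : 0 < p) {W u : (Fin n → ℝ) → ℝ≥0∞}
    (hW : Measurable W) (h0 : ∀ x, W x ≠ 0) (hu : Measurable u)
    (h : ∫⁻ x, u x ^ p * W x ≠ ⊤) : ∀ᵐ x, u x ≠ ⊤ := by
  filter_upwards [ae_lt_top ((hu.pow_const p).mul hW) h] with x hx hux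
  simp only [Pi.mul_apply] at hx
  rw [hux, ENNReal.top_rpow_of_pos hp, ENNReal.top_mul (h0 x)] at hx
  exact lt_irrefl _ hx

lemma alg_hold_lt {p p₀ : ℝ} (hp : 1 < p) (hpp : p < p₀) {T W u : ℝ≥0∞} (h0 : W ≠ 0) (ht : W ≠ ⊤)
    (hu : u ≠ 0) (hu' : u ≠ ⊤) :
    T ^ p * W = (T ^ p₀ * (W * u ^ (-(p₀ - p)))) ^ (p / p₀) * (u ^ p * W) ^ (1 - p / p₀) := by
  have hp0 : 0 < p₀ := by linarith
  have h1 : 0 < p / p₀ := by positivity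
  have h2 : 0 ≤ 1 - p / p₀ := by rw [sub_nonneg, div_le_one hp0]; exact hpp.le
  rw [ENNReal.mul_rpow_of_nonneg _ _ h1.le, ENNReal.mul_rpow_of_nonneg _ _ h1.le,
    ENNReal.mul_rpow_of_nonneg _ _ h2, ← ENNReal.rpow_mul, ← ENNReal.rpow_mul, ← ENNReal.rpow_mul]
  have e1 : W = W ^ (p / p₀) * W ^ (1 - p / p₀) := by
    rw [← ENNReal.rpow_add _ _ h0 ht]; simp
  have e2 : u ^ (-(p₀ - p) * (p / p₀)) * u ^ (p * (1 - p / p₀)) = 1 := by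
    rw [← ENNReal.rpow_add _ _ hu hu', ← ENNReal.rpow_zero (x := u)]
    congr 1; field_simp; ring
  rw [show p₀ * (p / p₀) = p by field_simp]
  calc T ^ p * W = T ^ p * (W ^ (p / p₀) * W ^ (1 - p / p₀)) *
        (u ^ (-(p₀ - p) * (p / p₀)) * u ^ (p * (1 - p / p₀))) := by rw [e2, mul_one, ← e1]
    _ = _ := by ring

lemma core_lt {n : ℕ} {T : ((Fin n → ℝ) → ℝ) → (Fin n → ℝ) → ℝ}
    (hT : ∀ f, Measurable f → Measurable (T f)) {p₀ α : ℝ} (hα : 0 < α) {c : ℝ≥0∞} (hc : c ≠ ⊤)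
    (H : Hyp T p₀ α c) {p : ℝ} (hp : 1 < p) (hpp : p < p₀) :
    ∃ C : ℝ≥0∞, C ≠ ⊤ ∧ ∀ (W : (Fin n → ℝ) → ℝ≥0∞) (K : ℝ≥0∞),
      Measurable W → (∀ x, W x ≠ 0) → (∀ x, W x ≠ ⊤) → LocFin W → ApB p W K → K ≠ ⊤ →
      ∀ f : (Fin n → ℝ) → ℝ, Measurable f → ∫⁻ x, ‖f x‖ₑ ^ p * W x ≠ ⊤ →
      ∫⁻ x, ‖T f x‖ₑ ^ p * W x ≤ (C * K ^ (α * ((p₀ - 1) / (p - 1)))) ^ p *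
        ∫⁻ x, ‖f x‖ₑ ^ p * W x := by
  have hp0 : 0 < p := by linarith
  have hp00 : 0 < p₀ := by linarith
  have hp1 : 0 < p - 1 := by linarith
  have hd : 0 < p₀ - p := by linarith
  have hr1 : 0 < p / p₀ := by positivity
  have hr2 : 0 ≤ 1 - p / p₀ := by rw [sub_nonneg, div_le_one hp00]; exact hpp.le
  obtain ⟨Cb, hCb0, hCbt, hCb⟩ := buckley n p hp
  set E : ℝ≥0∞ := (3 ^ n * (2 * Cb)) ^ (p₀ - p) with hE
  have hEt : E ≠ ⊤ := ENNReal.rpow_ne_top_of_nonneg hd.le (by finiteness)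
  refine ⟨c * E ^ α * 2 ^ (1 - p / p₀), ?_, ?_⟩
  · refine ENNReal.mul_ne_top (ENNReal.mul_ne_top hc (ENNReal.rpow_ne_top_of_nonneg hα.le hEt)) ?_
    exact ENNReal.rpow_ne_top_of_nonneg hr2 (by simp)
  intro W K hW h0 ht hL hA hK f hf hfin
  have hK0 : K ≠ 0 := K_ne_zero hp hW h0 ht hA hK
  set g : (Fin n → ℝ) → ℝ≥0∞ := fun x => ‖f x‖ₑ with hg
  have hgm : Measurable g := hf.enorm
  have hTm : Measurable fun x => ‖T f x‖ₑ := (hT f hf).enorm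
  by_cases hg0 : g =ᵐ[volume] 0
  · have hA1 : A1B (fun _ : Fin n → ℝ => (1 : ℝ≥0∞)) 1 := by
      intro x r hr y hy
      simp
    obtain ⟨hw1, hw2⟩ := weight_lt hp hpp hW h0 ht hL hA measurable_const (by simp) (by simp)
      one_ne_zero (by simp) hA1
    simp only [ENNReal.one_rpow, mul_one] at hw1 hw2
    have hz : ∫⁻ x, ‖f x‖ₑ ^ p₀ * W x = 0 := by
      rw [lintegral_eq_zero_iff (f := fun x => ‖f x‖ₑ ^ p₀ * W x) ((hgm.pow_const _).mul hW)]
      filter_upwards [hg0] with x hx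
      simp only [hg, Pi.zero_apply] at hx
      simp [hx, hp00]
    have h1 := H W K hW (Eventually.of_forall h0) (Eventually.of_forall ht) hw1 hw2 hK f hf
      (by rw [hz]; simp)
    rw [hz, mul_zero, nonpos_iff_eq_zero,
      lintegral_eq_zero_iff (f := fun x => ‖T f x‖ₑ ^ p₀ * W x) ((hTm.pow_const _).mul hW)] at h1
    have h2 : ∫⁻ x, ‖T f x‖ₑ ^ p * W x = 0 := by
      rw [lintegral_eq_zero_iff (f := fun x => ‖T f x‖ₑ ^ p * W x) ((hTm.pow_const _).mul hW)]
      filter_upwards [h1] with x hx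
      simp only [Pi.zero_apply, mul_eq_zero, h0 x, or_false, ENNReal.rpow_eq_zero_iff_of_pos hp00] at hx
      simp [hx, hp0]
    rw [h2]
    exact bot_le
  set A := Cb * K ^ (1 / (p - 1)) with hAdef
  have hA0 : A ≠ 0 := mul_ne_zero hCb0 (rpow_ne_zero' hK0 hK _)
  have hAt : A ≠ ⊤ := ENNReal.mul_ne_top hCbt (rpow_ne_top' hK0 hK _)
  obtain ⟨u, hum, hgu, hu0, hMu, hui⟩ := rubio hp hA0 hAt hW (hCb W K hW h0 ht hL hA hK) g hgm hg0
  set N := ∫⁻ x, g x ^ p * W x with hN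
  have hut : ∀ᵐ x, u x ≠ ⊤ := ae_fin_of_int hp0 hW h0 hum
    (ne_top_of_le_ne_top (ENNReal.mul_ne_top (by finiteness) hfin) hui)
  set D := 3 ^ n * (2 * A) with hD
  have hD0 : D ≠ 0 := mul_ne_zero (by simp) (mul_ne_zero (by simp) hA0)
  have hDt : D ≠ ⊤ := by finiteness
  have hA1 : A1B u D := fun x r hr y hy => a1_of_Mc hMu x hr y hy
  obtain ⟨hV1, hV2⟩ := weight_lt hp hpp hW h0 ht hL hA hum hu0 hut hD0 hDt hA1
  set V : (Fin n → ℝ) → ℝ≥0∞ := fun x => W x * u x ^ (-(p₀ - p)) with hV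
  have hVm : Measurable V := hW.mul (hum.pow_const _)
  set L := K * D ^ (p₀ - p) with hLdef
  have hLt : L ≠ ⊤ := ENNReal.mul_ne_top hK (rpow_ne_top' hD0 hDt _)
  have hfV : ∫⁻ x, g x ^ p₀ * V x ≤ N := by
    refine lintegral_mono fun x => ?_
    simp only [hV]
    by_cases hgx : g x = 0
    · simp [hgx, hp00]
    have hgt : g x ≠ ⊤ := enorm_ne_top
    calc g x ^ p₀ * (W x * u x ^ (-(p₀ - p)))
        ≤ g x ^ p₀ * (W x * g x ^ (-(p₀ - p))) := by
          exact mul_le_mul' le_rfl (mul_le_mul' le_rfl (rpow_neg_anti (hgu x) hd.le))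
      _ = (g x ^ p₀ * g x ^ (-(p₀ - p))) * W x := by ring
      _ = g x ^ p * W x := by
          rw [← ENNReal.rpow_add _ _ hgx hgt]
          congr 2; ring
  have h1 := H V L hVm
    (by filter_upwards [hut] with x hx using mul_ne_zero (h0 x) (rpow_ne_zero' (hu0 x) hx _))
    (by filter_upwards [hut] with x hx using ENNReal.mul_ne_top (ht x) (rpow_ne_top' (hu0 x) hx _))
    hV1 hV2 hLt f hf (ne_top_of_le_ne_top hfin hfV)
  have hL' : L = E * K ^ ((p₀ - 1) / (p - 1)) := by
    rw [hLdef, hD, hAdef, hE, show (3 : ℝ≥0∞) ^ n * (2 * (Cb * K ^ (1 / (p - 1)))) =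
      (3 ^ n * (2 * Cb)) * K ^ (1 / (p - 1)) by ring, ENNReal.mul_rpow_of_nonneg _ _ hd.le,
      ← ENNReal.rpow_mul, mul_left_comm]
    congr 1
    conv_lhs => rw [← ENNReal.rpow_one K, ← ENNReal.rpow_mul, ← ENNReal.rpow_add _ _ hK0 hK]
    congr 1; field_simp; ring
  have hLα : L ^ α = E ^ α * K ^ (α * ((p₀ - 1) / (p - 1))) := by
    rw [hL', ENNReal.mul_rpow_of_nonneg _ _ hα.le, ← ENNReal.rpow_mul K, mul_comm α]
  calc ∫⁻ x, ‖T f x‖ₑ ^ p * W x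
      = ∫⁻ x, (‖T f x‖ₑ ^ p₀ * V x) ^ (p / p₀) * (u x ^ p * W x) ^ (1 - p / p₀) := by
        refine lintegral_congr_ae ?_
        filter_upwards [hut] with x hx
        exact alg_hold_lt hp hpp (h0 x) (ht x) (hu0 x) hx
    _ ≤ (∫⁻ x, ‖T f x‖ₑ ^ p₀ * V x) ^ (p / p₀) * (∫⁻ x, u x ^ p * W x) ^ (1 - p / p₀) :=
        ENNReal.lintegral_mul_norm_pow_le ((hTm.pow_const _).mul hVm).aemeasurable
          ((hum.pow_const _).mul hW).aemeasurable hr1.le hr2 (by ring)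
    _ ≤ ((c * L ^ α) ^ p₀ * N) ^ (p / p₀) * (2 ^ p * N) ^ (1 - p / p₀) := by
        refine mul_le_mul' (ENNReal.rpow_le_rpow (h1.trans ?_) hr1.le)
          (ENNReal.rpow_le_rpow hui hr2)
        exact mul_le_mul_right hfV _
    _ = (c * L ^ α) ^ p * (2 ^ (1 - p / p₀)) ^ p * (N ^ (p / p₀) * N ^ (1 - p / p₀)) := by
        rw [ENNReal.mul_rpow_of_nonneg _ _ hr1.le, ENNReal.mul_rpow_of_nonneg _ _ hr2,
          ← ENNReal.rpow_mul, ← ENNReal.rpow_mul, ← ENNReal.rpow_mul,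
          show p₀ * (p / p₀) = p by field_simp, mul_comm p (1 - p / p₀)]
        ring
    _ = _ := by
        rw [← ENNReal.rpow_add_of_nonneg _ _ hr1.le hr2, add_sub_cancel, ENNReal.rpow_one,
          ← ENNReal.mul_rpow_of_nonneg _ _ hp0.le, hLα]
        congr 2
        ring

end RdF

namespace RdF

open Metric

lemma dual_weight {n : ℕ} {p : ℝ} (hp : 1 < p) {W : (Fin n → ℝ) → ℝ≥0∞} {K : ℝ≥0∞}
    (hW : Measurable W) (h0 : ∀ x, W x ≠ 0) (hA : ApB p W K) (hK : K ≠ ⊤) :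
    LocFin (fun x => W x ^ (-(1 / (p - 1)))) ∧
      ApB (p / (p - 1)) (fun x => W x ^ (-(1 / (p - 1)))) (K ^ (1 / (p - 1))) := by
  have hp1 : 0 < p - 1 := by linarith
  constructor
  · intro x r
    have h1 : closedBall x r ⊆ closedBall x (max r 1) := closedBall_subset_closedBall (le_max_left _ _)
    have hr : 0 < max r 1 := by positivity
    exact ne_top_of_le_ne_top (sigma_fin hp hW (Eventually.of_forall h0) hA hK x hr)
      (lintegral_mono_set h1)
  · intro x r hr
    have e1 : p / (p - 1) - 1 = 1 / (p - 1) := by field_simp; ring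
    have h1 := ENNReal.rpow_le_rpow (hA x r hr) (z := 1 / (p - 1)) (by positivity)
    rw [e1]
    simp only [← ENNReal.rpow_mul]
    rw [show -(1 / (p - 1)) * -(1 / (1 / (p - 1))) = 1 by field_simp]
    simp only [ENNReal.rpow_one]
    rw [ENNReal.mul_rpow_of_nonneg _ _ (by positivity), ENNReal.mul_rpow_of_nonneg _ _ (by positivity),
      ← ENNReal.rpow_mul, ← ENNReal.rpow_mul, show (p - 1) * (1 / (p - 1)) = 1 by field_simp,
      ENNReal.rpow_one, mul_one_div] at h1
    rw [mul_comm]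
    exact h1

lemma alg_hold_gt {p p₀ : ℝ} (hp₀ : 1 < p₀) (hpp : p₀ < p) {F W v : ℝ≥0∞} (h0 : W ≠ 0) (ht : W ≠ ⊤) :
    F ^ p₀ * (v ^ ((p - p₀) / (p - 1)) * W ^ ((p₀ - 1) / (p - 1))) =
      (F ^ p * W) ^ (p₀ / p) * (v ^ (p / (p - 1)) * W ^ (-(1 / (p - 1)))) ^ (1 - p₀ / p) := by
  have hp0 : 0 < p := by linarith
  have hp1 : 0 < p - 1 := by linarith
  have h1 : 0 < p₀ / p := by positivity
  have h2 : 0 ≤ 1 - p₀ / p := by rw [sub_nonneg, div_le_one hp0]; exact hpp.le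
  rw [ENNReal.mul_rpow_of_nonneg _ _ h1.le, ENNReal.mul_rpow_of_nonneg _ _ h2,
    ← ENNReal.rpow_mul, ← ENNReal.rpow_mul, ← ENNReal.rpow_mul]
  have e1 : W ^ ((p₀ - 1) / (p - 1)) = W ^ (p₀ / p) * W ^ (-(1 / (p - 1)) * (1 - p₀ / p)) := by
    rw [← ENNReal.rpow_add _ _ h0 ht]; congr 1; field_simp; ring
  rw [show p * (p₀ / p) = p₀ by field_simp, e1,
    show p / (p - 1) * (1 - p₀ / p) = (p - p₀) / (p - 1) by field_simp]
  ring

lemma alg_div {θ : ℝ} (h1 : 0 < θ) {I a N : ℝ≥0∞} (hI0 : I ≠ 0) (hIt : I ≠ ⊤)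
    (h : I ≤ a * N ^ θ * I ^ (1 - θ)) : I ≤ a ^ (1 / θ) * N := by
  have e : I = I ^ θ * I ^ (1 - θ) := by
    rw [← ENNReal.rpow_add _ _ hI0 hIt]; simp
  have h2 : I ^ θ ≤ a * N ^ θ := by
    have h3 : I ^ θ * I ^ (1 - θ) ≤ a * N ^ θ * I ^ (1 - θ) := by rw [← e]; exact h
    exact (ENNReal.mul_le_mul_iff_left (rpow_ne_zero' hI0 hIt _) (rpow_ne_top' hI0 hIt _)).1 h3
  have h4 := ENNReal.rpow_le_rpow h2 (z := 1 / θ) (by positivity)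
  rw [ENNReal.mul_rpow_of_nonneg _ _ (by positivity), ← ENNReal.rpow_mul, ← ENNReal.rpow_mul,
    show θ * (1 / θ) = 1 by field_simp, ENNReal.rpow_one, ENNReal.rpow_one] at h4
  exact h4

lemma core_gt {n : ℕ} {T : ((Fin n → ℝ) → ℝ) → (Fin n → ℝ) → ℝ}
    (hT : ∀ f, Measurable f → Measurable (T f)) {p₀ α : ℝ} (hp₀ : 1 < p₀) (hα : 0 < α)
    {c : ℝ≥0∞} (hc : c ≠ ⊤)
    (H : Hyp T p₀ α c) {p : ℝ} (hpp : p₀ < p) :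
    ∃ C : ℝ≥0∞, C ≠ ⊤ ∧ ∀ (W : (Fin n → ℝ) → ℝ≥0∞) (K : ℝ≥0∞),
      Measurable W → (∀ x, W x ≠ 0) → (∀ x, W x ≠ ⊤) → LocFin W → ApB p W K → K ≠ ⊤ →
      ∀ f : (Fin n → ℝ) → ℝ, Measurable f → ∫⁻ x, ‖f x‖ₑ ^ p * W x ≠ ⊤ →
      ∫⁻ x, ‖T f x‖ₑ ^ p * W x ≤ (C * K ^ α) ^ p * ∫⁻ x, ‖f x‖ₑ ^ p * W x := by
  have hp : 1 < p := by linarith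
  have hp0 : 0 < p := by linarith
  have hp00 : 0 < p₀ := by linarith
  have hp1 : 0 < p - 1 := by linarith
  have hp01 : 0 < p₀ - 1 := by linarith
  have hd : 0 < p - p₀ := by linarith
  have hr1 : 0 < p₀ / p := by positivity
  have hr2 : 0 ≤ 1 - p₀ / p := by rw [sub_nonneg, div_le_one hp0]; exact hpp.le
  have hp' : 1 < p / (p - 1) := by rw [lt_div_iff₀ hp1]; linarith
  set t := (p - p₀) / (p - 1) with htdef
  have ht0 : 0 < t := by positivity
  set s := (p₀ - 1) / (p - 1) with hsdef
  have hs0 : 0 < s := by positivity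
  have hts : t + s = 1 := by rw [htdef, hsdef]; field_simp; ring
  obtain ⟨Cb, hCb0, hCbt, hCb⟩ := buckley n (p / (p - 1)) hp'
  set E : ℝ≥0∞ := (3 ^ n * (2 * Cb)) ^ t with hE
  have hEt : E ≠ ⊤ := ENNReal.rpow_ne_top_of_nonneg ht0.le (by finiteness)
  refine ⟨c * E ^ α * 2 ^ (t / p₀), ?_, ?_⟩
  · refine ENNReal.mul_ne_top (ENNReal.mul_ne_top hc (ENNReal.rpow_ne_top_of_nonneg hα.le hEt)) ?_
    exact ENNReal.rpow_ne_top_of_nonneg (by positivity) (by simp)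
  intro W K hW h0 ht hL hA hK f hf hfin
  have hK0 : K ≠ 0 := K_ne_zero hp hW h0 ht hA hK
  have hTm : Measurable fun x => ‖T f x‖ₑ := (hT f hf).enorm
  set N := ∫⁻ x, ‖f x‖ₑ ^ p * W x with hN
  obtain ⟨hS1, hS2⟩ := dual_weight hp hW h0 hA hK
  set σ : (Fin n → ℝ) → ℝ≥0∞ := fun x => W x ^ (-(1 / (p - 1))) with hσ
  have hσm : Measurable σ := hW.pow_const _
  have hσ0 : ∀ x, σ x ≠ 0 := fun x => rpow_ne_zero' (h0 x) (ht x) _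
  have hσt : ∀ x, σ x ≠ ⊤ := fun x => rpow_ne_top' (h0 x) (ht x) _
  have hM := hCb σ _ hσm hσ0 hσt hS1 hS2 (rpow_ne_top' hK0 hK _)
  rw [← ENNReal.rpow_mul, show 1 / (p - 1) * (1 / (p / (p - 1) - 1)) = 1 by
    rw [show p / (p - 1) - 1 = 1 / (p - 1) by field_simp; ring]; field_simp, ENNReal.rpow_one] at hM
  set A := Cb * K with hAdef
  have hA0 : A ≠ 0 := mul_ne_zero hCb0 hK0
  have hAt : A ≠ ⊤ := ENNReal.mul_ne_top hCbt hK
  set D := 3 ^ n * (2 * A) with hD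
  have hD0 : D ≠ 0 := mul_ne_zero (by simp) (mul_ne_zero (by simp) hA0)
  have hDt : D ≠ ⊤ := by finiteness
  set L := D ^ t * K ^ s with hLdef
  have hLt : L ≠ ⊤ := ENNReal.mul_ne_top (rpow_ne_top' hD0 hDt _) (rpow_ne_top' hK0 hK _)
  have hL' : L = E * K := by
    rw [hLdef, hD, hAdef, hE, show (3 : ℝ≥0∞) ^ n * (2 * (Cb * K)) =
      (3 ^ n * (2 * Cb)) * K by ring, ENNReal.mul_rpow_of_nonneg _ _ ht0.le, mul_assoc,
      ← ENNReal.rpow_add _ _ hK0 hK, hts, ENNReal.rpow_one]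
  have hLα : L ^ α = E ^ α * K ^ α := by
    rw [hL', ENNReal.mul_rpow_of_nonneg _ _ hα.le]
  have step : ∀ g : (Fin n → ℝ) → ℝ≥0∞, Measurable g → (∀ x, g x ≤ ‖T f x‖ₑ) →
      ∫⁻ x, g x ^ p * W x ≠ ⊤ → ∫⁻ x, g x ^ p * W x ≤ (c * E ^ α * 2 ^ (t / p₀) * K ^ α) ^ p * N := by
    intro g hg hgT hgfin
    set I := ∫⁻ x, g x ^ p * W x with hI
    by_cases hI0 : I = 0
    · rw [hI0]; exact bot_le
    set G : (Fin n → ℝ) → ℝ≥0∞ := fun x => g x ^ (p - 1) * W x with hG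
    have hGm : Measurable G := (hg.pow_const _).mul hW
    have hGI : ∫⁻ x, G x ^ (p / (p - 1)) * σ x = I := by
      refine lintegral_congr fun x => ?_
      simp only [hG, hσ]
      rw [ENNReal.mul_rpow_of_nonneg _ _ (by positivity), ← ENNReal.rpow_mul, mul_assoc,
        ← ENNReal.rpow_add _ _ (h0 x) (ht x), show (p - 1) * (p / (p - 1)) = p by field_simp,
        show p / (p - 1) + -(1 / (p - 1)) = 1 by field_simp; ring, ENNReal.rpow_one]
    have hG0 : ¬ G =ᵐ[volume] 0 := by
      intro hcon
      apply hI0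
      rw [← hGI, lintegral_eq_zero_iff (f := fun x => G x ^ (p / (p - 1)) * σ x)
        ((hGm.pow_const _).mul hσm)]
      filter_upwards [hcon] with x hx
      have : 0 < p / (p - 1) := by positivity
      simp [hx, this]
    obtain ⟨v, hvm, hGv, hv0, hMv, hvi⟩ := rubio hp' hA0 hAt hσm hM G hGm hG0
    rw [hGI] at hvi
    have h2fin : (2 : ℝ≥0∞) ^ (p / (p - 1)) ≠ ⊤ :=
      ENNReal.rpow_ne_top_of_nonneg (by positivity) (by simp)
    have hvt : ∀ᵐ x, v x ≠ ⊤ := ae_fin_of_int (by positivity) hσm hσ0 hvm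
      (ne_top_of_le_ne_top (ENNReal.mul_ne_top h2fin hgfin) hvi)
    have hA1 : A1B v D := fun x r hr y hy => a1_of_Mc hMv x hr y hy
    obtain ⟨hV1, hV2⟩ := weight_gt hp₀ hpp hW h0 ht hL hA hvm hv0 hvt hD0 hDt hA1
    rw [← htdef, ← hsdef, ← hLdef] at hV2
    rw [← htdef, ← hsdef] at hV1
    set V : (Fin n → ℝ) → ℝ≥0∞ := fun x => v x ^ t * W x ^ s with hV
    have hVm : Measurable V := (hvm.pow_const _).mul (hW.pow_const _)
    have hfV : ∫⁻ x, ‖f x‖ₑ ^ p₀ * V x ≤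
        N ^ (p₀ / p) * (2 ^ (p / (p - 1)) * I) ^ (1 - p₀ / p) := by
      calc _ = ∫⁻ x, (‖f x‖ₑ ^ p * W x) ^ (p₀ / p) * (v x ^ (p / (p - 1)) * σ x) ^ (1 - p₀ / p) := by
            refine lintegral_congr fun x => ?_
            exact alg_hold_gt hp₀ hpp (h0 x) (ht x)
        _ ≤ N ^ (p₀ / p) * (∫⁻ x, v x ^ (p / (p - 1)) * σ x) ^ (1 - p₀ / p) :=
            ENNReal.lintegral_mul_norm_pow_le ((hf.enorm.pow_const _).mul hW).aemeasurable
              ((hvm.pow_const _).mul hσm).aemeasurable hr1.le hr2 (by ring)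
        _ ≤ _ := mul_le_mul' le_rfl (ENNReal.rpow_le_rpow hvi hr2)
    have hfVt : ∫⁻ x, ‖f x‖ₑ ^ p₀ * V x ≠ ⊤ := by
      refine ne_top_of_le_ne_top ?_ hfV
      exact ENNReal.mul_ne_top (ENNReal.rpow_ne_top_of_nonneg hr1.le hfin)
        (ENNReal.rpow_ne_top_of_nonneg hr2 (ENNReal.mul_ne_top h2fin hgfin))
    have h1 := H V L hVm
      (by filter_upwards [hvt] with x hx using
            mul_ne_zero (rpow_ne_zero' (hv0 x) hx _) (rpow_ne_zero' (h0 x) (ht x) _))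
      (by filter_upwards [hvt] with x hx using
            ENNReal.mul_ne_top (rpow_ne_top' (hv0 x) hx _) (rpow_ne_top' (h0 x) (ht x) _))
      hV1 hV2 hLt f hf hfVt
    have hIT : I ≤ ∫⁻ x, ‖T f x‖ₑ ^ p₀ * V x := by
      refine lintegral_mono fun x => ?_
      have e1 : g x ^ p * W x = g x ^ p₀ * (G x ^ t * W x ^ s) := by
        simp only [hG]
        rw [ENNReal.mul_rpow_of_nonneg _ _ ht0.le, mul_assoc (_ ^ t),
          ← ENNReal.rpow_add _ _ (h0 x) (ht x), hts, ENNReal.rpow_one, ← ENNReal.rpow_mul,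
          ← mul_assoc, ← ENNReal.rpow_add_of_nonneg _ _ hp00.le (by positivity)]
        congr 2
        rw [htdef]; field_simp; ring
      rw [e1]
      exact mul_le_mul' (ENNReal.rpow_le_rpow (hgT x) hp00.le)
        (mul_le_mul' (ENNReal.rpow_le_rpow (hGv x) ht0.le) le_rfl)
    have hfinal : I ≤ ((c * L ^ α) ^ p₀ * 2 ^ t) * N ^ (p₀ / p) * I ^ (1 - p₀ / p) := by
      refine hIT.trans (h1.trans ((mul_le_mul' le_rfl hfV).trans (le_of_eq ?_)))
      rw [ENNReal.mul_rpow_of_nonneg _ _ hr2, ← ENNReal.rpow_mul,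
        show p / (p - 1) * (1 - p₀ / p) = t by rw [htdef]; field_simp]
      ring
    refine (alg_div hr1 hI0 hgfin hfinal).trans (le_of_eq ?_)
    congr 1
    rw [ENNReal.mul_rpow_of_nonneg _ _ (by positivity), ← ENNReal.rpow_mul, ← ENNReal.rpow_mul,
      show p₀ * (1 / (p₀ / p)) = p by field_simp,
      show t * (1 / (p₀ / p)) = t / p₀ * p by field_simp, ENNReal.rpow_mul 2 (t / p₀),
      ← ENNReal.mul_rpow_of_nonneg _ _ hp0.le, hLα]
    congr 1
    ring
  -- exhaust
  set gk : ℕ → (Fin n → ℝ) → ℝ≥0∞ := fun k =>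
    (closedBall (0 : Fin n → ℝ) k).indicator (fun x => min ‖T f x‖ₑ k) with hgk
  have hgkm : ∀ k, Measurable (gk k) := fun k =>
    (hTm.min measurable_const).indicator isClosed_closedBall.measurableSet
  have hgkle : ∀ k x, gk k x ≤ ‖T f x‖ₑ := fun k x => by
    simp only [hgk]
    exact (indicator_le_self' (fun _ _ => bot_le) x).trans (min_le_left _ _)
  have hbound : ∀ k, ∫⁻ x, gk k x ^ p * W x ≤ (c * E ^ α * 2 ^ (t / p₀) * K ^ α) ^ p * N := by
    intro k
    refine step (gk k) (hgkm k) (hgkle k) ?_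
    have : ∫⁻ x, gk k x ^ p * W x ≤ (k : ℝ≥0∞) ^ p * ∫⁻ x in closedBall (0 : Fin n → ℝ) k, W x := by
      rw [← lintegral_const_mul _ hW, ← lintegral_indicator isClosed_closedBall.measurableSet]
      refine lintegral_mono fun x => ?_
      simp only [hgk, indicator]
      split_ifs
      · exact mul_le_mul' (ENNReal.rpow_le_rpow (min_le_right _ _) hp0.le) le_rfl
      · simp [hp0]
    exact ne_top_of_le_ne_top (ENNReal.mul_ne_top
      (ENNReal.rpow_ne_top_of_nonneg hp0.le (ENNReal.natCast_ne_top k)) (hL _ _)) this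
  have hmono : ∀ x, Monotone fun k => gk k x := by
    intro x k l hkl
    have hkl' : (k : ℝ) ≤ l := by exact_mod_cast hkl
    have hkl2 : (k : ℝ≥0∞) ≤ l := by exact_mod_cast hkl
    simp only [hgk, indicator]
    split_ifs with h1 h2
    · exact min_le_min le_rfl hkl2
    · exact absurd (closedBall_subset_closedBall hkl' h1) h2
    · exact bot_le
    · exact le_rfl
  have hlim : ∀ x, Tendsto (fun k => gk k x ^ p * W x) atTop (nhds (‖T f x‖ₑ ^ p * W x)) := by
    intro x
    refine tendsto_const_nhds.congr' ?_
    obtain ⟨k1, hk1⟩ := exists_nat_ge (dist x 0)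
    obtain ⟨k2, hk2⟩ := ENNReal.exists_nat_gt (enorm_ne_top (x := T f x))
    filter_upwards [eventually_ge_atTop k1, eventually_ge_atTop k2] with k h1 h2
    have h1' : (k1 : ℝ) ≤ k := by exact_mod_cast h1
    have h2' : (k2 : ℝ≥0∞) ≤ k := by exact_mod_cast h2
    have : x ∈ closedBall (0 : Fin n → ℝ) k := mem_closedBall.2 (hk1.trans h1')
    simp only [hgk, indicator_of_mem this]
    rw [min_eq_left (hk2.le.trans h2')]
  refine le_of_tendsto' (lintegral_tendsto_of_tendsto_of_monotone
    (fun k => (((hgkm k).pow_const p).mul hW).aemeasurable) ?_ (Eventually.of_forall hlim)) hbound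
  refine Eventually.of_forall fun x k l hkl => ?_
  exact mul_le_mul' (ENNReal.rpow_le_rpow (hmono x hkl) hp0.le) le_rfl

end RdF

namespace RdF

open Metric

lemma closedBall_eq {n : ℕ} (x : Fin n → ℝ) {r : ℝ} (hr : 0 ≤ r) :
    closedBall x r = Set.Icc (fun i => x i - r) (fun i => x i + r) := by
  rw [closedBall_pi _ hr, ← Set.pi_univ_Icc]
  simp only [Real.closedBall_eq_Icc]

lemma isCube_closedBall {n : ℕ} (x : Fin n → ℝ) {r : ℝ} (hr : 0 < r) : IsCube (closedBall x r) := by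
  refine ⟨fun i => x i - r, 2 * r, by positivity, ?_⟩
  rw [closedBall_eq x hr.le]
  congr 1
  ext i; ring

lemma isCube_exists_ball {n : ℕ} {Q : Set (Fin n → ℝ)} (h : IsCube Q) :
    ∃ (x : Fin n → ℝ) (r : ℝ), 0 < r ∧ Q = closedBall x r := by
  obtain ⟨a, r, hr, rfl⟩ := h
  refine ⟨fun i => a i + r / 2, r / 2, by positivity, ?_⟩
  rw [closedBall_eq _ (by positivity)]
  congr 1
  · ext i; ring
  · ext i; ring

lemma char_alg {p : ℝ} (hp : 1 < p) {I J v L : ℝ≥0∞} (hv0 : v ≠ 0) (hvt : v ≠ ⊤) :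
    (I / v) * (J / v) ^ (p - 1) ≤ L ↔ I * J ^ (p - 1) ≤ L * v ^ p := by
  have hp1 : 0 ≤ p - 1 := by linarith
  have e : (I / v) * (J / v) ^ (p - 1) = I * J ^ (p - 1) / v ^ p := by
    have e2 : v ^ p = v * v ^ (p - 1) := by
      conv_rhs => rw [← ENNReal.rpow_one v, ← ENNReal.rpow_mul, ← ENNReal.rpow_add _ _ hv0 hvt]
      congr 1; ring
    rw [ENNReal.div_rpow_of_nonneg _ _ hp1, e2, div_eq_mul_inv, div_eq_mul_inv, div_eq_mul_inv,
      ENNReal.mul_inv (Or.inl hv0) (Or.inl hvt)]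
    ring
  rw [e, ENNReal.div_le_iff (rpow_ne_zero' hv0 hvt _) (rpow_ne_top' hv0 hvt _)]

lemma apChar_iff {n : ℕ} {p : ℝ} (hp : 1 < p) {w : (Fin n → ℝ) → ℝ} {W : (Fin n → ℝ) → ℝ≥0∞}
    (hw : ∀ᵐ x, 0 < w x) (hW : ∀ᵐ x, W x = ENNReal.ofReal (w x)) (L : ℝ≥0∞) :
    apCharE p w ≤ L ↔ ApB p W L := by
  have h1 : ∀ s : Set (Fin n → ℝ), avg s w = (∫⁻ y in s, W y) / volume s := by
    intro s
    unfold avg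
    congr 1
    refine lintegral_congr_ae (ae_restrict_of_ae ?_)
    filter_upwards [hW] with x hx using hx.symm
  have h2 : ∀ s : Set (Fin n → ℝ), avg s (fun x => w x ^ (-(1 / (p - 1)))) =
      (∫⁻ y in s, W y ^ (-(1 / (p - 1)))) / volume s := by
    intro s
    unfold avg
    congr 1
    refine lintegral_congr_ae (ae_restrict_of_ae ?_)
    filter_upwards [hW, hw] with x hx hx0
    rw [hx, ENNReal.ofReal_rpow_of_pos hx0]
  unfold apCharE
  rw [iSup₂_le_iff]
  constructor
  · intro h x r hr
    have := h _ (isCube_closedBall x hr)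
    rw [h1, h2] at this
    exact (char_alg hp (vol_pos x hr) (vol_fin x r)).1 this
  · intro h Q hQ
    obtain ⟨x, r, hr, rfl⟩ := isCube_exists_ball hQ
    rw [h1, h2]
    exact (char_alg hp (vol_pos x hr) (vol_fin x r)).2 (h x r hr)

lemma norm_eq {n : ℕ} {p : ℝ} (hp : 1 < p) {w f : (Fin n → ℝ) → ℝ} {W : (Fin n → ℝ) → ℝ≥0∞}
    (hW : ∀ᵐ x, W x = ENNReal.ofReal (w x)) :
    eLpNormW p w f = (∫⁻ x, ‖f x‖ₑ ^ p * W x) ^ (1 / p) := by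
  unfold eLpNormW
  congr 1
  refine lintegral_congr_ae ?_
  filter_upwards [hW] with x hx
  rw [hx, ← ENNReal.ofReal_rpow_of_nonneg (abs_nonneg _) (by linarith), ← Real.norm_eq_abs,
    ofReal_norm]

lemma root_le_iff {p : ℝ} (hp : 1 < p) {a b C : ℝ≥0∞} :
    a ^ (1 / p) ≤ C * b ^ (1 / p) ↔ a ≤ C ^ p * b := by
  have hp0 : 0 < p := by linarith
  have e : C * b ^ (1 / p) = (C ^ p * b) ^ (1 / p) := by
    rw [ENNReal.mul_rpow_of_nonneg _ _ (by positivity), ← ENNReal.rpow_mul, mul_one_div_cancel hp0.ne',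
      ENNReal.rpow_one]
  rw [e, ENNReal.rpow_le_rpow_iff (by positivity)]

lemma root_ne_top {p : ℝ} (hp : 1 < p) {a : ℝ≥0∞} : a ^ (1 / p) ≠ ⊤ ↔ a ≠ ⊤ := by
  have hp0 : 0 < 1 / p := by have : 0 < p := by linarith
                             positivity
  rw [Ne, ENNReal.rpow_eq_top_iff_of_pos hp0]

lemma ofReal_char {n : ℕ} {p β c : ℝ} (hc : 0 ≤ c) (hβ : 0 ≤ β) {w : (Fin n → ℝ) → ℝ}
    (h : apCharE p w ≠ ⊤) :
    ENNReal.ofReal (c * apChar p w ^ β) = ENNReal.ofReal c * apCharE p w ^ β := by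
  unfold apChar
  rw [ENNReal.ofReal_mul hc, ← ENNReal.ofReal_rpow_of_nonneg ENNReal.toReal_nonneg hβ,
    ENNReal.ofReal_toReal h]

lemma hyp_of {n : ℕ} {T : ((Fin n → ℝ) → ℝ) → (Fin n → ℝ) → ℝ}
    {p₀ : ℝ} (hp₀ : 1 < p₀) {c α : ℝ} (hc : 0 < c) (hα : 0 < α)
    (hyp : ∀ w : (Fin n → ℝ) → ℝ, MemAp p₀ w → ∀ f, MemLpW p₀ w f →
      eLpNormW p₀ w (T f)
        ≤ ENNReal.ofReal (c * apChar p₀ w ^ α) * eLpNormW p₀ w f) :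
    Hyp T p₀ α (ENNReal.ofReal c) := by
  intro V L hV h0 ht hL hA hLt f hf hfin
  set w : (Fin n → ℝ) → ℝ := fun x => (V x).toReal with hw
  have hVw : ∀ᵐ x, V x = ENNReal.ofReal (w x) := by
    filter_upwards [ht] with x hx using (ENNReal.ofReal_toReal hx).symm
  have hw0 : ∀ᵐ x, 0 < w x := by
    filter_upwards [h0, ht] with x hx hx' using ENNReal.toReal_pos hx hx'
  have hchar : apCharE p₀ w ≤ L := (apChar_iff hp₀ hw0 hVw L).2 hA
  have hcharT : apCharE p₀ w ≠ ⊤ := ne_top_of_le_ne_top hLt hchar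
  have hmem : MemAp p₀ w := by
    refine ⟨⟨hw0, fun x => ⟨closedBall x 1, closedBall_mem_nhds x one_pos, ?_⟩⟩, hcharT⟩
    exact integrable_toReal_of_lintegral_ne_top hV.aemeasurable (hL x 1)
  have hmf : MemLpW p₀ w f := by
    refine ⟨hf, ?_⟩
    rw [norm_eq hp₀ hVw]
    exact (root_ne_top hp₀).2 hfin
  have h1 := hyp w hmem f hmf
  rw [norm_eq hp₀ hVw, norm_eq hp₀ hVw, root_le_iff hp₀, ofReal_char hc.le hα.le hcharT] at h1
  refine h1.trans (mul_le_mul' (ENNReal.rpow_le_rpow ?_ (by linarith)) le_rfl)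
  exact mul_le_mul' le_rfl (ENNReal.rpow_le_rpow hchar hα.le)

lemma of_memAp {n : ℕ} {p : ℝ} (hp : 1 < p) {w : (Fin n → ℝ) → ℝ} (h : MemAp p w) :
    ∃ W : (Fin n → ℝ) → ℝ≥0∞, Measurable W ∧ (∀ x, W x ≠ 0) ∧ (∀ x, W x ≠ ⊤) ∧
      (∀ᵐ x, W x = ENNReal.ofReal (w x)) ∧ LocFin W ∧ ApB p W (apCharE p w) := by
  obtain ⟨⟨hpos, hloc⟩, hfin⟩ := h
  have hm := hloc.aestronglyMeasurable
  set w' := hm.mk w with hw'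
  have hw'm : Measurable w' := hm.stronglyMeasurable_mk.measurable
  have hS : MeasurableSet {x | 0 < w' x} := measurableSet_lt measurable_const hw'm
  set W : (Fin n → ℝ) → ℝ≥0∞ := fun x => ENNReal.ofReal (if 0 < w' x then w' x else 1) with hWdef
  have hWw : ∀ᵐ x, W x = ENNReal.ofReal (w x) := by
    filter_upwards [hpos, hm.ae_eq_mk] with x hx hx'
    have : w' x = w x := hx'.symm
    simp only [hWdef, this, if_pos hx]
  refine ⟨W, ?_, ?_, fun x => ENNReal.ofReal_ne_top, hWw, ?_, (apChar_iff hp hpos hWw _).1 le_rfl⟩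
  · exact (Measurable.ite hS hw'm measurable_const).ennreal_ofReal
  · intro x
    simp only [hWdef]
    split_ifs with hx
    · exact (ENNReal.ofReal_pos.2 hx).ne'
    · simp
  · intro x r
    have h1 : IntegrableOn w (closedBall x r) := hloc.integrableOn_isCompact (isCompact_closedBall x r)
    have h2 := h1.lintegral_lt_top
    rw [lintegral_congr_ae (ae_restrict_of_ae hWw)]
    exact h2.ne

lemma transfer {n : ℕ} {T : ((Fin n → ℝ) → ℝ) → (Fin n → ℝ) → ℝ} {p β : ℝ} (hp : 1 < p) (hβ : 0 ≤ β)
    (h : ∃ C : ℝ≥0∞, C ≠ ⊤ ∧ ∀ (W : (Fin n → ℝ) → ℝ≥0∞) (K : ℝ≥0∞),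
      Measurable W → (∀ x, W x ≠ 0) → (∀ x, W x ≠ ⊤) → LocFin W → ApB p W K → K ≠ ⊤ →
      ∀ f : (Fin n → ℝ) → ℝ, Measurable f → ∫⁻ x, ‖f x‖ₑ ^ p * W x ≠ ⊤ →
      ∫⁻ x, ‖T f x‖ₑ ^ p * W x ≤ (C * K ^ β) ^ p * ∫⁻ x, ‖f x‖ₑ ^ p * W x) :
    ∃ cp : ℝ, 0 < cp ∧ ∀ w : (Fin n → ℝ) → ℝ, MemAp p w → ∀ f, MemLpW p w f →
        eLpNormW p w (T f) ≤ ENNReal.ofReal (cp * apChar p w ^ β) * eLpNormW p w f := by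
  obtain ⟨C, hC, h⟩ := h
  have hnn : 0 ≤ C.toReal := ENNReal.toReal_nonneg
  refine ⟨C.toReal + 1, by positivity, fun w hw f hf => ?_⟩
  obtain ⟨W, hWm, h0, ht, hWw, hL, hA⟩ := of_memAp hp hw
  rw [norm_eq hp hWw, norm_eq hp hWw, root_le_iff hp, ofReal_char (by positivity) hβ hw.2]
  have hfin := hf.2
  rw [norm_eq hp hWw, root_ne_top hp] at hfin
  refine (h W _ hWm h0 ht hL hA hw.2 f hf.1 hfin).trans ?_
  refine mul_le_mul' (ENNReal.rpow_le_rpow (mul_le_mul' ?_ le_rfl) (by linarith)) le_rfl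
  rw [← ENNReal.ofReal_toReal hC]
  exact ENNReal.ofReal_le_ofReal (by rw [ENNReal.toReal_ofReal hnn]; linarith)

end RdF

/-- **Rubio de Francia sharp extrapolation.** If for some `1 < p₀ < ∞` there are `c, α > 0`
with `‖Tf‖_{L^{p₀}(w)} ≤ c [w]_{A_{p₀}}^α ‖f‖_{L^{p₀}(w)}` for every `w ∈ A_{p₀}` and every
`f ∈ L^{p₀}(w)`, then for every `1 < p < ∞` there is `c_p > 0` (independent of the weight)
with `‖Tf‖_{L^p(w)} ≤ c_p [w]_{A_p}^{α·max(1,(p₀-1)/(p-1))} ‖f‖_{L^p(w)}` for every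
`w ∈ A_p` and `f ∈ L^p(w)`. -/
theorem rubio_de_francia_sharp_extrapolation
    (n : ℕ) (T : ((Fin n → ℝ) → ℝ) → (Fin n → ℝ) → ℝ)
    (hT : ∀ f, Measurable f → Measurable (T f))
    (p₀ : ℝ) (hp₀ : 1 < p₀) (c α : ℝ) (hc : 0 < c) (hα : 0 < α)
    (hyp : ∀ w : (Fin n → ℝ) → ℝ, MemAp p₀ w → ∀ f, MemLpW p₀ w f →
      eLpNormW p₀ w (T f)
        ≤ ENNReal.ofReal (c * apChar p₀ w ^ α) * eLpNormW p₀ w f) :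
    ∀ p : ℝ, 1 < p → ∃ cp : ℝ, 0 < cp ∧
      ∀ w : (Fin n → ℝ) → ℝ, MemAp p w → ∀ f, MemLpW p w f →
        eLpNormW p w (T f)
          ≤ ENNReal.ofReal (cp * apChar p w ^ (α * max 1 ((p₀ - 1) / (p - 1)))) *
            eLpNormW p w f := by
  intro p hp
  have H := RdF.hyp_of hp₀ hc hα hyp
  have hp1 : 0 < p - 1 := by linarith
  rcases lt_trichotomy p p₀ with h | h | h
  · rw [max_eq_right (by rw [le_div_iff₀ hp1]; linarith)]
    exact RdF.transfer hp (mul_nonneg hα.le (div_nonneg (by linarith) hp1.le))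
      (RdF.core_lt hT hα ENNReal.ofReal_ne_top H hp h)
  · subst h
    rw [div_self hp1.ne', max_self, mul_one]
    exact ⟨c, hc, hyp⟩
  · rw [max_eq_left (by rw [div_le_one hp1]; linarith), mul_one]
    exact RdF.transfer hp hα.le (RdF.core_gt hT hp₀ hα ENNReal.ofReal_ne_top H h)
end
end

section
/- (Quantitative flat extrapolation, downward case) Let 1 < p < p₀ < ∞, let 0 < ε < 1, let δ₀ > 0 and let F : [1,∞) → (0,∞) be an increasing function. Let T be an operator mapping measurable functions on ℝⁿ to measurable functions such that ‖Tf‖_{L^{p₀}(v)} ≤ F([v]_{A_{p₀}})‖f‖_{L^{p₀}(v)} for every weight v ∈ A_{p₀} with [v]_{A_{p₀}} ≤ 1 + δ₀ and every f ∈ L^{p₀}(v). Let w ∈ A_p be a weight satisfying (1+ε)^{p₀−p}·‖M‖_{p,w}^{p₀−p}·[w]_{A_p} ≤ 1 + δ₀. Then for every f ∈ L^p(w), ‖Tf‖_{L^p(w)} ≤ ((1+ε)/ε)^{(p₀−p)/p₀} · F((1+ε)^{p₀−p}·‖M‖_{p,w}^{p₀−p}·[w]_{A_p}) · ‖f‖_{L^p(w)}.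 -/
open MeasureTheory Set Filter ENNReal

noncomputable section

/-! ### Auxiliary: weighted maximal functions over a countable family of balls -/

/-- index set of rational balls -/
def RI (n : ℕ) : Type := (Fin n → ℚ) × {q : ℚ // 0 < q}

instance (n : ℕ) : Countable (RI n) := by unfold RI; infer_instance

/-- centre -/
def rC {n : ℕ} (i : RI n) : Fin n → ℝ := fun k => ((i.1 k : ℚ) : ℝ)

/-- radius -/
def rR {n : ℕ} (i : RI n) : ℝ := ((i.2.1 : ℚ) : ℝ)

lemma rR_pos {n : ℕ} (i : RI n) : 0 < rR i := by
  unfold rR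
  exact_mod_cast i.2.2

/-- rational ball -/
def rB {n : ℕ} (i : RI n) : Set (Fin n → ℝ) := Metric.closedBall (rC i) (rR i)

lemma rB_meas {n : ℕ} (i : RI n) : MeasurableSet (rB i) := Metric.isClosed_closedBall.measurableSet

/-- weighted maximal function -/
def Mw {n : ℕ} (μ : Measure (Fin n → ℝ)) (g : (Fin n → ℝ) → ℝ≥0∞) (x : Fin n → ℝ) : ℝ≥0∞ :=
  ⨆ i : RI n, (rB i).indicator (fun _ => (∫⁻ y in rB i, g y ∂μ) / μ (rB i)) x

lemma Mw_meas {n : ℕ} (μ : Measure (Fin n → ℝ)) (g : (Fin n → ℝ) → ℝ≥0∞) : Measurable (Mw μ g) :=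
  Measurable.iSup fun i => measurable_const.indicator (rB_meas i)

lemma le_Mw {n : ℕ} (μ : Measure (Fin n → ℝ)) (g : (Fin n → ℝ) → ℝ≥0∞) (i : RI n)
    {x : Fin n → ℝ} (hx : x ∈ rB i) : (∫⁻ y in rB i, g y ∂μ) / μ (rB i) ≤ Mw μ g x := by
  refine le_trans (le_of_eq ?_) (le_iSup _ i)
  simp [Set.indicator_of_mem hx]

lemma Mw_le {n : ℕ} (μ : Measure (Fin n → ℝ)) (g : (Fin n → ℝ) → ℝ≥0∞)
    {x : Fin n → ℝ} {c : ℝ≥0∞}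
    (h : ∀ i : RI n, x ∈ rB i → (∫⁻ y in rB i, g y ∂μ) / μ (rB i) ≤ c) : Mw μ g x ≤ c := by
  refine iSup_le fun i => ?_
  by_cases hx : x ∈ rB i
  · simpa [Set.indicator_of_mem hx] using h i hx
  · simp [Set.indicator_of_notMem hx]

/-- balls have finite positive measure and the measure is doubling -/
structure Dbl {n : ℕ} (μ : Measure (Fin n → ℝ)) (D : ℝ≥0∞) : Prop where
  pos : ∀ x r, 0 < r → μ (Metric.closedBall x r) ≠ 0
  fin : ∀ x r, 0 < r → μ (Metric.closedBall x r) ≠ ⊤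
  dbl : ∀ x r, 0 < r → μ (Metric.closedBall x (5 * r)) ≤ D * μ (Metric.closedBall x r)

lemma weak_finite {n : ℕ} {μ : Measure (Fin n → ℝ)} {D : ℝ≥0∞} (hμ : Dbl μ D)
    (g : (Fin n → ℝ) → ℝ≥0∞) (t : ℝ≥0∞) (s : Finset (RI n))
    (hs : ∀ i ∈ s, t * μ (rB i) ≤ ∫⁻ y in rB i, g y ∂μ) :
    t * μ (⋃ i ∈ s, rB i) ≤ D * ∫⁻ y, g y ∂μ := by
  obtain ⟨R, hR⟩ : ∃ R, ∀ a ∈ s, rR a ≤ R := by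
    obtain ⟨R, hR⟩ := (s.image rR).finite_toSet.bddAbove
    exact ⟨R, fun a ha => hR (by simp; exact ⟨a, ha, rfl⟩)⟩
  obtain ⟨u, hus, hdisj, hcov⟩ := Vitali.exists_disjoint_subfamily_covering_enlargement_closedBall
    (s : Set (RI n)) rC rR R (fun a ha => hR a ha) 5 (by norm_num)
  have hufin : u.Finite := s.finite_toSet.subset hus
  have h1 : μ (⋃ i ∈ s, rB i) ≤ ∑ i ∈ hufin.toFinset, D * μ (rB i) := by
    calc μ (⋃ i ∈ s, rB i) ≤ μ (⋃ i ∈ hufin.toFinset, Metric.closedBall (rC i) (5 * rR i)) := by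
          refine measure_mono (iUnion₂_subset fun a ha => ?_)
          obtain ⟨b, hb, hab⟩ := hcov a ha
          exact hab.trans (subset_biUnion_of_mem (u := fun i => Metric.closedBall (rC i) (5 * rR i))
            (by simpa using hb))
      _ ≤ ∑ i ∈ hufin.toFinset, μ (Metric.closedBall (rC i) (5 * rR i)) :=
          measure_biUnion_finset_le _ _
      _ ≤ _ := Finset.sum_le_sum fun i _ => hμ.dbl _ _ (rR_pos i)
  calc t * μ (⋃ i ∈ s, rB i) ≤ t * ∑ i ∈ hufin.toFinset, D * μ (rB i) := by gcongr
    _ = D * ∑ i ∈ hufin.toFinset, t * μ (rB i) := by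
        simp only [Finset.mul_sum]
        refine Finset.sum_congr rfl fun i _ => by ring
    _ ≤ D * ∑ i ∈ hufin.toFinset, ∫⁻ y in rB i, g y ∂μ := by
        gcongr with i hi
        exact hs i (hus (by simpa using hi))
    _ = D * ∫⁻ y in ⋃ i ∈ hufin.toFinset, rB i, g y ∂μ := by
        rw [lintegral_biUnion_finset _ (fun i _ => rB_meas i)]
        rw [Set.Finite.coe_toFinset]
        exact hdisj
    _ ≤ D * ∫⁻ y, g y ∂μ := by
        gcongr
        exact Measure.restrict_le_self

lemma weak_type {n : ℕ} {μ : Measure (Fin n → ℝ)} {D : ℝ≥0∞} (hμ : Dbl μ D)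
    (g : (Fin n → ℝ) → ℝ≥0∞) (t : ℝ≥0∞) :
    t * μ {x | t < Mw μ g x} ≤ D * ∫⁻ y, g y ∂μ := by
  set I : Set (RI n) := {i | t < (∫⁻ y in rB i, g y ∂μ) / μ (rB i)} with hI
  have hset : {x | t < Mw μ g x} ⊆ ⋃ s : Finset I, ⋃ i ∈ s.map (Function.Embedding.subtype _), rB i := by
    intro x hx
    simp only [mem_ofPred_eq, Mw, lt_iSup_iff] at hx
    obtain ⟨i, hi⟩ := hx
    have hxi : x ∈ rB i := by
      by_contra h
      simp [Set.indicator_of_notMem h] at hi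
    rw [Set.indicator_of_mem hxi] at hi
    simp only [mem_iUnion]
    exact ⟨{⟨i, hi⟩}, i, by simp, hxi⟩
  have hmono : Monotone fun s : Finset I => ⋃ i ∈ s.map (Function.Embedding.subtype _), rB i := by
    intro s s' hss
    exact biUnion_subset_biUnion_left (by simpa using hss)
  calc t * μ {x | t < Mw μ g x} ≤ t * μ (⋃ s : Finset I, ⋃ i ∈ s.map (Function.Embedding.subtype _), rB i) := by
        gcongr
    _ = t * ⨆ s : Finset I, μ (⋃ i ∈ s.map (Function.Embedding.subtype _), rB i) := by
        rw [hmono.directed_le.measure_iUnion]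
    _ = ⨆ s : Finset I, t * μ (⋃ i ∈ s.map (Function.Embedding.subtype _), rB i) := by
        rw [ENNReal.mul_iSup]
    _ ≤ _ := by
        refine iSup_le fun s => weak_finite hμ g t _ fun i hi => ?_
        simp only [Finset.mem_map, Function.Embedding.subtype_apply] at hi
        obtain ⟨j, _, rfl⟩ := hi
        have : t < (∫⁻ y in rB j.1, g y ∂μ) / μ (rB j.1) := j.2
        exact ((ENNReal.lt_div_iff_mul_lt (Or.inl (hμ.pos _ _ (rR_pos _)))
          (Or.inl (hμ.fin _ _ (rR_pos _)))).1 this).le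

lemma layer (b : ℝ≥0∞) (q : ℝ) (hq : 0 < q) :
    b ^ q = ENNReal.ofReal q * ∫⁻ t in Ioi (0:ℝ),
      {t : ℝ | ENNReal.ofReal t < b}.indicator (fun t => ENNReal.ofReal (t ^ (q - 1))) t := by
  have hfin : ∀ c : ℝ, 0 ≤ c → ENNReal.ofReal q * ∫⁻ t in Ioi (0:ℝ),
      {t : ℝ | ENNReal.ofReal t < ENNReal.ofReal c}.indicator (fun t => ENNReal.ofReal (t ^ (q - 1))) t
      = ENNReal.ofReal c ^ q := by
    intro c hc
    rcases hc.eq_or_lt with rfl | hc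
    · simp [hq]
    have hms : MeasurableSet {t : ℝ | ENNReal.ofReal t < ENNReal.ofReal c} :=
      measurableSet_lt ENNReal.measurable_ofReal measurable_const
    rw [lintegral_indicator hms, Measure.restrict_restrict hms]
    have : {t : ℝ | ENNReal.ofReal t < ENNReal.ofReal c} ∩ Ioi 0 = Ioo 0 c := by
      ext t
      simp only [mem_inter_iff, mem_ofPred_eq, mem_Ioi, mem_Ioo, ENNReal.ofReal_lt_ofReal_iff hc]
      tauto
    rw [this, ← Measure.restrict_congr_set Ioo_ae_eq_Ioc.symm, ← ofReal_integral_eq_lintegral_ofReal]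
    · rw [← intervalIntegral.integral_of_le hc.le, integral_rpow (Or.inl (by linarith)),
        ENNReal.ofReal_rpow_of_pos hc, ← ENNReal.ofReal_mul hq.le]
      congr 1
      rw [sub_add_cancel, Real.zero_rpow hq.ne']
      field_simp
      ring
    · exact (intervalIntegral.intervalIntegrable_rpow' (by linarith)).1
    · exact (ae_restrict_iff' measurableSet_Ioc).2 (ae_of_all _ fun t ht => Real.rpow_nonneg ht.1.le _)
  induction b with
  | coe b =>
    have := hfin b b.2
    rw [ENNReal.ofReal_coe_nnreal] at this
    exact this.symm
  | top =>
    rw [ENNReal.top_rpow_of_pos hq, eq_comm, eq_top_iff]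
    have : ∀ k : ℕ, ((k : ℝ≥0∞)) ^ q ≤ ENNReal.ofReal q * ∫⁻ t in Ioi (0:ℝ),
      {t : ℝ | ENNReal.ofReal t < ⊤}.indicator (fun t => ENNReal.ofReal (t ^ (q - 1))) t := by
      intro k
      have h := hfin k k.cast_nonneg
      rw [ENNReal.ofReal_natCast] at h
      rw [← h]
      gcongr
      exact le_top
    have h2 : Tendsto (fun k : ℕ => ((k : ℝ≥0∞)) ^ q) atTop (nhds ⊤) := by
      have := (ENNReal.continuous_rpow_const (y := q)).tendsto ⊤
      rw [ENNReal.top_rpow_of_pos hq] at this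
      exact this.comp ENNReal.tendsto_nat_nhds_top
    exact le_of_tendsto' h2 this

lemma Mw_split {n : ℕ} {μ : Measure (Fin n → ℝ)} {D : ℝ≥0∞} (hμ : Dbl μ D)
    (g : (Fin n → ℝ) → ℝ≥0∞) (s : ℝ≥0∞) (x : Fin n → ℝ) :
    Mw μ g x ≤ Mw μ ({y | s < g y}.indicator g) x + s := by
  refine Mw_le _ _ fun i hi => ?_
  have h1 : ∫⁻ y in rB i, g y ∂μ ≤ ∫⁻ y in rB i, {y | s < g y}.indicator g y ∂μ + s * μ (rB i) := by
    rw [← setLIntegral_const, ← lintegral_add_right _ measurable_const]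
    refine lintegral_mono fun y => ?_
    by_cases hy : s < g y
    · simp [Set.indicator, hy]
    · simp [Set.indicator, hy, not_lt.1 hy]
  calc _ ≤ (∫⁻ y in rB i, {y | s < g y}.indicator g y ∂μ + s * μ (rB i)) / μ (rB i) := by gcongr
    _ = (∫⁻ y in rB i, {y | s < g y}.indicator g y ∂μ) / μ (rB i) + s := by
        rw [ENNReal.add_div, ENNReal.mul_div_cancel_right (b := μ (rB i)) (hμ.pos (rC i) _ (rR_pos i)) (hμ.fin (rC i) _ (rR_pos i))]
    _ ≤ _ := by
        gcongr
        exact le_Mw _ _ _ hi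

lemma weak_trunc {n : ℕ} {μ : Measure (Fin n → ℝ)} {D : ℝ≥0∞} (hμ : Dbl μ D)
    (g : (Fin n → ℝ) → ℝ≥0∞) (t : ℝ) :
    ENNReal.ofReal t * μ {x | ENNReal.ofReal t < Mw μ g x} ≤
      2 * D * ∫⁻ y, {y | ENNReal.ofReal t < 2 * g y}.indicator g y ∂μ := by
  have hts : ENNReal.ofReal t = 2 * ENNReal.ofReal (t / 2) := by
    rw [← ENNReal.ofReal_ofNat, ← ENNReal.ofReal_mul (by norm_num)]; congr 1; ring
  set s := ENNReal.ofReal (t / 2) with hs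
  have hset : {y | ENNReal.ofReal t < 2 * g y} = {y | s < g y} := by
    ext y
    simp only [mem_ofPred_eq, hts]
    exact ENNReal.mul_lt_mul_iff_right (by norm_num) (by norm_num)
  rw [hset]
  have hsub : {x | ENNReal.ofReal t < Mw μ g x} ⊆ {x | s < Mw μ ({y | s < g y}.indicator g) x} := by
    intro x hx
    simp only [mem_ofPred_eq] at hx ⊢
    by_contra h
    have := Mw_split hμ g s x
    have h3 : Mw μ g x ≤ s + s := this.trans (by gcongr; exact not_lt.1 h)
    rw [hts, two_mul] at hx
    exact absurd hx (not_lt.2 h3)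
  calc _ ≤ ENNReal.ofReal t * μ {x | s < Mw μ ({y | s < g y}.indicator g) x} := by gcongr
    _ = 2 * (s * μ {x | s < Mw μ ({y | s < g y}.indicator g) x}) := by rw [hts, mul_assoc]
    _ ≤ 2 * (D * ∫⁻ y, {y | s < g y}.indicator g y ∂μ) := by
        gcongr 2 * ?_
        exact weak_type hμ _ s
    _ = _ := by rw [mul_assoc]

lemma strong_type {n : ℕ} {μ : Measure (Fin n → ℝ)} [SFinite μ] {D : ℝ≥0∞} (hμ : Dbl μ D)
    (hD : D ≠ ⊤) (q : ℝ) (hq : 1 < q) :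
    ∃ C : ℝ≥0∞, C ≠ ⊤ ∧ ∀ g : (Fin n → ℝ) → ℝ≥0∞, Measurable g →
      ∫⁻ x, Mw μ g x ^ q ∂μ ≤ C * ∫⁻ x, g x ^ q ∂μ := by
  have hq1 : 0 < q - 1 := by linarith
  refine ⟨ENNReal.ofReal q * (2 * D * ((ENNReal.ofReal (q - 1))⁻¹ * 2 ^ (q - 1))), ?_, fun g hg => ?_⟩
  · refine ENNReal.mul_ne_top (by simp) (ENNReal.mul_ne_top (ENNReal.mul_ne_top (by simp) hD)
      (ENNReal.mul_ne_top (by simp [hq]) (ENNReal.rpow_ne_top_of_nonneg hq1.le (by simp))))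
  have meas1 : ∀ (G H : (Fin n → ℝ) → ℝ≥0∞) (r : ℝ), Measurable G → Measurable H →
      Measurable (fun z : (Fin n → ℝ) × ℝ => H z.1 *
      {t : ℝ | ENNReal.ofReal t < G z.1}.indicator (fun t => ENNReal.ofReal (t ^ r)) z.2) := by
    intro G H r hG hH
    have : (fun z : (Fin n → ℝ) × ℝ => H z.1 *
      {t : ℝ | ENNReal.ofReal t < G z.1}.indicator (fun t => ENNReal.ofReal (t ^ r)) z.2)
      = fun z => H z.1 * {z : (Fin n → ℝ) × ℝ | ENNReal.ofReal z.2 < G z.1}.indicator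
        (fun z => ENNReal.ofReal (z.2 ^ r)) z := by
      ext z; simp [Set.indicator]
    rw [this]
    refine (hH.comp measurable_fst).mul (Measurable.indicator (by fun_prop) ?_)
    exact measurableSet_lt (by fun_prop) (hG.comp measurable_fst)
  calc ∫⁻ x, Mw μ g x ^ q ∂μ
      = ENNReal.ofReal q * ∫⁻ x, (∫⁻ t in Ioi (0:ℝ), 1 * {t : ℝ | ENNReal.ofReal t < Mw μ g x}.indicator
          (fun t => ENNReal.ofReal (t ^ (q - 1))) t) ∂μ := by
        rw [← lintegral_const_mul' _ _ (by simp)]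
        refine lintegral_congr fun x => ?_
        simp only [one_mul]
        exact layer _ q (by linarith)
    _ = ENNReal.ofReal q * ∫⁻ t in Ioi (0:ℝ), (∫⁻ x, 1 * {t : ℝ | ENNReal.ofReal t < Mw μ g x}.indicator
          (fun t => ENNReal.ofReal (t ^ (q - 1))) t ∂μ) := by
        rw [lintegral_lintegral_swap]
        exact (meas1 (Mw μ g) (fun _ => 1) _ (Mw_meas μ g) measurable_const).aemeasurable
    _ ≤ ENNReal.ofReal q * ∫⁻ t in Ioi (0:ℝ), 2 * D * (∫⁻ x, g x * {t : ℝ | ENNReal.ofReal t < 2 * g x}.indicator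
          (fun t => ENNReal.ofReal (t ^ (q - 1 - 1))) t ∂μ) := by
        gcongr ENNReal.ofReal q * ?_
        refine setLIntegral_mono' measurableSet_Ioi fun t ht => ?_
        have ht : 0 < t := ht
        have e1 : ∫⁻ x, 1 * {t : ℝ | ENNReal.ofReal t < Mw μ g x}.indicator
          (fun t => ENNReal.ofReal (t ^ (q - 1))) t ∂μ
          = ENNReal.ofReal (t ^ (q - 1)) * μ {x | ENNReal.ofReal t < Mw μ g x} := by
          rw [← lintegral_indicator_const (measurableSet_lt measurable_const (Mw_meas μ g))]
          refine lintegral_congr fun x => ?_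
          simp [Set.indicator]
        have e2 : ∫⁻ x, g x * {t : ℝ | ENNReal.ofReal t < 2 * g x}.indicator
          (fun t => ENNReal.ofReal (t ^ (q - 1 - 1))) t ∂μ
          = ENNReal.ofReal (t ^ (q - 1 - 1)) * ∫⁻ y, {y | ENNReal.ofReal t < 2 * g y}.indicator g y ∂μ := by
          rw [← lintegral_const_mul' _ _ (by simp)]
          refine lintegral_congr fun x => ?_
          by_cases h : ENNReal.ofReal t < 2 * g x
          · simp [Set.indicator, mul_comm]
          · simp [Set.indicator, h]
        have e3 : ENNReal.ofReal (t ^ (q - 1)) = ENNReal.ofReal (t ^ (q - 1 - 1)) * ENNReal.ofReal t := by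
          rw [← ENNReal.ofReal_mul (by positivity)]
          congr 1
          rw [← Real.rpow_add_one ht.ne']
          congr 1; ring
        rw [e1, e2, e3, mul_assoc, mul_left_comm (2 * D)]
        gcongr _ * ?_
        exact weak_trunc hμ g t
    _ = ENNReal.ofReal q * (2 * D * ∫⁻ x, (∫⁻ t in Ioi (0:ℝ), g x * {t : ℝ | ENNReal.ofReal t < 2 * g x}.indicator
          (fun t => ENNReal.ofReal (t ^ (q - 1 - 1))) t) ∂μ) := by
        rw [lintegral_const_mul' _ _ (ENNReal.mul_ne_top (by simp) hD), lintegral_lintegral_swap]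
        exact ((meas1 (fun x => 2 * g x) g _ (hg.const_mul 2) hg).comp measurable_swap).aemeasurable
    _ = ENNReal.ofReal q * (2 * D * ∫⁻ x, ((ENNReal.ofReal (q - 1))⁻¹ * 2 ^ (q - 1)) * g x ^ q ∂μ) := by
        congr 2
        refine lintegral_congr fun x => ?_
        have hl := layer (2 * g x) (q - 1) hq1
        have hne : ENNReal.ofReal (q - 1) ≠ 0 := by simp [hq]
        rw [lintegral_const_mul'' _ ?_]
        · have : ∫⁻ t in Ioi (0:ℝ), {t : ℝ | ENNReal.ofReal t < 2 * g x}.indicator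
            (fun t => ENNReal.ofReal (t ^ (q - 1 - 1))) t = (ENNReal.ofReal (q - 1))⁻¹ * (2 * g x) ^ (q - 1) := by
            rw [hl, ← mul_assoc, ENNReal.inv_mul_cancel hne (by simp), one_mul]
          rw [this, ENNReal.mul_rpow_of_nonneg _ _ hq1.le]
          have h4 : g x ^ q = g x * g x ^ (q - 1) := by
            have := ENNReal.rpow_add_of_nonneg (x := g x) 1 (q - 1) (by norm_num) hq1.le
            rw [ENNReal.rpow_one] at this
            rw [← this]; congr 1; ring
          rw [h4]; ring
        · refine (Measurable.indicator (by fun_prop) ?_).aemeasurable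
          exact measurableSet_lt (by fun_prop) measurable_const
    _ = _ := by
        rw [lintegral_const_mul' _ _ (ENNReal.mul_ne_top (by simp [hq])
          (ENNReal.rpow_ne_top_of_nonneg hq1.le (by simp)))]
        ring

/-! ### Cubes -/

lemma isCube_closedBall {n : ℕ} (c : Fin n → ℝ) (r : ℝ) (hr : 0 < r) :
    IsCube (Metric.closedBall c r) := by
  refine ⟨fun i => c i - r, 2 * r, by linarith, ?_⟩
  ext x
  rw [mem_closedBall_iff_norm, pi_norm_le_iff_of_nonneg hr.le]
  simp only [Pi.sub_apply, Real.norm_eq_abs, abs_le, mem_Icc, Pi.le_def]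
  refine ⟨fun h => ⟨fun i => ?_, fun i => ?_⟩, fun h i => ⟨?_, ?_⟩⟩
  · linarith [(h i).1]
  · linarith [(h i).2]
  · linarith [h.1 i]
  · linarith [h.2 i]

lemma IsCube.ball {n : ℕ} {Q : Set (Fin n → ℝ)} (hQ : IsCube Q) :
    ∃ c r, 0 < r ∧ Q = Metric.closedBall c r := by
  obtain ⟨a, r, hr, rfl⟩ := hQ
  refine ⟨fun i => a i + r / 2, r / 2, by linarith, ?_⟩
  ext x
  rw [mem_closedBall_iff_norm, pi_norm_le_iff_of_nonneg (by linarith)]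
  simp only [Pi.sub_apply, Real.norm_eq_abs, abs_le, mem_Icc, Pi.le_def]
  refine ⟨fun h i => ⟨?_, ?_⟩, fun h => ⟨fun i => ?_, fun i => ?_⟩⟩
  · linarith [h.1 i]
  · linarith [h.2 i]
  · linarith [(h i).1]
  · linarith [(h i).2]

lemma vol_ball {n : ℕ} (c : Fin n → ℝ) {r : ℝ} (hr : 0 < r) :
    volume (Metric.closedBall c r) = ENNReal.ofReal ((2 * r) ^ n) := by
  rw [Real.volume_pi_closedBall _ hr.le]; simp

lemma vol_ne_zero {n : ℕ} (c : Fin n → ℝ) {r : ℝ} (hr : 0 < r) :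
    volume (Metric.closedBall c r) ≠ 0 := by
  rw [vol_ball c hr]; simp; positivity

lemma vol_ne_top {n : ℕ} (c : Fin n → ℝ) {r : ℝ} (hr : 0 < r) :
    volume (Metric.closedBall c r) ≠ ⊤ := by
  rw [vol_ball c hr]; simp

lemma avg_le_Mw {n : ℕ} (g : (Fin n → ℝ) → ℝ≥0∞) (c : Fin n → ℝ) (r : ℝ) (hr : 0 < r)
    (x : Fin n → ℝ) (hx : x ∈ Metric.closedBall c r) :
    (∫⁻ y in Metric.closedBall c r, g y) / volume (Metric.closedBall c r) ≤ Mw volume g x := by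
  have key : ∀ θ : ℝ, 1 < θ → (∫⁻ y in Metric.closedBall c r, g y) / volume (Metric.closedBall c r)
      ≤ ENNReal.ofReal (θ ^ n) * Mw volume g x := by
    intro θ hθ
    obtain ⟨s, hs1, hs2⟩ := exists_rat_btwn (show r < θ * r by nlinarith)
    have hs0 : 0 < s := by
      have : (0:ℝ) < s := hr.trans hs1
      exact_mod_cast this
    have : ∀ k, ∃ q : ℚ, c k < q ∧ (q : ℝ) < c k + (s - r) := fun k =>
      exists_rat_btwn (by linarith)
    choose q hq1 hq2 using this
    let i : RI n := (q, ⟨s, hs0⟩)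
    have hsub : Metric.closedBall c r ⊆ rB i := by
      refine Metric.closedBall_subset_closedBall' ?_
      have : dist c (rC i) ≤ s - r := by
        rw [dist_pi_le_iff (by linarith)]
        intro k
        change dist (c k) (q k : ℝ) ≤ _
        rw [Real.dist_eq, abs_le]
        constructor <;> linarith [hq1 k, hq2 k]
      change r + _ ≤ (s : ℝ)
      linarith
    have hv : volume (rB i) ≤ ENNReal.ofReal (θ ^ n) * volume (Metric.closedBall c r) := by
      rw [rB, vol_ball _ (rR_pos i), vol_ball _ hr, ← ENNReal.ofReal_mul (by positivity)]
      apply ENNReal.ofReal_le_ofReal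
      rw [← mul_pow]
      have : rR i = s := rfl
      have hs0' := rR_pos i
      refine pow_le_pow_left₀ (by positivity) ?_ n
      rw [this]; linarith
    have h0 := vol_ne_zero c hr
    have ht := vol_ne_top c hr
    rw [ENNReal.div_le_iff h0 ht]
    have h3 := le_Mw volume g i (hsub hx)
    replace h3 := (ENNReal.div_le_iff (vol_ne_zero (rC i) (rR_pos i)) (vol_ne_top (rC i) (rR_pos i))).1 h3
    calc _ ≤ ∫⁻ y in rB i, g y := lintegral_mono_set hsub
      _ ≤ Mw volume g x * volume (rB i) := h3
      _ ≤ Mw volume g x * (ENNReal.ofReal (θ ^ n) * volume (Metric.closedBall c r)) := by gcongr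
      _ = _ := by ring
  have hlim : Tendsto (fun θ : ℝ => ENNReal.ofReal (θ ^ n) * Mw volume g x) (nhdsWithin 1 (Ioi 1))
      (nhds (1 * Mw volume g x)) := by
    refine ENNReal.Tendsto.mul_const ?_ (Or.inl one_ne_zero)
    have : Continuous fun θ : ℝ => ENNReal.ofReal (θ ^ n) := ENNReal.continuous_ofReal.comp (continuous_pow n)
    have h := this.tendsto 1
    simp only [one_pow, ENNReal.ofReal_one] at h
    exact h.mono_left nhdsWithin_le_nhds
  rw [one_mul] at hlim
  refine ge_of_tendsto hlim ?_
  filter_upwards [self_mem_nhdsWithin] with θ hθ using key θ hθ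

lemma maximalE_eq {n : ℕ} (f : (Fin n → ℝ) → ℝ) (x : Fin n → ℝ) :
    maximalE f x = Mw volume (fun y => ENNReal.ofReal |f y|) x := by
  apply le_antisymm
  · refine iSup_le fun Q => iSup_le fun hQ => iSup_le fun hx => ?_
    obtain ⟨c, r, hr, rfl⟩ := hQ.ball
    exact avg_le_Mw _ c r hr x hx
  · refine Mw_le _ _ fun i hi => ?_
    exact le_iSup_of_le (rB i) (le_iSup_of_le (isCube_closedBall _ _ (rR_pos i))
      (le_iSup_of_le hi le_rfl))

/-! ### Weights in `ℝ≥0∞` -/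

lemma holder_one {n : ℕ} {p : ℝ} (hp : 1 < p) {W : (Fin n → ℝ) → ℝ≥0∞} (hW : Measurable W)
    (B : Set (Fin n → ℝ)) (hB : ∀ᵐ x ∂volume, W x ≠ 0 ∧ W x ≠ ⊤) :
    volume B ^ p ≤ (∫⁻ x in B, W x) * (∫⁻ x in B, W x ^ (-(1 / (p - 1)))) ^ (p - 1) := by
  have hp0 : 0 < p := by linarith
  have hp1 : 0 < p - 1 := by linarith
  have h := ENNReal.lintegral_mul_norm_pow_le (μ := volume.restrict B) (f := W)
    (g := fun x => W x ^ (-(1 / (p - 1)))) hW.aemeasurable (hW.pow_const _).aemeasurable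
    (p := 1 / p) (q := (p - 1) / p) (by positivity) (by positivity) (by field_simp; ring)
  have h1 : ∫⁻ a in B, W a ^ (1 / p) * (W a ^ (-(1 / (p - 1)))) ^ ((p - 1) / p) = volume B := by
    rw [← setLIntegral_one]
    refine lintegral_congr_ae ((ae_restrict_of_ae hB).mono fun x hx => ?_)
    simp only
    rw [← ENNReal.rpow_mul, ← ENNReal.rpow_add _ _ hx.1 hx.2]
    convert ENNReal.rpow_zero using 2
    field_simp
    ring
  rw [h1] at h
  calc volume B ^ p ≤ _ := ENNReal.rpow_le_rpow h hp0.le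
    _ = _ := by
      rw [ENNReal.mul_rpow_of_nonneg _ _ hp0.le, ← ENNReal.rpow_mul, ← ENNReal.rpow_mul]
      congr 1
      · rw [one_div_mul_cancel hp0.ne', ENNReal.rpow_one]
      · rw [div_mul_cancel₀ _ hp0.ne']

/-- measurable everywhere finite positive `A_p` weight -/
structure Wt {n : ℕ} (p : ℝ) (K : ℝ≥0∞) (W : (Fin n → ℝ) → ℝ≥0∞) : Prop where
  meas : Measurable W
  pos : ∀ x, W x ≠ 0
  fin : ∀ x, W x ≠ ⊤
  loc : ∀ c r, 0 < r → ∫⁻ x in Metric.closedBall c r, W x ≠ ⊤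
  ap : ∀ c r, 0 < r → (∫⁻ x in Metric.closedBall c r, W x) / volume (Metric.closedBall c r) *
    ((∫⁻ x in Metric.closedBall c r, W x ^ (-(1 / (p - 1)))) / volume (Metric.closedBall c r)) ^ (p - 1)
    ≤ K

lemma int_ne_zero {n : ℕ} {W : (Fin n → ℝ) → ℝ≥0∞} (hW : Measurable W) (h0 : ∀ x, W x ≠ 0)
    (c : Fin n → ℝ) {r : ℝ} (hr : 0 < r) : ∫⁻ x in Metric.closedBall c r, W x ≠ 0 := by
  intro h
  rw [lintegral_eq_zero_iff hW] at h
  have h2 : ∀ᵐ x ∂(volume.restrict (Metric.closedBall c r)), False := h.mono fun x hx => h0 x hx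
  rw [ae_iff] at h2
  simp at h2
  exact vol_ne_zero c hr (by simpa using h2)

section
variable {n : ℕ} {p : ℝ} {K : ℝ≥0∞} {W : (Fin n → ℝ) → ℝ≥0∞}

lemma Wt.ap' (h : Wt p K W) (hp : 1 < p) (c : Fin n → ℝ) {r : ℝ} (hr : 0 < r) :
    (∫⁻ x in Metric.closedBall c r, W x) *
    (∫⁻ x in Metric.closedBall c r, W x ^ (-(1 / (p - 1)))) ^ (p - 1)
    ≤ K * volume (Metric.closedBall c r) ^ p := by
  have hap := h.ap c r hr
  have h0 := vol_ne_zero c hr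
  have ht := vol_ne_top c hr
  set V := volume (Metric.closedBall c r)
  set a := ∫⁻ x in Metric.closedBall c r, W x
  set b := ∫⁻ x in Metric.closedBall c r, W x ^ (-(1 / (p - 1)))
  have hp1 : 0 < p - 1 := by linarith
  have hV : V ^ p = V * V ^ (p - 1) := by
    have := ENNReal.rpow_add_of_nonneg (x := V) 1 (p - 1) (by norm_num) hp1.le
    rw [ENNReal.rpow_one] at this
    rw [← this]; congr 1; ring
  calc a * b ^ (p - 1) = (a / V * V) * (b / V * V) ^ (p - 1) := by
        rw [ENNReal.div_mul_cancel h0 ht, ENNReal.div_mul_cancel h0 ht]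
    _ = (a / V * (b / V) ^ (p - 1)) * V ^ p := by
        rw [ENNReal.mul_rpow_of_nonneg _ _ hp1.le, hV]; ring
    _ ≤ _ := by gcongr

lemma Wt.Smeas (h : Wt p K W) : Measurable fun x => W x ^ (-(1 / (p - 1))) := h.meas.pow_const _

lemma Wt.Spos (h : Wt p K W) (x) : W x ^ (-(1 / (p - 1))) ≠ 0 := by
  rw [← pos_iff_ne_zero]
  exact ENNReal.rpow_pos (pos_iff_ne_zero.2 (h.pos x)) (h.fin x)

lemma Wt.Sfin (h : Wt p K W) (x) : W x ^ (-(1 / (p - 1))) ≠ ⊤ :=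
  fun hh => by simp [ENNReal.rpow_eq_top_iff, h.pos x, h.fin x] at hh

lemma Wt.Sloc (h : Wt p K W) (hp : 1 < p) (hK : K ≠ ⊤) (c : Fin n → ℝ) {r : ℝ} (hr : 0 < r) :
    ∫⁻ x in Metric.closedBall c r, W x ^ (-(1 / (p - 1))) ≠ ⊤ := by
  intro ht
  have := h.ap' hp c hr
  rw [ht, ENNReal.top_rpow_of_pos (by linarith), ENNReal.mul_top (int_ne_zero h.meas h.pos c hr),
    top_le_iff] at this
  exact ENNReal.mul_ne_top hK (ENNReal.rpow_ne_top_of_nonneg (by linarith) (vol_ne_top c hr)) this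

lemma Wt.dbl5 (h : Wt p K W) (hp : 1 < p) (c : Fin n → ℝ) {r : ℝ} (hr : 0 < r) :
    (∫⁻ x in Metric.closedBall c (5 * r), W x) *
    (∫⁻ x in Metric.closedBall c (5 * r), W x ^ (-(1 / (p - 1)))) ^ (p - 1)
    ≤ K * ENNReal.ofReal (5 ^ n) ^ p * ((∫⁻ x in Metric.closedBall c r, W x) *
    (∫⁻ x in Metric.closedBall c r, W x ^ (-(1 / (p - 1)))) ^ (p - 1)) := by
  have hV : volume (Metric.closedBall c (5 * r)) = ENNReal.ofReal (5 ^ n) * volume (Metric.closedBall c r) := by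
    rw [vol_ball _ (by linarith), vol_ball _ hr, ← ENNReal.ofReal_mul (by positivity), ← mul_pow]
    congr 2; ring
  refine (h.ap' hp c (r := 5 * r) (by linarith)).trans ?_
  rw [hV, ENNReal.mul_rpow_of_nonneg _ _ (by linarith), ← mul_assoc]
  gcongr
  exact holder_one hp h.meas _ (ae_of_all _ fun x => ⟨h.pos x, h.fin x⟩)

lemma Wt.dblW (h : Wt p K W) (hp : 1 < p) (hK : K ≠ ⊤) :
    Dbl (volume.withDensity W) (K * ENNReal.ofReal (5 ^ n) ^ p) := by
  have e : ∀ c r, volume.withDensity W (Metric.closedBall c r) = ∫⁻ x in Metric.closedBall c r, W x :=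
    fun c r => withDensity_apply _ Metric.isClosed_closedBall.measurableSet
  refine ⟨fun c r hr => ?_, fun c r hr => ?_, fun c r hr => ?_⟩
  · rw [e]; exact int_ne_zero h.meas h.pos c hr
  · rw [e]; exact h.loc c r hr
  · rw [e, e]
    have h5 : 0 < 5 * r := by linarith
    have hs0 : (∫⁻ x in Metric.closedBall c (5 * r), W x ^ (-(1 / (p - 1)))) ^ (p - 1) ≠ 0 := by
      rw [← pos_iff_ne_zero]
      exact ENNReal.rpow_pos (pos_iff_ne_zero.2 (int_ne_zero h.Smeas h.Spos c h5)) (h.Sloc hp hK c h5)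
    have hst : (∫⁻ x in Metric.closedBall c (5 * r), W x ^ (-(1 / (p - 1)))) ^ (p - 1) ≠ ⊤ :=
      ENNReal.rpow_ne_top_of_nonneg (by linarith) (h.Sloc hp hK c h5)
    rw [← ENNReal.mul_le_mul_iff_left hs0 hst]
    refine (h.dbl5 hp c hr).trans ?_
    rw [← mul_assoc]
    have : 0 ≤ p - 1 := by linarith
    gcongr
    linarith

lemma Wt.dblS (h : Wt p K W) (hp : 1 < p) (hK : K ≠ ⊤) :
    Dbl (volume.withDensity fun x => W x ^ (-(1 / (p - 1))))
      ((K * ENNReal.ofReal (5 ^ n) ^ p) ^ (1 / (p - 1))) := by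
  have hp1 : 0 < p - 1 := by linarith
  have e : ∀ c r, volume.withDensity (fun x => W x ^ (-(1 / (p - 1)))) (Metric.closedBall c r)
      = ∫⁻ x in Metric.closedBall c r, W x ^ (-(1 / (p - 1))) :=
    fun c r => withDensity_apply _ Metric.isClosed_closedBall.measurableSet
  refine ⟨fun c r hr => ?_, fun c r hr => ?_, fun c r hr => ?_⟩
  · rw [e]; exact int_ne_zero h.Smeas h.Spos c hr
  · rw [e]; exact h.Sloc hp hK c hr
  · rw [e, e]
    have h5 : 0 < 5 * r := by linarith
    have key : (∫⁻ x in Metric.closedBall c (5 * r), W x ^ (-(1 / (p - 1)))) ^ (p - 1) ≤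
        (K * ENNReal.ofReal (5 ^ n) ^ p) *
          (∫⁻ x in Metric.closedBall c r, W x ^ (-(1 / (p - 1)))) ^ (p - 1) := by
      rw [← ENNReal.mul_le_mul_iff_right (int_ne_zero h.meas h.pos c h5) (h.loc c _ h5)]
      refine (h.dbl5 hp c hr).trans ?_
      rw [mul_left_comm]
      gcongr
      linarith
    have := ENNReal.rpow_le_rpow key (z := 1 / (p - 1)) (by positivity)
    rw [ENNReal.mul_rpow_of_nonneg _ _ (by positivity), ← ENNReal.rpow_mul, ← ENNReal.rpow_mul,
      mul_one_div_cancel hp1.ne', ENNReal.rpow_one, ENNReal.rpow_one] at this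
    exact this

lemma Wt.lerner (h : Wt p K W) (hp : 1 < p) (hK : K ≠ ⊤) (g : (Fin n → ℝ) → ℝ≥0∞) (hg : Measurable g)
    (x : Fin n → ℝ) :
    Mw volume g x ^ (p - 1) ≤ K * Mw (volume.withDensity W) (fun y =>
      (Mw (volume.withDensity fun x => W x ^ (-(1 / (p - 1))))
        (fun z => g z * (W z ^ (-(1 / (p - 1))))⁻¹) y) ^ (p - 1) * (W y)⁻¹) x := by
  have hp1 : 0 < p - 1 := by linarith
  set S := fun x => W x ^ (-(1 / (p - 1))) with hS
  set A := Mw (volume.withDensity S) (fun z => g z * (S z)⁻¹) with hA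
  change _ ≤ K * Mw (volume.withDensity W) (fun y => A y ^ (p - 1) * (W y)⁻¹) x
  have hAm : Measurable A := Mw_meas _ _
  suffices Mw volume g x ≤ (K * Mw (volume.withDensity W) (fun y => A y ^ (p - 1) * (W y)⁻¹) x) ^ (1 / (p - 1)) by
    have h2 := ENNReal.rpow_le_rpow this hp1.le
    rwa [← ENNReal.rpow_mul, one_div_mul_cancel hp1.ne', ENNReal.rpow_one] at h2
  refine Mw_le _ _ fun i hi => ?_
  rw [one_div, ENNReal.le_rpow_inv_iff hp1]
  have hrm := rB_meas i
  have hw := le_Mw (volume.withDensity W) (fun y => A y ^ (p - 1) * (W y)⁻¹) i hi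
  have hV0 : volume (rB i) ≠ 0 := vol_ne_zero _ (rR_pos i)
  have hVt : volume (rB i) ≠ ⊤ := vol_ne_top _ (rR_pos i)
  have hs0 : ∫⁻ y in rB i, S y ≠ 0 := int_ne_zero h.Smeas h.Spos _ (rR_pos i)
  have hst : ∫⁻ y in rB i, S y ≠ ⊤ := h.Sloc hp hK _ (rR_pos i)
  have hw0 : ∫⁻ y in rB i, W y ≠ 0 := int_ne_zero h.meas h.pos _ (rR_pos i)
  have hwt : ∫⁻ y in rB i, W y ≠ ⊤ := h.loc _ _ (rR_pos i)
  have hap : (∫⁻ y in rB i, W y) / volume (rB i) * ((∫⁻ y in rB i, S y) / volume (rB i)) ^ (p - 1) ≤ K :=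
    h.ap _ _ (rR_pos i)
  have ha : ∀ y ∈ rB i, (∫⁻ z in rB i, g z) / (∫⁻ z in rB i, S z) ≤ A y := by
    intro y hy
    have := le_Mw (volume.withDensity S) (fun z => g z * (S z)⁻¹) i hy
    rw [withDensity_apply _ hrm, setLIntegral_withDensity_eq_setLIntegral_mul _ h.Smeas
      (show Measurable fun z => g z * (S z)⁻¹ from hg.mul h.Smeas.inv) hrm] at this
    refine le_trans (le_of_eq ?_) this
    congr 1
    refine lintegral_congr fun z => ?_
    simp only [Pi.mul_apply]
    rw [mul_left_comm, ENNReal.mul_inv_cancel (h.Spos z) (h.Sfin z), mul_one]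
  rw [withDensity_apply _ hrm, setLIntegral_withDensity_eq_setLIntegral_mul _ h.meas
      (show Measurable fun y => A y ^ (p - 1) * (W y)⁻¹ from (hAm.pow_const _).mul h.meas.inv) hrm] at hw
  set a := (∫⁻ z in rB i, g z) / (∫⁻ z in rB i, S z) with haa
  set V := volume (rB i)
  set s := ∫⁻ z in rB i, S z
  set ww := ∫⁻ z in rB i, W z
  have h1 : a ^ (p - 1) * V ≤ ∫⁻ y in rB i, (W * fun y => A y ^ (p - 1) * (W y)⁻¹) y := by
    rw [← setLIntegral_const]
    refine setLIntegral_mono' hrm fun y hy => ?_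
    simp only [Pi.mul_apply]
    rw [mul_left_comm, ENNReal.mul_inv_cancel (h.pos y) (h.fin y), mul_one]
    exact ENNReal.rpow_le_rpow (ha y hy) hp1.le
  have h2 : a ^ (p - 1) * V / ww ≤ Mw (volume.withDensity W) (fun y => A y ^ (p - 1) * (W y)⁻¹) x :=
    (ENNReal.div_le_div_right h1 _).trans hw
  have h3 : (∫⁻ z in rB i, g z) / V = a * (s / V) := by
    rw [haa, ← mul_div_assoc, ENNReal.div_mul_cancel hs0 hst]
  rw [h3, ENNReal.mul_rpow_of_nonneg _ _ hp1.le]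
  calc a ^ (p - 1) * (s / V) ^ (p - 1) = (ww / V * (s / V) ^ (p - 1)) * (a ^ (p - 1) * V / ww) := by
        have : ww / V * (V / ww) = 1 := by
          rw [← mul_div_assoc, ENNReal.div_mul_cancel hV0 hVt, ENNReal.div_self hw0 hwt]
        rw [mul_div_assoc, show ww / V * (s / V) ^ (p - 1) * (a ^ (p - 1) * (V / ww)) =
          (ww / V * (V / ww)) * (a ^ (p - 1) * (s / V) ^ (p - 1)) by ring, this, one_mul]
    _ ≤ _ := by gcongr

theorem Wt.muckenhoupt (h : Wt p K W) (hp : 1 < p) (hK : K ≠ ⊤) :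
    ∃ C : ℝ≥0∞, C ≠ ⊤ ∧ ∀ g : (Fin n → ℝ) → ℝ≥0∞, Measurable g →
      ∫⁻ x, Mw volume g x ^ p * W x ≤ C * ∫⁻ x, g x ^ p * W x := by
  have hp1 : 0 < p - 1 := by linarith
  have hp0 : 0 < p := by linarith
  have hq : 1 < p / (p - 1) := by rw [lt_div_iff₀ hp1]; linarith
  set S := fun x => W x ^ (-(1 / (p - 1))) with hS
  have hD : K * ENNReal.ofReal (5 ^ n) ^ p ≠ ⊤ :=
    ENNReal.mul_ne_top hK (ENNReal.rpow_ne_top_of_nonneg hp0.le (by simp))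
  obtain ⟨C1, hC1, H1⟩ := strong_type (h.dblW hp hK) hD (p / (p - 1)) hq
  obtain ⟨C2, hC2, H2⟩ := strong_type (h.dblS hp hK)
    (ENNReal.rpow_ne_top_of_nonneg (by positivity) hD) p hp
  refine ⟨K ^ (p / (p - 1)) * (C1 * C2), ?_, fun g hg => ?_⟩
  · exact ENNReal.mul_ne_top (ENNReal.rpow_ne_top_of_nonneg (by positivity) hK)
      (ENNReal.mul_ne_top hC1 hC2)
  have hl := h.lerner hp hK g hg
  change ∀ x, Mw volume g x ^ (p - 1) ≤ K * Mw (volume.withDensity W) (fun y =>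
      (Mw (volume.withDensity S) (fun z => g z * (S z)⁻¹) y) ^ (p - 1) * (W y)⁻¹) x at hl
  set A := Mw (volume.withDensity S) (fun z => g z * (S z)⁻¹) with hA
  have hAm : Measurable A := Mw_meas _ _
  have hSm : Measurable S := h.Smeas
  set H := fun y => A y ^ (p - 1) * (W y)⁻¹ with hH
  have hHm : Measurable H := (hAm.pow_const _).mul h.meas.inv
  have G1 := H1 H hHm
  have G2 : ∫⁻ x, A x ^ p ∂volume.withDensity S ≤
      C2 * ∫⁻ x, (g x * (S x)⁻¹) ^ p ∂volume.withDensity S := H2 (fun z => g z * (S z)⁻¹) (hg.mul hSm.inv)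
  rw [lintegral_withDensity_eq_lintegral_mul _ h.meas ((Mw_meas _ _).pow_const _),
    lintegral_withDensity_eq_lintegral_mul _ h.meas (hHm.pow_const _)] at G1
  rw [lintegral_withDensity_eq_lintegral_mul _ hSm (hAm.pow_const _),
    lintegral_withDensity_eq_lintegral_mul _ hSm
      (show Measurable fun x => (g x * (S x)⁻¹) ^ p from (hg.mul hSm.inv).pow_const _)] at G2
  simp only [Pi.mul_apply] at G1 G2
  have E1 : ∀ x, W x * H x ^ (p / (p - 1)) = S x * A x ^ p := by
    intro x
    simp only [hH, hS]
    rw [ENNReal.mul_rpow_of_nonneg _ _ (by positivity), ← ENNReal.rpow_mul, mul_div_cancel₀ _ hp1.ne',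
      ENNReal.inv_rpow, ← ENNReal.rpow_neg]
    rw [mul_left_comm, mul_comm (A x ^ p)]
    nth_rw 1 [← ENNReal.rpow_one (W x)]
    rw [← ENNReal.rpow_add _ _ (h.pos x) (h.fin x)]
    congr 2
    field_simp
    ring
  have E2 : ∀ x, S x * (g x * (S x)⁻¹) ^ p = g x ^ p * W x := by
    intro x
    simp only [hS]
    rw [ENNReal.mul_rpow_of_nonneg _ _ hp0.le, ENNReal.inv_rpow, ← ENNReal.rpow_neg,
      ← ENNReal.rpow_mul, mul_left_comm,
      ← ENNReal.rpow_add _ _ (h.pos x) (h.fin x)]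
    congr 1
    conv_rhs => rw [← ENNReal.rpow_one (W x)]
    congr 1
    field_simp
    ring
  simp only [E1] at G1
  simp only [E2] at G2
  have hKt : K ^ (p / (p - 1)) ≠ ⊤ := ENNReal.rpow_ne_top_of_nonneg (by positivity) hK
  calc ∫⁻ x, Mw volume g x ^ p * W x
      ≤ ∫⁻ x, K ^ (p / (p - 1)) * (W x * Mw (volume.withDensity W) H x ^ (p / (p - 1))) := by
        refine lintegral_mono fun x => ?_
        have := ENNReal.rpow_le_rpow (hl x) (z := p / (p - 1)) (by positivity)
        rw [← ENNReal.rpow_mul, mul_div_cancel₀ _ hp1.ne', ENNReal.mul_rpow_of_nonneg _ _ (by positivity)] at this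
        calc _ ≤ _ := mul_le_mul_left this (W x)
          _ = _ := by ring
    _ = K ^ (p / (p - 1)) * ∫⁻ x, W x * Mw (volume.withDensity W) H x ^ (p / (p - 1)) :=
        lintegral_const_mul' _ _ hKt
    _ ≤ K ^ (p / (p - 1)) * (C1 * (C2 * ∫⁻ x, g x ^ p * W x)) := by
        gcongr K ^ (p / (p - 1)) * ?_
        exact G1.trans (by gcongr)
    _ = _ := by ring

end

/-! ### Passing from real weights to `ℝ≥0∞` weights; the norm of the maximal operator -/

lemma avg_congr {n : ℕ} {Q : Set (Fin n → ℝ)} {f : (Fin n → ℝ) → ℝ} {g : (Fin n → ℝ) → ℝ≥0∞}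
    (h : ∀ᵐ x, ENNReal.ofReal (f x) = g x) : avg Q f = (∫⁻ x in Q, g x) / volume Q := by
  unfold avg
  rw [lintegral_congr_ae (ae_restrict_of_ae h)]

lemma exists_Wt {n : ℕ} {p : ℝ} {w : (Fin n → ℝ) → ℝ} (hw : MemAp p w) :
    ∃ W : (Fin n → ℝ) → ℝ≥0∞, Wt p (apCharE p w) W ∧ ∀ᵐ x, ENNReal.ofReal (w x) = W x := by
  obtain ⟨⟨hpos, hloc⟩, hfin⟩ := hw
  have hm := hloc.aestronglyMeasurable
  set w0 := hm.mk w with hw0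
  have hw0m : Measurable w0 := hm.stronglyMeasurable_mk.measurable
  have hms : MeasurableSet {x | 0 < w0 x} := measurableSet_lt measurable_const hw0m
  classical
  set W : (Fin n → ℝ) → ℝ≥0∞ := fun x => if 0 < w0 x then ENNReal.ofReal (w0 x) else 1 with hW
  have hae : ∀ᵐ x, 0 < w x ∧ ENNReal.ofReal (w x) = W x := by
    filter_upwards [hpos, hm.ae_eq_mk] with x h1 h2
    refine ⟨h1, ?_⟩
    have h2' : w x = w0 x := h2
    simp only [hW]
    rw [← h2', if_pos h1]
  have hae1 : ∀ᵐ x, ENNReal.ofReal (w x) = W x := hae.mono fun x h => h.2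
  have hae2 : ∀ᵐ x, ENNReal.ofReal (w x ^ (-(1 / (p - 1)))) = W x ^ (-(1 / (p - 1))) := by
    filter_upwards [hae] with x hx
    rw [← hx.2, ENNReal.ofReal_rpow_of_pos hx.1]
  refine ⟨W, ⟨?_, ?_, ?_, ?_, ?_⟩, hae1⟩
  · exact Measurable.ite hms hw0m.ennreal_ofReal measurable_const
  · intro x
    simp only [hW]
    split_ifs with h
    · simpa using h
    · simp
  · intro x
    simp only [hW]
    split_ifs with h <;> simp
  · intro c r hr
    rw [← lintegral_congr_ae (ae_restrict_of_ae hae1)]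
    have := hloc.integrableOn_isCompact (isCompact_closedBall c r)
    exact this.lintegral_lt_top.ne
  · intro c r hr
    rw [← avg_congr hae1, ← avg_congr hae2]
    exact le_iSup₂_of_le (Metric.closedBall c r) (isCube_closedBall c r hr) le_rfl

lemma eLpNormW_eq {n : ℕ} {p : ℝ} (hp : 0 < p) {w : (Fin n → ℝ) → ℝ} {W : (Fin n → ℝ) → ℝ≥0∞}
    (h : ∀ᵐ x, ENNReal.ofReal (w x) = W x) (f : (Fin n → ℝ) → ℝ) :
    eLpNormW p w f = (∫⁻ x, ENNReal.ofReal |f x| ^ p * W x) ^ (1 / p) := by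
  unfold eLpNormW
  congr 1
  refine lintegral_congr_ae (h.mono fun x hx => ?_)
  simp only
  rw [hx, ENNReal.ofReal_rpow_of_nonneg (abs_nonneg _) hp.le]

lemma Mw_congr {n : ℕ} {g g' : (Fin n → ℝ) → ℝ≥0∞} (h : g =ᵐ[volume] g') (x : Fin n → ℝ) :
    Mw volume g x = Mw volume g' x := by
  unfold Mw
  congr 1
  ext i
  rw [lintegral_congr_ae (ae_restrict_of_ae h)]

section
variable {n : ℕ} {p : ℝ} {K : ℝ≥0∞} {W : (Fin n → ℝ) → ℝ≥0∞} {w : (Fin n → ℝ) → ℝ}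

lemma Wt.finite_ae (h : Wt p K W) (hp : 0 < p) {g : (Fin n → ℝ) → ℝ≥0∞} (hg : Measurable g)
    (hfin : ∫⁻ x, g x ^ p * W x ≠ ⊤) : ∀ᵐ x, g x ≠ ⊤ := by
  have := ae_lt_top ((hg.pow_const p).mul h.meas) hfin
  refine this.mono fun x hx hgx => ?_
  simp [hgx, ENNReal.top_rpow_of_pos hp, ENNReal.top_mul (h.pos x)] at hx

lemma Wt.strong_nonempty (h : Wt p K W) (hp : 1 < p) (hK : K ≠ ⊤)
    (hw : ∀ᵐ x, ENNReal.ofReal (w x) = W x) : { c : ℝ | 0 ≤ c ∧ StrongBound p w maximal c }.Nonempty := by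
  have hp0 : 0 < p := by linarith
  obtain ⟨C, hC, H⟩ := h.muckenhoupt hp hK
  have hC' : C ^ (1 / p) ≠ ⊤ := ENNReal.rpow_ne_top_of_nonneg (by positivity) hC
  refine ⟨(C ^ (1 / p)).toReal, ENNReal.toReal_nonneg, fun f hf => ?_⟩
  rw [ENNReal.ofReal_toReal hC', eLpNormW_eq hp0 hw, eLpNormW_eq hp0 hw,
    ← ENNReal.mul_rpow_of_nonneg _ _ (by positivity)]
  refine ENNReal.rpow_le_rpow (le_trans (lintegral_mono fun x => ?_)
    (H (fun x => ENNReal.ofReal |f x|) hf.1.abs.ennreal_ofReal)) (by positivity)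
  gcongr
  rw [maximal, abs_of_nonneg ENNReal.toReal_nonneg, maximalE_eq]
  exact ENNReal.ofReal_toReal_le

lemma Wt.strong_opNorm (h : Wt p K W) (hp : 1 < p) (hK : K ≠ ⊤)
    (hw : ∀ᵐ x, ENNReal.ofReal (w x) = W x) : StrongBound p w maximal (opNorm p w maximal) := by
  intro f hf
  have hne := h.strong_nonempty hp hK hw
  obtain ⟨u, -, hu, hmem⟩ := exists_seq_tendsto_sInf hne ⟨0, fun c hc => hc.1⟩
  have : Tendsto (fun k => ENNReal.ofReal (u k) * eLpNormW p w f) atTop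
      (nhds (ENNReal.ofReal (opNorm p w maximal) * eLpNormW p w f)) :=
    ENNReal.Tendsto.mul_const (ENNReal.tendsto_ofReal hu) (Or.inr hf.2)
  exact ge_of_tendsto' this fun k => (hmem k).2 f hf

lemma Wt.one_le_opNorm (h : Wt p K W) (hp : 1 < p) (hK : K ≠ ⊤)
    (hw : ∀ᵐ x, ENNReal.ofReal (w x) = W x) : 1 ≤ opNorm p w maximal := by
  have hp0 : 0 < p := by linarith
  set B : Set (Fin n → ℝ) := Metric.closedBall 0 1 with hB
  have hBm : MeasurableSet B := Metric.isClosed_closedBall.measurableSet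
  set f : (Fin n → ℝ) → ℝ := B.indicator fun _ => 1 with hf
  have hfe : ∀ x, ENNReal.ofReal |f x| = B.indicator (fun _ => (1 : ℝ≥0∞)) x := by
    intro x
    by_cases hx : x ∈ B <;> simp [hf, hx]
  have hfn : eLpNormW p w f = (∫⁻ x in B, W x) ^ (1 / p) := by
    rw [eLpNormW_eq hp0 hw, ← lintegral_indicator hBm]
    congr 1
    refine lintegral_congr fun x => ?_
    rw [hfe]
    by_cases hx : x ∈ B <;> simp [hx, hp0]
  have hi0 : ∫⁻ x in B, W x ≠ 0 := int_ne_zero h.meas h.pos _ one_pos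
  have hit : ∫⁻ x in B, W x ≠ ⊤ := h.loc _ _ one_pos
  have ht : eLpNormW p w f ≠ ⊤ := by
    rw [hfn]; exact ENNReal.rpow_ne_top_of_nonneg (by positivity) hit
  have h0 : eLpNormW p w f ≠ 0 := by
    rw [hfn, ← pos_iff_ne_zero]; exact ENNReal.rpow_pos (pos_iff_ne_zero.2 hi0) hit
  have hfm : Measurable f := measurable_const.indicator hBm
  have hs := h.strong_opNorm hp hK hw f ⟨hfm, ht⟩
  have hle : eLpNormW p w f ≤ eLpNormW p w (maximal f) := by
    rw [eLpNormW_eq hp0 hw, eLpNormW_eq hp0 hw]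
    refine ENNReal.rpow_le_rpow (lintegral_mono fun x => ?_) (by positivity)
    refine mul_le_mul_left (ENNReal.rpow_le_rpow ?_ hp0.le) _
    rw [maximal, abs_of_nonneg ENNReal.toReal_nonneg, maximalE_eq, ENNReal.ofReal_toReal]
    · rw [hfe]
      by_cases hx : x ∈ B
      · refine le_trans ?_ (avg_le_Mw _ 0 1 one_pos x hx)
        rw [setLIntegral_congr_fun (g := fun _ => 1) hBm (fun y hy => by simp [hfe, hy]), setLIntegral_one,
          ENNReal.div_self (vol_ne_zero _ one_pos) (vol_ne_top _ one_pos)]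
        simp [hx]
      · simp [hx]
    · refine ne_top_of_le_ne_top ENNReal.one_ne_top (Mw_le _ _ fun i _ => ?_)
      refine ENNReal.div_le_of_le_mul ?_
      rw [one_mul, ← setLIntegral_one]
      refine lintegral_mono fun y => ?_
      rw [hfe]
      exact Set.indicator_le_self' (by simp) y
  have : 1 * eLpNormW p w f ≤ ENNReal.ofReal (opNorm p w maximal) * eLpNormW p w f := by
    rw [one_mul]; exact hle.trans hs
  rw [ENNReal.mul_le_mul_iff_left h0 ht] at this
  simpa using this

lemma Wt.Mw_bound (h : Wt p K W) (hp : 1 < p) (hK : K ≠ ⊤)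
    (hw : ∀ᵐ x, ENNReal.ofReal (w x) = W x) (g : (Fin n → ℝ) → ℝ≥0∞) (hg : Measurable g) :
    (∫⁻ x, Mw volume g x ^ p * W x) ^ (1 / p) ≤
      ENNReal.ofReal (opNorm p w maximal) * (∫⁻ x, g x ^ p * W x) ^ (1 / p) := by
  have hp0 : 0 < p := by linarith
  have hN := h.one_le_opNorm hp hK hw
  by_cases hfin : ∫⁻ x, g x ^ p * W x = ⊤
  · rw [hfin, ENNReal.top_rpow_of_pos (by positivity), ENNReal.mul_top]
    · exact le_top
    · simp; linarith
  have hgt := h.finite_ae hp0 hg hfin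
  obtain ⟨C, hC, H⟩ := h.muckenhoupt hp hK
  have hMfin : ∫⁻ x, Mw volume g x ^ p * W x ≠ ⊤ :=
    ne_top_of_le_ne_top (ENNReal.mul_ne_top hC hfin) (H g hg)
  have hMt := h.finite_ae hp0 (Mw_meas _ _) hMfin
  set f : (Fin n → ℝ) → ℝ := fun x => (g x).toReal with hf
  have hfe : (fun x => ENNReal.ofReal |f x|) =ᵐ[volume] g := by
    filter_upwards [hgt] with x hx
    simp only [hf]
    rw [abs_of_nonneg ENNReal.toReal_nonneg, ENNReal.ofReal_toReal hx]
  have hfn : eLpNormW p w f = (∫⁻ x, g x ^ p * W x) ^ (1 / p) := by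
    rw [eLpNormW_eq hp0 hw]
    congr 1
    refine lintegral_congr_ae (hfe.mono fun x hx => ?_)
    simp only at hx ⊢
    rw [hx]
  have hs := h.strong_opNorm hp hK hw f ⟨hg.ennreal_toReal, by
    rw [hfn]; exact ENNReal.rpow_ne_top_of_nonneg (by positivity) hfin⟩
  rw [hfn, eLpNormW_eq hp0 hw] at hs
  refine le_trans (le_of_eq ?_) hs
  congr 1
  refine lintegral_congr_ae (hMt.mono fun x hx => ?_)
  simp only
  rw [maximal, abs_of_nonneg ENNReal.toReal_nonneg, maximalE_eq, Mw_congr hfe, ENNReal.ofReal_toReal hx]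

end

/-! ### The Rubio de Francia algorithm -/

lemma lp_tsum {α : Type*} [MeasurableSpace α] (μ : Measure α) {p : ℝ} (hp : 1 ≤ p)
    (f : ℕ → α → ℝ≥0∞) (hf : ∀ k, Measurable (f k)) :
    (∫⁻ x, (∑' k, f k x) ^ p ∂μ) ^ (1 / p) ≤ ∑' k, (∫⁻ x, f k x ^ p ∂μ) ^ (1 / p) := by
  have hp0 : 0 < p := by linarith
  have hsum : ∀ m : ℕ, Measurable fun x => ∑ k ∈ Finset.range m, f k x := fun m =>
    Finset.measurable_sum _ fun k _ => hf k
  have hpart : ∀ m : ℕ, (∫⁻ x, (∑ k ∈ Finset.range m, f k x) ^ p ∂μ) ^ (1 / p) ≤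
      ∑ k ∈ Finset.range m, (∫⁻ x, f k x ^ p ∂μ) ^ (1 / p) := by
    intro m
    induction m with
    | zero => simp [hp0]
    | succ m ih =>
      rw [Finset.sum_range_succ]
      refine le_trans ?_ (add_le_add_left ih _)
      have := ENNReal.lintegral_Lp_add_le (μ := μ) (hsum m).aemeasurable (hf m).aemeasurable hp
      simpa [Finset.sum_range_succ] using this
  have h1 : ∀ x, (∑' k, f k x) ^ p = ⨆ m : ℕ, (∑ k ∈ Finset.range m, f k x) ^ p := by
    intro x
    rw [ENNReal.tsum_eq_iSup_nat]
    exact (ENNReal.orderIsoRpow p hp0).map_iSup _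
  have h2 : ∫⁻ x, (∑' k, f k x) ^ p ∂μ = ⨆ m : ℕ, ∫⁻ x, (∑ k ∈ Finset.range m, f k x) ^ p ∂μ := by
    simp only [h1]
    rw [lintegral_iSup (fun m => (hsum m).pow_const p)]
    intro a b hab x
    refine ENNReal.rpow_le_rpow ?_ hp0.le
    exact Finset.sum_le_sum_of_subset (Finset.range_mono hab)
  rw [h2]
  have h3 : (⨆ m : ℕ, ∫⁻ x, (∑ k ∈ Finset.range m, f k x) ^ p ∂μ) ^ (1 / p)
      = ⨆ m : ℕ, (∫⁻ x, (∑ k ∈ Finset.range m, f k x) ^ p ∂μ) ^ (1 / p) :=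
    (ENNReal.orderIsoRpow (1 / p) (by positivity)).map_iSup _
  rw [h3]
  exact iSup_le fun m => (hpart m).trans (ENNReal.sum_le_tsum _)

/-- iterated maximal function -/
def itM {n : ℕ} (g : (Fin n → ℝ) → ℝ≥0∞) : ℕ → (Fin n → ℝ) → ℝ≥0∞
  | 0 => g
  | k + 1 => Mw volume (itM g k)

/-- Rubio de Francia operator -/
def RdF {n : ℕ} (c : ℝ≥0∞) (g : (Fin n → ℝ) → ℝ≥0∞) (x : Fin n → ℝ) : ℝ≥0∞ :=
  ∑' k, (c⁻¹) ^ k * itM g k x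

section
variable {n : ℕ} {g : (Fin n → ℝ) → ℝ≥0∞} {c : ℝ≥0∞}

lemma itM_meas (hg : Measurable g) : ∀ k, Measurable (itM g k)
  | 0 => hg
  | _ + 1 => Mw_meas _ _

lemma RdF_meas (hg : Measurable g) : Measurable (RdF c g) :=
  Measurable.ennreal_tsum fun k => (itM_meas hg k).const_mul _

lemma le_RdF (x : Fin n → ℝ) : g x ≤ RdF c g x := by
  refine le_trans (le_of_eq ?_) (ENNReal.le_tsum 0)
  simp [itM]

lemma Mw_RdF (hg : Measurable g) (hc0 : c ≠ 0) (hct : c ≠ ⊤) (x : Fin n → ℝ) :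
    Mw volume (RdF c g) x ≤ c * RdF c g x := by
  refine Mw_le _ _ fun i hi => ?_
  have h1 : ∫⁻ y in rB i, RdF c g y = ∑' k, (c⁻¹) ^ k * ∫⁻ y in rB i, itM g k y := by
    unfold RdF
    rw [lintegral_tsum (fun k => ((itM_meas hg k).const_mul _).aemeasurable)]
    congr 1; ext k
    rw [lintegral_const_mul _ (itM_meas hg k)]
  rw [h1, div_eq_mul_inv, ← ENNReal.tsum_mul_right]
  have h2 : c * RdF c g x ≥ ∑' k, (c⁻¹) ^ k * itM g (k + 1) x := by
    unfold RdF
    rw [tsum_eq_zero_add' ENNReal.summable, mul_add, ← ENNReal.tsum_mul_left]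
    refine le_trans (le_of_eq ?_) le_add_self
    congr 1; ext k
    rw [← mul_assoc, pow_succ', ← mul_assoc, ENNReal.mul_inv_cancel hc0 hct, one_mul]
  refine le_trans (ENNReal.tsum_le_tsum fun k => ?_) h2
  rw [mul_assoc]
  gcongr
  exact le_Mw volume (itM g k) i hi

lemma Mw_pos (hg : Measurable g) (h : ¬ g =ᵐ[volume] 0) (x : Fin n → ℝ) : Mw volume g x ≠ 0 := by
  intro h0
  apply h
  have h1 : ∀ k : ℕ, ∀ᵐ y ∂volume.restrict (Metric.closedBall x ((k : ℝ) + 1)), g y = 0 := by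
    intro k
    have hk : (0:ℝ) < k + 1 := by positivity
    have := avg_le_Mw g x _ hk x (Metric.mem_closedBall_self hk.le)
    rw [h0, nonpos_iff_eq_zero, ENNReal.div_eq_zero_iff] at this
    exact (lintegral_eq_zero_iff hg).1 (this.resolve_right (vol_ne_top x hk))
  rw [← ae_restrict_iUnion_iff] at h1
  have hU : (⋃ k : ℕ, Metric.closedBall x ((k : ℝ) + 1)) = univ := by
    refine eq_univ_of_forall fun y => mem_iUnion.2 ?_
    obtain ⟨k, hk⟩ := exists_nat_ge (dist y x)
    exact ⟨k, Metric.mem_closedBall.2 (by linarith)⟩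
  rw [hU, Measure.restrict_univ] at h1
  exact h1

lemma RdF_pos (hg : Measurable g) (hct : c ≠ ⊤) (h : ¬ g =ᵐ[volume] 0) (x : Fin n → ℝ) :
    RdF c g x ≠ 0 := by
  have : (c⁻¹) ^ 1 * itM g 1 x ≤ RdF c g x := ENNReal.le_tsum 1
  intro h0
  rw [h0, nonpos_iff_eq_zero, pow_one] at this
  exact mul_ne_zero (ENNReal.inv_ne_zero.2 hct) (Mw_pos hg h x) this

variable {p : ℝ} {K : ℝ≥0∞} {W : (Fin n → ℝ) → ℝ≥0∞}

lemma Wt.RdF_norm (h : Wt p K W) (hp : 1 < p) (hg : Measurable g) (N ε : ℝ) (hN : 1 ≤ N) (hε : 0 < ε)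
    (hb : ∀ g : (Fin n → ℝ) → ℝ≥0∞, Measurable g → (∫⁻ x, Mw volume g x ^ p * W x) ^ (1 / p) ≤
      ENNReal.ofReal N * (∫⁻ x, g x ^ p * W x) ^ (1 / p)) :
    (∫⁻ x, RdF (ENNReal.ofReal ((1 + ε) * N)) g x ^ p * W x) ^ (1 / p) ≤
      ENNReal.ofReal ((1 + ε) / ε) * (∫⁻ x, g x ^ p * W x) ^ (1 / p) := by
  have hp0 : 0 < p := by linarith
  set c := ENNReal.ofReal ((1 + ε) * N) with hc
  have hconv : ∀ f : (Fin n → ℝ) → ℝ≥0∞, Measurable f →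
      ∫⁻ x, f x ^ p ∂(volume.withDensity W) = ∫⁻ x, f x ^ p * W x := by
    intro f hf
    rw [lintegral_withDensity_eq_lintegral_mul _ h.meas (hf.pow_const p)]
    refine lintegral_congr fun x => ?_
    simp only [Pi.mul_apply, mul_comm]
  have hit : ∀ k, (∫⁻ x, itM g k x ^ p * W x) ^ (1 / p) ≤
      ENNReal.ofReal N ^ k * (∫⁻ x, g x ^ p * W x) ^ (1 / p) := by
    intro k
    induction k with
    | zero => simp [itM]
    | succ k ih =>
      refine (hb _ (itM_meas hg k)).trans ?_
      rw [pow_succ', mul_assoc]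
      gcongr
  have hcN : c⁻¹ * ENNReal.ofReal N = ENNReal.ofReal ((1 + ε)⁻¹) := by
    rw [hc, ← ENNReal.ofReal_inv_of_pos (by positivity), ← ENNReal.ofReal_mul (by positivity)]
    congr 1
    field_simp
  have hgeo : ∑' k : ℕ, ENNReal.ofReal ((1 + ε)⁻¹) ^ k = ENNReal.ofReal ((1 + ε) / ε) := by
    rw [ENNReal.tsum_geometric, ← ENNReal.ofReal_one, ← ENNReal.ofReal_sub _ (by positivity),
      ← ENNReal.ofReal_inv_of_pos]
    · have h1 : 1 - (1 + ε)⁻¹ = ε / (1 + ε) := by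
        field_simp
        ring
      rw [h1, inv_div]
    · have : (1 + ε)⁻¹ < 1 := inv_lt_one_of_one_lt₀ (by linarith)
      linarith
  rw [← hconv _ (RdF_meas hg)]
  refine (lp_tsum _ hp.le (fun k x => (c⁻¹) ^ k * itM g k x)
    (fun k => (itM_meas hg k).const_mul _)).trans ?_
  rw [← hgeo, ← ENNReal.tsum_mul_right]
  refine ENNReal.tsum_le_tsum fun k => ?_
  rw [hconv _ ((itM_meas hg k).const_mul _)]
  have hck : ((c⁻¹) ^ k) ≠ ⊤ := by
    refine ENNReal.pow_ne_top (ENNReal.inv_ne_top.2 ?_)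
    rw [hc]; simp; positivity
  have e : ∫⁻ x, ((c⁻¹) ^ k * itM g k x) ^ p * W x = ((c⁻¹) ^ k) ^ p * ∫⁻ x, itM g k x ^ p * W x := by
    rw [← lintegral_const_mul' _ _ (ENNReal.rpow_ne_top_of_nonneg hp0.le hck)]
    refine lintegral_congr fun x => ?_
    rw [ENNReal.mul_rpow_of_nonneg _ _ hp0.le, mul_assoc]
  rw [e, ENNReal.mul_rpow_of_nonneg _ _ (by positivity), ← ENNReal.rpow_mul, mul_one_div_cancel hp0.ne',
    ENNReal.rpow_one, ← hcN, mul_pow, mul_assoc]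
  gcongr
  exact hit k

/-! ### The new weight -/

lemma Wt.new_weight (h : Wt p K W) (hp : 1 < p) {p₀ : ℝ} (hpp : p < p₀)
    {G : (Fin n → ℝ) → ℝ≥0∞} (hG : Measurable G) (hG0 : ∀ x, G x ≠ 0) (hGt : ∀ᵐ x, G x ≠ ⊤)
    (hc0 : c ≠ 0) (hct : c ≠ ⊤) (hM : ∀ x, Mw volume G x ≤ c * G x)
    (z : Fin n → ℝ) {r : ℝ} (hr : 0 < r) :
    ∫⁻ x in Metric.closedBall z r, W x * G x ^ (-(p₀ - p)) ≠ ⊤ ∧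
    (∫⁻ x in Metric.closedBall z r, W x * G x ^ (-(p₀ - p))) / volume (Metric.closedBall z r) *
      ((∫⁻ x in Metric.closedBall z r, (W x * G x ^ (-(p₀ - p))) ^ (-(1 / (p₀ - 1)))) /
        volume (Metric.closedBall z r)) ^ (p₀ - 1) ≤ c ^ (p₀ - p) * K := by
  have hs : 0 < p₀ - p := by linarith
  have hp1 : 0 < p - 1 := by linarith
  have hp01 : 0 < p₀ - 1 := by linarith
  have hV0 := vol_ne_zero z hr
  have hVt := vol_ne_top z hr
  have hap := h.ap z r hr
  have hloc := h.loc z r hr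
  have hint0 := int_ne_zero hG hG0 z hr
  have havg := fun x (hx : x ∈ Metric.closedBall z r) => (avg_le_Mw G z r hr x hx).trans (hM x)
  have hBm : MeasurableSet (Metric.closedBall z r) := Metric.isClosed_closedBall.measurableSet
  set B := Metric.closedBall z r with hB
  set V := volume B with hV
  set a := (∫⁻ x in B, G x) / V with ha
  have ha0 : a ≠ 0 := by
    rw [ha, Ne, ENNReal.div_eq_zero_iff]
    tauto
  have hat : a ≠ ⊤ := by
    intro hat
    have h1 : ∀ᵐ x ∂volume.restrict B, False := by
      filter_upwards [ae_restrict_of_ae hGt, ae_restrict_mem hBm] with x hx hxB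
      have := havg x hxB
      rw [hat, top_le_iff] at this
      exact ENNReal.mul_ne_top hct hx this
    rw [ae_iff] at h1
    simp at h1
    exact hV0 (by simpa using h1)
  have has0 : a ^ (p₀ - p) ≠ 0 := by
    rw [← pos_iff_ne_zero]; exact ENNReal.rpow_pos (pos_iff_ne_zero.2 ha0) hat
  have hast : a ^ (p₀ - p) ≠ ⊤ := ENNReal.rpow_ne_top_of_nonneg hs.le hat
  have hcs0 : c ^ (p₀ - p) ≠ 0 := by
    rw [← pos_iff_ne_zero]; exact ENNReal.rpow_pos (pos_iff_ne_zero.2 hc0) hct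
  have hcst : c ^ (p₀ - p) ≠ ⊤ := ENNReal.rpow_ne_top_of_nonneg hs.le hct
  have hpt : ∀ x ∈ B, G x ^ (-(p₀ - p)) ≤ c ^ (p₀ - p) * (a ^ (p₀ - p))⁻¹ := by
    intro x hx
    have h1 := ENNReal.rpow_le_rpow (havg x hx) hs.le
    rw [ENNReal.mul_rpow_of_nonneg _ _ hs.le] at h1
    have h2 := ENNReal.inv_le_inv.2 h1
    rw [ENNReal.mul_inv (Or.inl hcs0) (Or.inl hcst)] at h2
    rw [ENNReal.rpow_neg]
    calc (G x ^ (p₀ - p))⁻¹ = c ^ (p₀ - p) * ((c ^ (p₀ - p))⁻¹ * (G x ^ (p₀ - p))⁻¹) := by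
          rw [← mul_assoc, ENNReal.mul_inv_cancel hcs0 hcst, one_mul]
      _ ≤ _ := by gcongr
  have hI : ∫⁻ x in B, W x * G x ^ (-(p₀ - p)) ≤ c ^ (p₀ - p) * (a ^ (p₀ - p))⁻¹ * ∫⁻ x in B, W x := by
    rw [← lintegral_const_mul _ h.meas]
    refine setLIntegral_mono' hBm fun x hx => ?_
    rw [mul_comm]
    gcongr
    exact hpt x hx
  have hconst : c ^ (p₀ - p) * (a ^ (p₀ - p))⁻¹ ≠ ⊤ := ENNReal.mul_ne_top hcst (ENNReal.inv_ne_top.2 has0)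
  refine ⟨ne_top_of_le_ne_top (ENNReal.mul_ne_top hconst hloc) hI, ?_⟩
  set sB := ∫⁻ x in B, W x ^ (-(1 / (p - 1))) with hsB
  have hθ : (p - 1) / (p₀ - 1) + (p₀ - p) / (p₀ - 1) = 1 := by field_simp; ring
  have hJ : ∫⁻ x in B, (W x * G x ^ (-(p₀ - p))) ^ (-(1 / (p₀ - 1))) ≤
      sB ^ ((p - 1) / (p₀ - 1)) * (∫⁻ x in B, G x) ^ ((p₀ - p) / (p₀ - 1)) := by
    refine le_trans (le_of_eq ?_) (ENNReal.lintegral_mul_norm_pow_le (μ := volume.restrict B)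
      h.Smeas.aemeasurable hG.aemeasurable (by positivity) (by positivity) hθ)
    refine lintegral_congr_ae ((ae_restrict_of_ae hGt).mono fun x hx => ?_)
    simp only
    have hGs : G x ^ (-(p₀ - p)) ≠ ⊤ := ENNReal.rpow_ne_top_of_ne_zero (hG0 x) hx
    rw [ENNReal.mul_rpow_of_ne_top (h.fin x) hGs, ← ENNReal.rpow_mul, ← ENNReal.rpow_mul]
    congr 2
    · field_simp
    · field_simp
  have hJ' : (∫⁻ x in B, (W x * G x ^ (-(p₀ - p))) ^ (-(1 / (p₀ - 1)))) / V ≤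
      (sB / V) ^ ((p - 1) / (p₀ - 1)) * a ^ ((p₀ - p) / (p₀ - 1)) := by
    refine ENNReal.div_le_of_le_mul (hJ.trans (le_of_eq ?_))
    have hVV : V = V ^ ((p - 1) / (p₀ - 1)) * V ^ ((p₀ - p) / (p₀ - 1)) := by
      rw [← ENNReal.rpow_add _ _ hV0 hVt, hθ, ENNReal.rpow_one]
    have e1 : sB = sB / V * V := (ENNReal.div_mul_cancel hV0 hVt).symm
    have e2 : ∫⁻ x in B, G x = a * V := (ENNReal.div_mul_cancel hV0 hVt).symm
    calc sB ^ ((p - 1) / (p₀ - 1)) * (∫⁻ x in B, G x) ^ ((p₀ - p) / (p₀ - 1))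
        = (sB / V * V) ^ ((p - 1) / (p₀ - 1)) * (a * V) ^ ((p₀ - p) / (p₀ - 1)) := by rw [← e1, ← e2]
      _ = (sB / V) ^ ((p - 1) / (p₀ - 1)) * a ^ ((p₀ - p) / (p₀ - 1)) *
          (V ^ ((p - 1) / (p₀ - 1)) * V ^ ((p₀ - p) / (p₀ - 1))) := by
        rw [ENNReal.mul_rpow_of_nonneg _ _ (by positivity),
          ENNReal.mul_rpow_of_nonneg _ _ (by positivity)]
        ring
      _ = _ := by rw [← hVV]
  have hJ2 := ENNReal.rpow_le_rpow hJ' hp01.le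
  rw [ENNReal.mul_rpow_of_nonneg _ _ hp01.le, ← ENNReal.rpow_mul, ← ENNReal.rpow_mul,
    div_mul_cancel₀ _ hp01.ne', div_mul_cancel₀ _ hp01.ne'] at hJ2
  calc _ ≤ (c ^ (p₀ - p) * (a ^ (p₀ - p))⁻¹ * ∫⁻ x in B, W x) / V * ((sB / V) ^ (p - 1) * a ^ (p₀ - p)) := by
        gcongr
    _ = c ^ (p₀ - p) * ((∫⁻ x in B, W x) / V * (sB / V) ^ (p - 1)) * ((a ^ (p₀ - p))⁻¹ * a ^ (p₀ - p)) := by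
        rw [mul_div_assoc]; ring
    _ = c ^ (p₀ - p) * ((∫⁻ x in B, W x) / V * (sB / V) ^ (p - 1)) := by
        rw [ENNReal.inv_mul_cancel has0 hast, mul_one]
    _ ≤ _ := by gcongr

end

/-! ### Extrapolation -/

section
variable {n : ℕ} {p : ℝ} {K : ℝ≥0∞} {W : (Fin n → ℝ) → ℝ≥0∞}

lemma Wt.build (h : Wt p K W) (hK : K ≠ ⊤) (hp : 1 < p) {p₀ : ℝ} (hpp : p < p₀) (N ε : ℝ)
    (hN : 1 ≤ N) (hε : 0 < ε)
    (hb : ∀ g : (Fin n → ℝ) → ℝ≥0∞, Measurable g → (∫⁻ x, Mw volume g x ^ p * W x) ^ (1 / p) ≤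
      ENNReal.ofReal N * (∫⁻ x, g x ^ p * W x) ^ (1 / p))
    {g : (Fin n → ℝ) → ℝ≥0∞} (hg : Measurable g) (hgf : ∫⁻ x, g x ^ p * W x ≠ ⊤)
    (hg0 : ¬ g =ᵐ[volume] 0) :
    ∃ (G : (Fin n → ℝ) → ℝ≥0∞) (v : (Fin n → ℝ) → ℝ), Measurable G ∧ (∀ x, g x ≤ G x) ∧
      (∀ x, G x ≠ 0) ∧ (∀ᵐ x, G x ≠ ⊤) ∧
      (∫⁻ x, G x ^ p * W x) ^ (1 / p) ≤
        ENNReal.ofReal ((1 + ε) / ε) * (∫⁻ x, g x ^ p * W x) ^ (1 / p) ∧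
      (∀ᵐ x, ENNReal.ofReal (v x) = W x * G x ^ (-(p₀ - p))) ∧ MemAp p₀ v ∧ 1 ≤ apChar p₀ v ∧
      apChar p₀ v ≤ (1 + ε) ^ (p₀ - p) * N ^ (p₀ - p) * K.toReal := by
  have hp0 : 0 < p := by linarith
  have hs : 0 < p₀ - p := by linarith
  have hp01 : 0 < p₀ - 1 := by linarith
  have hcpos : 0 < (1 + ε) * N := by positivity
  set c := ENNReal.ofReal ((1 + ε) * N) with hc
  have hc0 : c ≠ 0 := by rw [hc]; simpa using hcpos
  have hct : c ≠ ⊤ := ENNReal.ofReal_ne_top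
  have hGn := h.RdF_norm hp hg N ε hN hε hb
  have hGm : Measurable (RdF c g) := RdF_meas hg
  have hG0 : ∀ x, RdF c g x ≠ 0 := RdF_pos hg hct hg0
  have hM : ∀ x, Mw volume (RdF c g) x ≤ c * RdF c g x := Mw_RdF hg hc0 hct
  have hle : ∀ x, g x ≤ RdF c g x := le_RdF
  have hGt : ∀ᵐ x, RdF c g x ≠ ⊤ := by
    refine h.finite_ae hp0 hGm fun ht => ?_
    rw [ht, ENNReal.top_rpow_of_pos (by positivity), top_le_iff] at hGn
    exact ENNReal.mul_ne_top ENNReal.ofReal_ne_top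
      (ENNReal.rpow_ne_top_of_nonneg (by positivity) hgf) hGn
  rw [← hc] at hGn
  generalize RdF c g = G at *
  have hnew := fun z (r : ℝ) (hr : 0 < r) => h.new_weight hp hpp hGm hG0 hGt hc0 hct hM z hr
  set V : (Fin n → ℝ) → ℝ≥0∞ := fun x => W x * G x ^ (-(p₀ - p)) with hV
  have hVm : Measurable V := h.meas.mul (hGm.pow_const _)
  have hVae : ∀ᵐ x, V x ≠ 0 ∧ V x ≠ ⊤ := by
    filter_upwards [hGt] with x hx
    refine ⟨mul_ne_zero (h.pos x) ?_, ENNReal.mul_ne_top (h.fin x)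
      (ENNReal.rpow_ne_top_of_ne_zero (hG0 x) hx)⟩
    rw [← pos_iff_ne_zero]; exact ENNReal.rpow_pos (pos_iff_ne_zero.2 (hG0 x)) hx
  have hv : ∀ᵐ x, ENNReal.ofReal ((V x).toReal) = V x := hVae.mono fun x hx =>
    ENNReal.ofReal_toReal hx.2
  have hvs : ∀ᵐ x, ENNReal.ofReal ((V x).toReal ^ (-(1 / (p₀ - 1)))) = V x ^ (-(1 / (p₀ - 1))) := by
    filter_upwards [hVae] with x hx
    rw [ENNReal.toReal_rpow, ENNReal.ofReal_toReal (ENNReal.rpow_ne_top_of_ne_zero hx.1 hx.2)]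
  have hcharle : apCharE p₀ (fun x => (V x).toReal) ≤ c ^ (p₀ - p) * K := by
    unfold apCharE
    refine iSup₂_le fun Q hQ => ?_
    obtain ⟨z, r, hr, rfl⟩ := hQ.ball
    rw [avg_congr hv, avg_congr hvs]
    exact (hnew z r hr).2
  have hbt : c ^ (p₀ - p) * K ≠ ⊤ := ENNReal.mul_ne_top (ENNReal.rpow_ne_top_of_nonneg hs.le hct) hK
  have hct' : apCharE p₀ (fun x => (V x).toReal) ≠ ⊤ := ne_top_of_le_ne_top hbt hcharle
  refine ⟨G, fun x => (V x).toReal, hGm, hle, hG0, hGt, hGn, hv, ⟨⟨?_, ?_⟩, hct'⟩, ?_, ?_⟩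
  · exact hVae.mono fun x hx => ENNReal.toReal_pos hx.1 hx.2
  · intro x
    refine ⟨Metric.closedBall x 1, Metric.closedBall_mem_nhds x one_pos, ?_⟩
    exact integrable_toReal_of_lintegral_ne_top hVm.aemeasurable (hnew x 1 one_pos).1
  · unfold apChar
    rw [← ENNReal.toReal_one]
    refine ENNReal.toReal_mono hct' ?_
    refine le_trans ?_ (le_iSup₂ (f := fun (Q : Set (Fin n → ℝ)) (_ : IsCube Q) =>
      avg Q (fun x => (V x).toReal) *
        (avg Q (fun x => (V x).toReal ^ (-(1 / (p₀ - 1))))) ^ (p₀ - 1))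
      (Metric.closedBall 0 1) (isCube_closedBall 0 1 one_pos))
    rw [avg_congr hv, avg_congr hvs]
    have hH := holder_one (p := p₀) (by linarith) hVm (Metric.closedBall (0 : Fin n → ℝ) 1) hVae
    have hV0 := vol_ne_zero (0 : Fin n → ℝ) one_pos
    have hVt := vol_ne_top (0 : Fin n → ℝ) one_pos
    set m := volume (Metric.closedBall (0 : Fin n → ℝ) 1) with hm
    rw [div_eq_mul_inv, div_eq_mul_inv, ENNReal.mul_rpow_of_nonneg _ _ hp01.le]
    have e : m⁻¹ * (m⁻¹) ^ (p₀ - 1) = (m ^ p₀)⁻¹ := by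
      rw [← ENNReal.inv_rpow]
      nth_rewrite 1 [← ENNReal.rpow_one m⁻¹]
      rw [← ENNReal.rpow_add _ _ (ENNReal.inv_ne_zero.2 hVt) (ENNReal.inv_ne_top.2 hV0)]
      congr 1; ring
    have hmp0 : m ^ p₀ ≠ 0 := by
      rw [← pos_iff_ne_zero]; exact ENNReal.rpow_pos (pos_iff_ne_zero.2 hV0) hVt
    have hmpt : m ^ p₀ ≠ ⊤ := ENNReal.rpow_ne_top_of_nonneg (by linarith) hVt
    calc (1 : ℝ≥0∞) = m ^ p₀ * (m ^ p₀)⁻¹ := (ENNReal.mul_inv_cancel hmp0 hmpt).symm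
      _ ≤ _ * (m ^ p₀)⁻¹ := by
        refine mul_le_mul' hH le_rfl
      _ = _ := by rw [← e]; ring
  · unfold apChar
    refine (ENNReal.toReal_mono hbt hcharle).trans (le_of_eq ?_)
    rw [ENNReal.toReal_mul, ← ENNReal.toReal_rpow, hc, ENNReal.toReal_ofReal hcpos.le,
      Real.mul_rpow (by positivity) (by positivity)]

lemma Wt.holder_down (h : Wt p K W) (hp : 1 < p) {p₀ : ℝ} (hpp : p < p₀)
    {G k : (Fin n → ℝ) → ℝ≥0∞} (hG : Measurable G) (hk : Measurable k)
    (hG0 : ∀ x, G x ≠ 0) (hGt : ∀ᵐ x, G x ≠ ⊤) :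
    (∫⁻ x, k x ^ p * W x) ^ (1 / p) ≤
      (∫⁻ x, k x ^ p₀ * (W x * G x ^ (-(p₀ - p)))) ^ (1 / p₀) *
        ((∫⁻ x, G x ^ p * W x) ^ (1 / p)) ^ ((p₀ - p) / p₀) := by
  have hp0 : 0 < p := by linarith
  have hs : 0 < p₀ - p := by linarith
  have hp00 : 0 < p₀ := by linarith
  have hθ : p / p₀ + (p₀ - p) / p₀ = 1 := by field_simp; ring
  have hH := ENNReal.lintegral_mul_norm_pow_le (μ := volume)
    (f := fun x => k x ^ p₀ * (W x * G x ^ (-(p₀ - p)))) (g := fun x => G x ^ p * W x)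
    ((hk.pow_const _).mul (h.meas.mul (hG.pow_const _))).aemeasurable
    ((hG.pow_const _).mul h.meas).aemeasurable (p := p / p₀) (q := (p₀ - p) / p₀)
    (by positivity) (by positivity) hθ
  have e : ∫⁻ x, (k x ^ p₀ * (W x * G x ^ (-(p₀ - p)))) ^ (p / p₀) *
      (G x ^ p * W x) ^ ((p₀ - p) / p₀) = ∫⁻ x, k x ^ p * W x := by
    refine lintegral_congr_ae (hGt.mono fun x hx => ?_)
    simp only
    rw [ENNReal.mul_rpow_of_nonneg _ _ (by positivity), ENNReal.mul_rpow_of_nonneg _ _ (by positivity),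
      ENNReal.mul_rpow_of_nonneg _ _ (by positivity), ← ENNReal.rpow_mul, ← ENNReal.rpow_mul,
      ← ENNReal.rpow_mul, mul_div_cancel₀ _ hp00.ne']
    have e1 : G x ^ (-(p₀ - p) * (p / p₀)) * G x ^ (p * ((p₀ - p) / p₀)) = 1 := by
      rw [← ENNReal.rpow_add _ _ (hG0 x) hx]
      have : -(p₀ - p) * (p / p₀) + p * ((p₀ - p) / p₀) = 0 := by field_simp; ring
      rw [this, ENNReal.rpow_zero]
    have e2 : W x ^ (p / p₀) * W x ^ ((p₀ - p) / p₀) = W x := by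
      rw [← ENNReal.rpow_add _ _ (h.pos x) (h.fin x), hθ, ENNReal.rpow_one]
    calc _ = k x ^ p * (W x ^ (p / p₀) * W x ^ ((p₀ - p) / p₀)) *
        (G x ^ (-(p₀ - p) * (p / p₀)) * G x ^ (p * ((p₀ - p) / p₀))) := by ring
      _ = _ := by rw [e1, e2, mul_one]
  rw [e] at hH
  refine (ENNReal.rpow_le_rpow hH (by positivity : 0 ≤ 1 / p)).trans (le_of_eq ?_)
  rw [ENNReal.mul_rpow_of_nonneg _ _ (by positivity), ← ENNReal.rpow_mul, ← ENNReal.rpow_mul,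
    ← ENNReal.rpow_mul]
  congr 2
  · field_simp
  · ring

lemma Wt.norm_down (hp : 1 < p) {p₀ : ℝ} (hpp : p < p₀)
    {G k : (Fin n → ℝ) → ℝ≥0∞} (hkt : ∀ x, k x ≠ ⊤) (hkG : ∀ᵐ x, k x ≤ G x) :
    (∫⁻ x, k x ^ p₀ * (W x * G x ^ (-(p₀ - p)))) ^ (1 / p₀) ≤
      ((∫⁻ x, k x ^ p * W x) ^ (1 / p)) ^ (p / p₀) := by
  have hp0 : 0 < p := by linarith
  have hs : 0 < p₀ - p := by linarith
  have hp00 : 0 < p₀ := by linarith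
  have e : 1 / p * (p / p₀) = 1 / p₀ := by field_simp
  rw [← ENNReal.rpow_mul, e]
  refine ENNReal.rpow_le_rpow (lintegral_mono_ae (hkG.mono fun x hx => ?_)) (by positivity)
  by_cases h0 : k x = 0
  · simp [h0, ENNReal.zero_rpow_of_pos hp00]
  · have h1 : G x ^ (-(p₀ - p)) ≤ k x ^ (-(p₀ - p)) := by
      rw [ENNReal.rpow_neg, ENNReal.rpow_neg]
      exact ENNReal.inv_le_inv.2 (ENNReal.rpow_le_rpow hx hs.le)
    calc k x ^ p₀ * (W x * G x ^ (-(p₀ - p))) ≤ k x ^ p₀ * (W x * k x ^ (-(p₀ - p))) := by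
          gcongr k x ^ p₀ * (W x * ?_)
      _ = (k x ^ p₀ * k x ^ (-(p₀ - p))) * W x := by ring
      _ = _ := by
        rw [← ENNReal.rpow_add _ _ h0 (hkt x)]
        congr 2; ring

end

/-- **Quantitative flat extrapolation, downward case** (`p < p₀`). If
`‖Tf‖_{L^{p₀}(v)} ≤ F([v]_{A_{p₀}}) ‖f‖_{L^{p₀}(v)}` for every `v ∈ A_{p₀}` with
`[v]_{A_{p₀}} ≤ 1 + δ₀`, and `w ∈ A_p` satisfies
`(1+ε)^{p₀-p} ‖M‖_{p,w}^{p₀-p} [w]_{A_p} ≤ 1 + δ₀`, then for every `f ∈ L^p(w)`,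
`‖Tf‖_{L^p(w)} ≤ ((1+ε)/ε)^{(p₀-p)/p₀} F((1+ε)^{p₀-p} ‖M‖_{p,w}^{p₀-p} [w]_{A_p}) ‖f‖_{L^p(w)}`. -/
theorem flat_extrapolation_downward
    (n : ℕ) (p p₀ ε δ₀ : ℝ) (hp : 1 < p) (hpp₀ : p < p₀)
    (hε : 0 < ε) (hε1 : ε < 1) (hδ₀ : 0 < δ₀)
    (F : ℝ → ℝ) (hFpos : ∀ x : ℝ, 1 ≤ x → 0 < F x)
    (hFmono : ∀ x y : ℝ, 1 ≤ x → x ≤ y → F x ≤ F y)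
    (T : ((Fin n → ℝ) → ℝ) → (Fin n → ℝ) → ℝ)
    (hT : ∀ f, Measurable f → Measurable (T f))
    (hyp : ∀ v : (Fin n → ℝ) → ℝ, MemAp p₀ v → apChar p₀ v ≤ 1 + δ₀ →
      ∀ f, MemLpW p₀ v f →
        eLpNormW p₀ v (T f) ≤ ENNReal.ofReal (F (apChar p₀ v)) * eLpNormW p₀ v f)
    (w : (Fin n → ℝ) → ℝ) (hw : MemAp p w)
    (hflat : (1 + ε) ^ (p₀ - p) * opNorm p w maximal ^ (p₀ - p) * apChar p w ≤ 1 + δ₀) :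
    ∀ f, MemLpW p w f →
      eLpNormW p w (T f)
        ≤ ENNReal.ofReal (((1 + ε) / ε) ^ ((p₀ - p) / p₀) *
            F ((1 + ε) ^ (p₀ - p) * opNorm p w maximal ^ (p₀ - p) * apChar p w)) *
          eLpNormW p w f := by
  intro f hf
  have hp0 : 0 < p := by linarith
  have hp00 : 0 < p₀ := by linarith
  have hs : 0 < p₀ - p := by linarith
  obtain ⟨W, h, hwW⟩ := exists_Wt hw
  have hK := hw.2
  have hN := h.one_le_opNorm hp hK hwW
  have hb := h.Mw_bound hp hK hwW
  have key : ∀ g : (Fin n → ℝ) → ℝ≥0∞, Measurable g → ∫⁻ x, g x ^ p * W x ≠ ⊤ →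
      ¬ g =ᵐ[volume] 0 → (∀ᵐ x, ENNReal.ofReal |f x| ≤ g x) →
      eLpNormW p w (T f) ≤ ENNReal.ofReal
          (F ((1 + ε) ^ (p₀ - p) * opNorm p w maximal ^ (p₀ - p) * apChar p w)) *
          eLpNormW p w f ^ (p / p₀) *
        (ENNReal.ofReal ((1 + ε) / ε) * (∫⁻ x, g x ^ p * W x) ^ (1 / p)) ^ ((p₀ - p) / p₀) := by
    intro g hg hgf hg0 hfg
    obtain ⟨G, v, hG, hgG, hG0, hGt, hGn, hvV, hv, h1, hle⟩ :=
      h.build hK hp hpp₀ (opNorm p w maximal) ε hN hε hb hg hgf hg0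
    have hTm : Measurable fun x => ENNReal.ofReal |T f x| :=
      ((hT f hf.1).abs).ennreal_ofReal
    have hfG : ∀ᵐ x, ENNReal.ofReal |f x| ≤ G x := hfg.mono fun x hx => hx.trans (hgG x)
    have hnd := Wt.norm_down (W := W) hp hpp₀ (G := G) (k := fun x => ENNReal.ofReal |f x|)
      (fun x => ENNReal.ofReal_ne_top) hfG
    have hhd := h.holder_down hp hpp₀ hG hTm hG0 hGt
    rw [← eLpNormW_eq hp00 hvV, ← eLpNormW_eq hp0 hwW] at hnd
    rw [← eLpNormW_eq hp00 hvV, ← eLpNormW_eq hp0 hwW] at hhd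
    have hfv : MemLpW p₀ v f := ⟨hf.1, ne_top_of_le_ne_top
      (ENNReal.rpow_ne_top_of_nonneg (by positivity) hf.2) hnd⟩
    have hTv := hyp v hv (hle.trans hflat) f hfv
    refine hhd.trans (mul_le_mul' (hTv.trans (mul_le_mul' ?_ hnd))
      (ENNReal.rpow_le_rpow hGn (by positivity)))
    exact ENNReal.ofReal_le_ofReal (hFmono _ _ h1 hle)
  by_cases hf0 : (fun x => ENNReal.ofReal |f x|) =ᵐ[volume] 0
  · have hBm : MeasurableSet (Metric.closedBall (0 : Fin n → ℝ) 1) :=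
      Metric.isClosed_closedBall.measurableSet
    have hzero : eLpNormW p w f = 0 := by
      rw [eLpNormW_eq hp0 hwW]
      have : ∫⁻ x, ENNReal.ofReal |f x| ^ p * W x = 0 := by
        rw [← lintegral_zero (μ := (volume : Measure (Fin n → ℝ)))]
        refine lintegral_congr_ae (hf0.mono fun x hx => ?_)
        simp only [Pi.zero_apply] at hx
        simp only [hx, ENNReal.zero_rpow_of_pos hp0, zero_mul]
      rw [this, ENNReal.zero_rpow_of_pos (by positivity)]
    have := key ((Metric.closedBall (0 : Fin n → ℝ) 1).indicator fun _ => 1)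
      (measurable_const.indicator hBm) ?_ ?_ ?_
    · rw [hzero, ENNReal.zero_rpow_of_pos (by positivity), mul_zero, zero_mul] at this
      exact this.trans zero_le
    · have e : ∀ x, (Metric.closedBall (0 : Fin n → ℝ) 1).indicator (fun _ => (1 : ℝ≥0∞)) x ^ p * W x
          = (Metric.closedBall (0 : Fin n → ℝ) 1).indicator W x := by
        intro x
        by_cases hx : x ∈ Metric.closedBall (0 : Fin n → ℝ) 1
        · simp only [indicator_of_mem hx, ENNReal.one_rpow, one_mul]
        · simp only [indicator_of_notMem hx, ENNReal.zero_rpow_of_pos hp0, zero_mul]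
      simp only [e]
      rw [lintegral_indicator hBm]
      exact h.loc 0 1 one_pos
    · intro h0
      rw [← lintegral_eq_zero_iff (measurable_const.indicator hBm), lintegral_indicator hBm] at h0
      simp only [lintegral_const, one_mul, Measure.restrict_apply_univ] at h0
      exact vol_ne_zero 0 one_pos h0
    · filter_upwards [hf0] with x hx
      rw [hx]; exact zero_le
  · have hfin : ∫⁻ x, ENNReal.ofReal |f x| ^ p * W x ≠ ⊤ := by
      intro ht
      apply hf.2
      rw [eLpNormW_eq hp0 hwW, ht, ENNReal.top_rpow_of_pos (by positivity)]
    have hk := key (fun x => ENNReal.ofReal |f x|) hf.1.abs.ennreal_ofReal hfin hf0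
      (Eventually.of_forall fun x => le_rfl)
    rw [← eLpNormW_eq hp0 hwW] at hk
    refine hk.trans (le_of_eq ?_)
    have hθ : p / p₀ + (p₀ - p) / p₀ = 1 := by field_simp; ring
    rw [ENNReal.mul_rpow_of_nonneg _ _ (by positivity),
      ENNReal.ofReal_rpow_of_nonneg (by positivity) (by positivity),
      ENNReal.ofReal_mul (by positivity)]
    have e : eLpNormW p w f ^ (p / p₀) * eLpNormW p w f ^ ((p₀ - p) / p₀) = eLpNormW p w f := by
      rw [← ENNReal.rpow_add_of_nonneg _ _ (by positivity) (by positivity), hθ, ENNReal.rpow_one]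
    nth_rewrite 3 [← e]
    ring
end
end
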